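/- Entropy gap for discrete subgroups: For every integer d ≥ 1 there is a constant s = s(d) > 0 with the following property. Let n ≥ 0, let k₁,…,kₙ be non-Archimedean local fields, and let Γ be a finitely generated discrete subgroup of GL_d(ℝ) × GL_d(k₁) × … × GL_d(kₙ) that is not virtually nilpotent. Then for every finite generating set Σ of Γ with 1 ∈ Σ (not necessarily symmetric), liminf_{m→∞} (1/m)·log #(Σ^m) ≥ s. In particular the algebraic entropy S_Γ = inf over such Σ of lim (1/m) log #(Σ^m) satisfies S_Γ ≥ s > 0. -/

import Mathlib

open Matrix Pointwise

set_option linter.unusedVariables false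
set_option linter.unusedSimpArgs false

namespace EG

/-- words of equal length in `a`, `b` are pairwise distinct -/
def FreePair {G : Type*} [Group G] (a b : G) : Prop :=
  ∀ l l' : List Bool, l.length = l'.length →
    (l.map (fun t => cond t a b)).prod = (l'.map (fun t => cond t a b)).prod → l = l'

/-- no free pair among the elements of `S ^ N` -/
def NoFree {G : Type*} [Group G] (S : Set G) (N : ℕ) : Prop :=
  ∀ a ∈ S ^ N, ∀ b ∈ S ^ N, ¬ FreePair a b

lemma pow_mono_set {G : Type*} [Group G] {S : Set G} (h1 : (1 : G) ∈ S) {m n : ℕ} (h : m ≤ n) :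
    S ^ m ⊆ S ^ n := Set.pow_subset_pow_right h1 h

lemma NoFree.mono {G : Type*} [Group G] {S : Set G} (h1 : (1 : G) ∈ S) {m n : ℕ} (h : m ≤ n)
    (hn : NoFree S n) : NoFree S m := fun a ha b hb =>
  hn a (pow_mono_set h1 h ha) b (pow_mono_set h1 h hb)

lemma NoFree.of_subset {G : Type*} [Group G] {S T : Set G} {m k n : ℕ} (hT : T ⊆ S ^ m)
    (hS : NoFree S n) (hk : m * k = n) : NoFree T k := by
  intro a ha b hb
  have : T ^ k ⊆ S ^ n := by
    rw [← hk, pow_mul]; exact Set.pow_subset_pow_left hT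
  exact hS a (this ha) b (this hb)

lemma FreePair.map {G H : Type*} [Group G] [Group H] (f : G →* H) (hf : Function.Injective f)
    {a b : G} (h : FreePair a b) : FreePair (f a) (f b) := by
  intro l l' hl he
  have key : ∀ l : List Bool, (l.map (fun t => cond t (f a) (f b))).prod
      = f ((l.map (fun t => cond t a b)).prod) := by
    intro l
    rw [map_list_prod, List.map_map]
    congr 1
    apply List.map_congr_left
    intro t _
    cases t <;> rfl
  rw [key, key] at he
  exact h l l' hl (hf he)

lemma NoFree.comap {G H : Type*} [Group G] [Group H] (f : G →* H) (hf : Function.Injective f)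
    {T : Set G} {S : Set H} {m k n : ℕ} (hT : f '' T ⊆ S ^ m)
    (hS : NoFree S n) (hk : m * k = n) : NoFree T k := by
  intro a ha b hb hab
  have h2 : f '' (T ^ k) ⊆ S ^ n := by
    rw [Set.image_pow, ← hk, pow_mul]; exact Set.pow_subset_pow_left hT
  exact hS _ (h2 ⟨a, ha, rfl⟩) _ (h2 ⟨b, hb, rfl⟩) (hab.map f hf)

lemma pingpong {G M : Type*} [Group G] [Monoid M] (φ : G →* M) (a b : G) (Ω : Set M)
    (hne : Ω.Nonempty) (ha : ∀ x ∈ Ω, φ a * x ∈ Ω) (hb : ∀ x ∈ Ω, φ b * x ∈ Ω)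
    (hd : ∀ x ∈ Ω, ∀ y ∈ Ω, φ a * x ≠ φ b * y) : FreePair a b := by
  have hw : ∀ l : List Bool, ∀ x ∈ Ω, φ ((l.map (fun t => cond t a b)).prod) * x ∈ Ω := by
    intro l
    induction l with
    | nil => intro x hx; simpa using hx
    | cons t l ih =>
      intro x hx
      rw [List.map_cons, List.prod_cons, map_mul, mul_assoc]
      cases t
      · exact hb _ (ih x hx)
      · exact ha _ (ih x hx)
  obtain ⟨x, hx⟩ := hne
  intro l
  induction l with
  | nil => intro l' h _; exact (List.length_eq_zero_iff.mp h.symm).symm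
  | cons t l ih =>
    intro l' hl he
    cases l' with
    | nil => simp at hl
    | cons t' l' =>
      have hl2 : l.length = l'.length := by simpa using hl
      simp only [List.map_cons, List.prod_cons] at he
      have he2 := congrArg (fun g => φ g * x) he
      simp only [map_mul, mul_assoc] at he2
      have h1 := hw l x hx
      have h2 := hw l' x hx
      cases t <;> cases t'
      · rw [ih l' hl2 (mul_left_cancel he)]
      · exact absurd he2.symm (hd _ h2 _ h1)
      · exact absurd he2 (hd _ h1 _ h2)
      · rw [ih l' hl2 (mul_left_cancel he)]

lemma FreePair.of_inv {G : Type*} [Group G] {a b : G} (h : FreePair a⁻¹ b⁻¹) : FreePair a b := by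
  have key : ∀ l : List Bool, (l.reverse.map (fun t => cond t a⁻¹ b⁻¹)).prod
      = ((l.map (fun t => cond t a b)).prod)⁻¹ := by
    intro l
    rw [List.prod_inv_reverse, List.map_map, List.map_reverse]
    congr 2
    apply List.map_congr_left
    intro t _
    cases t <;> rfl
  intro l l' hl he
  have := h l.reverse l'.reverse (by simpa using hl) (by rw [key, key, he])
  exact List.reverse_injective this

lemma NoFree.inv {G : Type*} [Group G] {S : Set G} {N : ℕ} (h : NoFree S N) : NoFree S⁻¹ N := by
  intro a ha b hb hab
  rw [inv_pow] at ha hb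
  refine h a⁻¹ ha b⁻¹ hb (FreePair.of_inv ?_)
  simpa using hab

/-- the entropy link -/
lemma entropy_of_freePair {G : Type*} [Group G] (S : Set G) (hS : S.Finite) (h1 : (1 : G) ∈ S)
    (N : ℕ) (hN : 1 ≤ N) (h : ¬ NoFree S N) :
    Real.log 2 / (2 * N) ≤ Filter.liminf (fun m : ℕ => Real.log ((S ^ m).ncard) / m)
      Filter.atTop := by
  simp only [NoFree, not_forall, not_not] at h
  obtain ⟨a, ha, b, hb, hab⟩ := h
  have hfin : ∀ m, (S ^ m).Finite := by
    intro m
    induction m with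
    | zero => simp
    | succ m ih => rw [pow_succ]; exact ih.mul hS
  have hcard : ∀ n, 2 ^ n ≤ (S ^ (N * n)).ncard := by
    intro n
    have hinj : Function.Injective (fun v : List.Vector Bool n =>
        (v.toList.map (fun t => cond t a b)).prod) := by
      intro v w hvw
      apply List.Vector.toList_injective
      exact hab _ _ (by simp) hvw
    have hmem : ∀ l : List Bool, (l.map (fun t => cond t a b)).prod ∈ S ^ (N * l.length) := by
      intro l
      induction l with
      | nil => simp
      | cons t l ih =>
        rw [List.map_cons, List.prod_cons, List.length_cons, mul_add, mul_one, add_comm, pow_add]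
        refine Set.mul_mem_mul ?_ ih
        cases t <;> assumption
    have hsub : Set.range (fun v : List.Vector Bool n =>
        (v.toList.map (fun t => cond t a b)).prod) ⊆ S ^ (N * n) := by
      rintro _ ⟨v, rfl⟩
      have := hmem v.toList
      simpa using this
    have := Set.ncard_le_ncard hsub (hfin _)
    rw [← Set.image_univ, Set.ncard_image_of_injective _ hinj, Set.ncard_univ] at this
    simpa using this
  have hpos : ∀ m, 1 ≤ (S ^ m).ncard := by
    intro m
    rw [Nat.one_le_iff_ne_zero, Ne, Set.ncard_eq_zero (hfin m), ← Ne, ← Set.nonempty_iff_ne_empty]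
    exact ⟨1, Set.one_mem_pow h1⟩
  refine Filter.le_liminf_of_le ?_ ?_
  · -- cobounded
    refine Filter.IsBoundedUnder.isCoboundedUnder_ge ?_
    refine ⟨Real.log S.ncard, ?_⟩
    rw [Filter.eventually_map, Filter.eventually_atTop]
    refine ⟨1, fun m hm => ?_⟩
    have hm' : (0 : ℝ) < m := by exact_mod_cast hm
    show Real.log ((S ^ m).ncard) / m ≤ Real.log S.ncard
    rw [div_le_iff₀ hm', mul_comm, ← Real.log_pow]
    apply Real.log_le_log (by exact_mod_cast hpos m)
    have : (S ^ m).ncard ≤ S.ncard ^ m := by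
      clear hm hm'
      induction m with
      | zero => rw [pow_zero, pow_zero, ← Set.singleton_one, Set.ncard_singleton]
      | succ m ih =>
        rw [pow_succ, pow_succ]
        refine le_trans ?_ (Nat.mul_le_mul_right _ ih)
        simp only [Set.ncard_eq_toFinset_card _ ((hfin m).mul hS), Set.ncard_eq_toFinset_card _ (hfin m),
          Set.ncard_eq_toFinset_card _ hS]
        classical
        rw [Set.Finite.toFinset_mul]
        exact Finset.card_mul_le
    exact_mod_cast this
  · rw [Filter.eventually_atTop]
    refine ⟨N, fun m hm => ?_⟩
    have hNpos : (0 : ℝ) < N := by exact_mod_cast hN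
    have hm' : (0 : ℝ) < m := by exact_mod_cast (lt_of_lt_of_le hN hm)
    rw [div_le_div_iff₀ (by positivity) hm']
    have hq : m ≤ 2 * N * (m / N) := by
      have h3 := Nat.div_add_mod m N
      have h4 := Nat.mod_lt m hN
      have h5 : 1 ≤ m / N := (Nat.one_le_div_iff hN).mpr hm
      nlinarith
    have hc : (2 : ℝ) ^ (m / N) ≤ (S ^ m).ncard := by
      have h3 := hcard (m / N)
      have h4 := Set.ncard_le_ncard (pow_mono_set h1 (Nat.mul_div_le m N)) (hfin m)
      exact_mod_cast h3.trans h4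
    have hl : ((m / N : ℕ) : ℝ) * Real.log 2 ≤ Real.log (S ^ m).ncard := by
      rw [← Real.log_pow]
      exact Real.log_le_log (by positivity) hc
    have hq' : (m : ℝ) ≤ 2 * N * ((m / N : ℕ) : ℝ) := by exact_mod_cast hq
    have hl2 : 0 ≤ Real.log 2 := Real.log_nonneg (by norm_num)
    nlinarith [mul_le_mul_of_nonneg_right hq' hl2, mul_le_mul_of_nonneg_left hl (by positivity : (0:ℝ) ≤ 2 * N)]


/-- coset image -/
def cosetImg {G : Type*} [Group G] (S : Set G) (H : Subgroup G) (k : ℕ) : Set (G ⧸ H) :=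
  (fun g : G => (g : G ⧸ H)) '' (S ^ k)

lemma cosetImg_univ {G : Type*} [Group G] (S : Set G) (h1 : (1 : G) ∈ S)
    (hS : Subgroup.closure S = ⊤) (H : Subgroup G) (M : ℕ) (hf : (cosetImg S H M).Finite)
    (hM : (cosetImg S H M).ncard ≤ M) : cosetImg S H M = Set.univ := by
  have mono : ∀ {i j}, i ≤ j → cosetImg S H i ⊆ cosetImg S H j := fun h =>
    Set.image_mono (pow_mono_set h1 h)
  have step : ∃ k < M, cosetImg S H k = cosetImg S H (k + 1) := by
    by_contra hcon
    push Not at hcon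
    have : ∀ k ≤ M, k + 1 ≤ (cosetImg S H k).ncard := by
      intro k
      induction k with
      | zero => intro _; simp [cosetImg]
      | succ k ih =>
        intro hk
        have h2 : cosetImg S H k ⊂ cosetImg S H (k + 1) :=
          lt_of_le_of_ne (mono (Nat.le_succ k)) (hcon k hk)
        have h3 := Set.ncard_lt_ncard h2 (hf.subset (mono hk))
        have := ih (by omega)
        omega
    have := this M le_rfl
    omega
  obtain ⟨k, hk, he⟩ := step
  have hfk : (cosetImg S H k).Finite := hf.subset (mono hk.le)
  have hstab : ∀ s ∈ S, s • cosetImg S H k = cosetImg S H k := by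
    intro s hs
    refine Set.eq_of_subset_of_ncard_le ?_ ?_ hfk
    · rintro _ ⟨_, ⟨g, hg, rfl⟩, rfl⟩
      rw [he]
      refine ⟨s * g, ?_, rfl⟩
      rw [pow_succ']
      exact Set.mul_mem_mul hs hg
    · rw [Set.ncard_smul_set]
  have hst : Subgroup.closure S ≤ MulAction.stabilizer G (cosetImg S H k) := by
    rw [Subgroup.closure_le]
    intro s hs
    exact hstab s hs
  rw [hS] at hst
  rw [Set.eq_univ_iff_forall]
  intro x
  obtain ⟨g, rfl⟩ := QuotientGroup.mk_surjective x
  apply mono hk.le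
  have h2 : g • cosetImg S H k = cosetImg S H k := hst (Subgroup.mem_top g)
  rw [← h2]
  refine ⟨((1 : G) : G ⧸ H), ⟨1, Set.one_mem_pow h1, rfl⟩, ?_⟩
  show ((g * 1 : G) : G ⧸ H) = _
  rw [mul_one]

lemma index_of_univ {G : Type*} [Group G] (S : Set G) (H : Subgroup G) (M : ℕ)
    (hf : (cosetImg S H M).Finite) (hM : (cosetImg S H M).ncard ≤ M)
    (hu : cosetImg S H M = Set.univ) : H.index ≠ 0 ∧ H.index ≤ M := by
  rw [hu] at hf hM
  rw [Set.ncard_univ] at hM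
  have : Finite (G ⧸ H) := Set.finite_univ_iff.mp hf
  exact ⟨Subgroup.index_ne_zero_of_finite, hM⟩

/-- pigeonhole criterion for finite index -/
lemma index_le_of_collision {G : Type*} [Group G] (S : Set G) (h1 : (1 : G) ∈ S)
    (hS : Subgroup.closure S = ⊤) (H : Subgroup G) (M : ℕ)
    (hcol : ∀ f : Fin (M + 1) → G, (∀ i, f i ∈ S ^ M) → ∃ i j, i ≠ j ∧ (f i)⁻¹ * f j ∈ H) :
    H.index ≠ 0 ∧ H.index ≤ M := by
  have key : (cosetImg S H M).encard ≤ M := by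
    by_contra hcon
    push Not at hcon
    have h2 : ((M + 1 : ℕ) : ℕ∞) ≤ (cosetImg S H M).encard := by
      exact_mod_cast Order.add_one_le_of_lt hcon
    obtain ⟨t, ht, htc⟩ := Set.exists_subset_encard_eq h2
    have htf : t.Finite := Set.finite_of_encard_eq_coe htc
    have htn : t.ncard = M + 1 := by
      rw [Set.ncard_def, htc]; rfl
    have hcard : Nat.card t = M + 1 := by rw [Nat.card_coe_set_eq, htn]
    have := htf.to_subtype
    have e : t ≃ Fin (M + 1) := Finite.equivFinOfCardEq hcard
    choose g hg hg2 using fun i : Fin (M + 1) => ht (e.symm i).2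
    obtain ⟨i, j, hij, hH⟩ := hcol g hg
    apply hij
    have h3 : ((g i : G) : G ⧸ H) = (g j : G ⧸ H) := QuotientGroup.eq.mpr hH
    simp only at hg2
    rw [hg2, hg2] at h3
    exact e.symm.injective (Subtype.ext h3)
  have hf : (cosetImg S H M).Finite := Set.finite_of_encard_le_coe key
  have hM : (cosetImg S H M).ncard ≤ M := by
    rw [← hf.cast_ncard_eq] at key
    exact_mod_cast key
  exact index_of_univ S H M hf hM (cosetImg_univ S h1 hS H M hf hM)

lemma exists_rep {G : Type*} [Group G] (S : Set G) (h1 : (1 : G) ∈ S)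
    (hS : Subgroup.closure S = ⊤) (H : Subgroup G) (M : ℕ) (h0 : H.index ≠ 0) (hM : H.index ≤ M)
    (c : G ⧸ H) : ∃ r ∈ S ^ M, (r : G ⧸ H) = c := by
  have : Finite (G ⧸ H) := Nat.finite_of_card_ne_zero h0
  have hf : (cosetImg S H M).Finite := Set.toFinite _
  have h2 : (cosetImg S H M).ncard ≤ M := (Set.ncard_le_card _).trans hM
  have := cosetImg_univ S h1 hS H M hf h2
  have hc : c ∈ cosetImg S H M := by rw [this]; trivial
  obtain ⟨r, hr, rfl⟩ := hc
  exact ⟨r, hr, rfl⟩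

/-- positive Schreier generators -/
lemma posGen {G : Type*} [Group G] (S : Set G) (h1 : (1 : G) ∈ S)
    (hS : Subgroup.closure S = ⊤) (H : Subgroup G) (M : ℕ) (h0 : H.index ≠ 0) (hM : H.index ≤ M) :
    Subgroup.closure ((H : Set G) ∩ S ^ (M * M + M + 1)) = H := by
  classical
  set K := Subgroup.closure ((H : Set G) ∩ S ^ (M * M + M + 1)) with hK
  have hKH : K ≤ H := by
    rw [hK, Subgroup.closure_le]; exact Set.inter_subset_left
  have hr : ∃ r : G ⧸ H → G, r ((1 : G) : G ⧸ H) = 1 ∧ ∀ c, r c ∈ S ^ M ∧ ((r c : G) : G ⧸ H) = c := by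
    choose r hr1 hr2 using exists_rep S h1 hS H M h0 hM
    refine ⟨fun c => if c = ((1 : G) : G ⧸ H) then 1 else r c, by simp, fun c => ?_⟩
    by_cases hc : c = ((1 : G) : G ⧸ H)
    · simp [hc, Set.one_mem_pow h1]
    · simp [hc, hr1, hr2]
  obtain ⟨r, hr1, hr⟩ := hr
  have hM1 : 1 ≤ M := by omega
  have hpow : ∀ g : G, ∃ j, j + 1 ≤ M ∧ g ^ (j + 1) ∈ H := by
    intro g
    obtain ⟨n, hn0, hn, hg⟩ := Subgroup.exists_pow_mem_of_index_ne_zero h0 g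
    exact ⟨n - 1, by omega, by rwa [Nat.sub_add_cancel hn0]⟩
  have hSm : ∀ {g : G} {i : ℕ}, g ∈ S ^ i → i ≤ M * M + M + 1 → g ∈ H → g ∈ K := by
    intro g i hg hi hgH
    exact Subgroup.subset_closure ⟨hgH, pow_mono_set h1 hi hg⟩
  -- Schreier generators lie in `K`
  have hu : ∀ s ∈ S, ∀ c : G ⧸ H, (r (s • c))⁻¹ * s * r c ∈ K := by
    intro s hs c
    set x := r (s • c)
    obtain ⟨j, hj, hxH⟩ := hpow x
    have hxS : x ∈ S ^ M := (hr _).1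
    have huH : x⁻¹ * s * r c ∈ H := by
      rw [mul_assoc, ← QuotientGroup.eq]
      rw [(hr _).2]
      show s • c = s • ((r c : G) : G ⧸ H)
      rw [(hr c).2]
    have e1 : x ^ (j + 1) ∈ K := by
      refine hSm (i := M * (j + 1)) ?_ (by nlinarith) hxH
      rw [pow_mul]; exact Set.pow_mem_pow hxS
    have e2 : x ^ j * s * r c ∈ K := by
      refine hSm (i := M * j + 1 + M) ?_ (by nlinarith) ?_
      · rw [pow_add, pow_add, pow_one, pow_mul]
        exact Set.mul_mem_mul (Set.mul_mem_mul (Set.pow_mem_pow hxS) hs) (hr c).1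
      · have := H.mul_mem hxH huH
        rw [pow_succ] at this
        convert this using 1
        group
    have := K.mul_mem (K.inv_mem e1) e2
    convert this using 1
    rw [pow_succ]; group
  have hall : ∀ g : G, ∀ c : G ⧸ H, (r (g • c))⁻¹ * g * r c ∈ K := by
    intro g
    have hg : g ∈ Subgroup.closure S := by rw [hS]; trivial
    induction hg using Subgroup.closure_induction with
    | mem s hs => exact hu s hs
    | one => intro c; simp
    | mul x y _ _ hx hy =>
      intro c
      have := K.mul_mem (hx (y • c)) (hy c)
      rw [← mul_smul] at this
      convert this using 1
      group
    | inv x _ hx =>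
      intro c
      have := K.inv_mem (hx (x⁻¹ • c))
      rw [smul_inv_smul] at this
      convert this using 1
      group
  refine le_antisymm hKH fun g hg => ?_
  have h2 := hall g ((1 : G) : G ⧸ H)
  have h3 : g • ((1 : G) : G ⧸ H) = ((1 : G) : G ⧸ H) := by
    show ((g * 1 : G) : G ⧸ H) = _
    rw [mul_one]
    exact (QuotientGroup.eq.mpr (by simpa using hg)).symm
  rw [h3, hr1] at h2
  simpa using h2

end EG

namespace EG

section nm
variable {K : Type*} [Field K] (v : AbsoluteValue K ℝ)
variable {ι κ l : Type*} [Fintype ι] [Fintype κ] [Fintype l]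

/-- the sum norm -/
def nm (A : Matrix ι κ K) : ℝ := ∑ i, ∑ j, v (A i j)

lemma nm_nonneg (A : Matrix ι κ K) : 0 ≤ nm v A :=
  Finset.sum_nonneg fun _ _ => Finset.sum_nonneg fun _ _ => v.nonneg _

lemma entry_le (A : Matrix ι κ K) (i : ι) (j : κ) : v (A i j) ≤ nm v A := by
  unfold nm
  refine le_trans ?_ (Finset.single_le_sum (f := fun i => ∑ j, v (A i j))
    (fun _ _ => Finset.sum_nonneg fun _ _ => v.nonneg _) (Finset.mem_univ i))
  exact Finset.single_le_sum (f := fun j => v (A i j)) (fun _ _ => v.nonneg _) (Finset.mem_univ j)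

lemma row_le (A : Matrix ι κ K) (i : ι) : ∑ j, v (A i j) ≤ nm v A :=
  Finset.single_le_sum (f := fun i => ∑ j, v (A i j))
    (fun _ _ => Finset.sum_nonneg fun _ _ => v.nonneg _) (Finset.mem_univ i)

@[simp] lemma nm_zero : nm v (0 : Matrix ι κ K) = 0 := by simp [nm]

lemma nm_eq_zero {A : Matrix ι κ K} : nm v A = 0 ↔ A = 0 := by
  constructor
  · intro h
    ext i j
    have := entry_le v A i j
    rw [h] at this
    exact v.eq_zero.mp (le_antisymm this (v.nonneg _))
  · rintro rfl; simp

lemma nm_pos {A : Matrix ι κ K} (h : A ≠ 0) : 0 < nm v A :=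
  lt_of_le_of_ne (nm_nonneg v A) (fun h' => h ((nm_eq_zero v).mp h'.symm))

lemma nm_add_le (A B : Matrix ι κ K) : nm v (A + B) ≤ nm v A + nm v B := by
  unfold nm
  simp only [← Finset.sum_add_distrib]
  exact Finset.sum_le_sum fun i _ => Finset.sum_le_sum fun j _ => v.add_le _ _

@[simp] lemma nm_neg (A : Matrix ι κ K) : nm v (-A) = nm v A := by
  simp [nm]

lemma nm_sub_le (A B : Matrix ι κ K) : nm v (A - B) ≤ nm v A + nm v B := by
  rw [sub_eq_add_neg]
  exact (nm_add_le v _ _).trans (by rw [nm_neg])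

lemma nm_smul (c : K) (A : Matrix ι κ K) : nm v (c • A) = v c * nm v A := by
  simp [nm, Finset.mul_sum]

lemma nm_transpose (A : Matrix ι κ K) : nm v Aᵀ = nm v A := by
  unfold nm
  rw [Finset.sum_comm]
  rfl

lemma nm_mul_le (A : Matrix ι κ K) (B : Matrix κ l K) : nm v (A * B) ≤ nm v A * nm v B := by
  unfold nm
  rw [Finset.sum_mul]
  refine Finset.sum_le_sum fun i _ => ?_
  calc ∑ j, v ((A * B) i j) ≤ ∑ j, ∑ k, v (A i k) * v (B k j) := by
        refine Finset.sum_le_sum fun j _ => ?_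
        rw [Matrix.mul_apply]
        refine (v.sum_le _ _).trans (le_of_eq ?_)
        simp
    _ = ∑ k, v (A i k) * ∑ j, v (B k j) := by
        rw [Finset.sum_comm]; simp [Finset.mul_sum]
    _ ≤ ∑ k, v (A i k) * ∑ i, ∑ j, v (B i j) := by
        refine Finset.sum_le_sum fun k _ => mul_le_mul_of_nonneg_left (row_le v B k) (v.nonneg _)
    _ = _ := by rw [Finset.sum_mul]

lemma nm_mul_le_of {A : Matrix ι κ K} {B : Matrix κ l K} {a b : ℝ} (ha : nm v A ≤ a)
    (hb : nm v B ≤ b) : nm v (A * B) ≤ a * b :=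
  (nm_mul_le v A B).trans (mul_le_mul ha hb (nm_nonneg _ _) ((nm_nonneg _ _).trans ha))

lemma nm_le_of_entry {A : Matrix ι κ K} {c : ℝ} (h : ∀ i j, v (A i j) ≤ c) :
    nm v A ≤ Fintype.card ι * Fintype.card κ * c := by
  unfold nm
  calc ∑ i, ∑ j, v (A i j) ≤ ∑ _i : ι, ∑ _j : κ, c :=
        Finset.sum_le_sum fun i _ => Finset.sum_le_sum fun j _ => h i j
    _ = _ := by simp; ring

lemma nm_le_sqcard {A : Matrix ι ι K} {c : ℝ} (h : ∀ i j, v (A i j) ≤ c) :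
    nm v A ≤ (Fintype.card ι) ^ 2 * c := by
  rw [pow_two]; exact nm_le_of_entry v h

variable [DecidableEq ι] 

@[simp] lemma nm_one : nm v (1 : Matrix ι ι K) = Fintype.card ι := by
  unfold nm
  simp [Matrix.one_apply, apply_ite v]

lemma nm_prod_le {c : ℝ} (hc : 0 ≤ c) (L : List (Matrix ι ι K)) (h : ∀ x ∈ L, nm v x ≤ c) :
    nm v L.prod ≤ Fintype.card ι * c ^ L.length := by
  induction L with
  | nil => simp
  | cons x L ih =>
    rw [List.prod_cons, List.length_cons, pow_succ]
    have h2 := nm_mul_le_of v (h x (by simp)) (ih fun y hy => h y (by simp [hy]))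
    linarith

lemma nm_prod_le' {c : ℝ} (hc : 0 ≤ c) (L : List (Matrix ι ι K)) (hL : L ≠ []) (h : ∀ x ∈ L, nm v x ≤ c) :
    nm v L.prod ≤ c ^ L.length := by
  induction L with
  | nil => exact absurd rfl hL
  | cons x L ih =>
    by_cases hL2 : L = []
    · subst hL2; simpa using h
    rw [List.prod_cons, List.length_cons, pow_succ']
    exact nm_mul_le_of v (h x (by simp)) (ih hL2 fun y hy => h y (by simp [hy]))

lemma nm_pow_le (A : Matrix ι ι K) (k : ℕ) : nm v (A ^ k) ≤ Fintype.card ι * nm v A ^ k := by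
  have := nm_prod_le v (nm_nonneg v A) (List.replicate k A) (by
    intro x hx; rw [List.eq_of_mem_replicate hx])
  simpa using this

lemma nm_pow_le' (A : Matrix ι ι K) (k : ℕ) (hk : k ≠ 0) : nm v (A ^ k) ≤ nm v A ^ k := by
  have := nm_prod_le' v (nm_nonneg v A) (List.replicate k A) (by simpa using hk) (by
    intro x hx; rw [List.eq_of_mem_replicate hx])
  simpa using this

lemma det_le_prod (A : Matrix ι ι K) : v A.det ≤ ∏ i, ∑ j, v (A i j) := by
  rw [Matrix.det_apply, Finset.prod_univ_sum]
  refine (v.sum_le _ _).trans ?_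
  calc ∑ σ : Equiv.Perm ι, v (Equiv.Perm.sign σ • ∏ i, A (σ i) i)
      = ∑ σ : Equiv.Perm ι, ∏ i, v (A i (σ.symm i)) := by
        refine Finset.sum_congr rfl fun σ _ => ?_
        have : v (Equiv.Perm.sign σ • ∏ i, A (σ i) i) = v (∏ i, A (σ i) i) := by
          rcases Int.units_eq_one_or (Equiv.Perm.sign σ) with h | h <;> simp [h]
        rw [this, map_prod]
        rw [← Equiv.prod_comp σ (fun i => v (A i (σ.symm i)))]
        simp
    _ ≤ _ := by
        rw [← Finset.sum_image (s := Finset.univ) (g := fun σ : Equiv.Perm ι => (σ.symm : ι → ι))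
          (f := fun x : ι → ι => ∏ i, v (A i (x i)))]
        · refine Finset.sum_le_sum_of_subset_of_nonneg ?_ fun _ _ _ => Finset.prod_nonneg fun _ _ => v.nonneg _
          intro x _
          simp [Fintype.mem_piFinset]
        · intro σ _ τ _ h
          have : σ.symm = τ.symm := Equiv.ext fun x => congrFun h x
          exact Equiv.symm_bijective.injective this

lemma det_le (A : Matrix ι ι K) : v A.det ≤ nm v A ^ Fintype.card ι := by
  refine (det_le_prod v A).trans ?_
  calc ∏ i, ∑ j, v (A i j) ≤ ∏ _i : ι, nm v A :=
        Finset.prod_le_prod (fun _ _ => Finset.sum_nonneg fun _ _ => v.nonneg _) fun i _ => row_le v A i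
    _ = _ := by simp

lemma one_le_nm [Nonempty ι] {A : Matrix ι ι K} (h : A.det = 1) : 1 ≤ nm v A := by
  by_contra hc
  push Not at hc
  have h1 := det_le v A
  rw [h, map_one] at h1
  have := pow_lt_one₀ (nm_nonneg v A) hc (Fintype.card_ne_zero (α := ι))
  linarith

lemma adjugate_le (A : Matrix ι ι K) :
    nm v A.adjugate ≤ (Fintype.card ι) ^ 2 * (nm v A + 1) ^ Fintype.card ι := by
  refine nm_le_sqcard v fun i j => ?_
  rw [Matrix.adjugate_apply]
  refine (det_le_prod v _).trans ?_
  calc _ ≤ ∏ _i : ι, (nm v A + 1) := by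
        refine Finset.prod_le_prod (fun _ _ => Finset.sum_nonneg fun _ _ => v.nonneg _) fun k _ => ?_
        by_cases hk : k = j
        · subst hk
          simp only [Matrix.updateRow_self]
          have : ∑ x, v ((Pi.single i (1 : K) : ι → K) x) = 1 := by
            simp [Pi.single_apply, apply_ite v]
          rw [this]
          linarith [nm_nonneg v A]
        · simp only [Matrix.updateRow_ne hk]
          linarith [row_le v A k]
    _ = _ := by simp

lemma inv_le {A : Matrix ι ι K} (h : A.det = 1) :
    nm v A⁻¹ ≤ (Fintype.card ι) ^ 2 * (nm v A + 1) ^ Fintype.card ι := by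
  rw [Matrix.inv_def, h]
  simpa using adjugate_le v A

lemma det_one_add_ne {u : Matrix ι ι K} (h : nm v u ≤ 1 / 2) : (1 + u).det ≠ 0 := by
  intro h0
  obtain ⟨x, hx, he⟩ := Matrix.exists_mulVec_eq_zero_iff.mpr h0
  set X : Matrix ι (Fin 1) K := Matrix.of fun i _ => x i with hX
  have e1 : (1 + u) * X = 0 := by
    ext i j
    have := congrFun he i
    simpa [Matrix.mul_apply, Matrix.mulVec, dotProduct, hX] using this
  have e2 : X = - (u * X) := by
    rw [Matrix.add_mul, Matrix.one_mul] at e1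
    exact eq_neg_of_add_eq_zero_left e1
  have e3 : nm v X ≤ 1 / 2 * nm v X := by
    conv_lhs => rw [e2, nm_neg]
    exact nm_mul_le_of v h le_rfl
  have e4 : nm v X = 0 := by linarith [nm_nonneg v X]
  rw [nm_eq_zero] at e4
  apply hx
  ext i
  exact congrFun (congrFun e4 i) 0

lemma inv_one_add_le {u : Matrix ι ι K} (h : nm v u ≤ 1 / 2) :
    nm v (1 + u)⁻¹ ≤ 2 * Fintype.card ι := by
  have hd := det_one_add_ne v h
  have h1 : (1 + u) * (1 + u)⁻¹ = 1 := Matrix.mul_nonsing_inv _ (isUnit_iff_ne_zero.mpr hd)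
  set W := (1 + u)⁻¹
  have h2 : W = 1 - u * W := by
    rw [add_mul, one_mul] at h1
    rw [← h1]; simp
  have h3 : nm v W ≤ Fintype.card ι + 1 / 2 * nm v W := by
    conv_lhs => rw [h2]
    refine (nm_sub_le v _ _).trans ?_
    rw [nm_one]
    gcongr
    exact nm_mul_le_of v h le_rfl
  linarith

lemma root_le {A : Matrix ι ι K} {μ : K} (h : A.charpoly.IsRoot μ) : v μ ≤ nm v A := by
  rw [Polynomial.IsRoot, Matrix.eval_charpoly] at h
  obtain ⟨x, hx, he⟩ := Matrix.exists_mulVec_eq_zero_iff.mpr h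
  set X : Matrix ι (Fin 1) K := Matrix.of fun i _ => x i with hX
  have e1 : μ • X = A * X := by
    ext i j
    have := congrFun he i
    rw [Matrix.sub_mulVec, Pi.sub_apply, Pi.zero_apply, sub_eq_zero] at this
    simpa [Matrix.mul_apply, Matrix.mulVec, dotProduct, hX, Matrix.scalar_apply, Matrix.diagonal] using this
  have hX0 : X ≠ 0 := by
    intro h0
    apply hx
    ext i
    exact congrFun (congrFun h0 i) 0
  have h3 : v μ * nm v X ≤ nm v A * nm v X := by
    rw [← nm_smul, e1]; exact nm_mul_le v _ _
  exact le_of_mul_le_mul_right h3 (nm_pos v hX0)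

end nm

lemma dense_values {K : Type*} [Field K] [IsAlgClosed K] (v : AbsoluteValue K ℝ)
    (hv : v.IsNontrivial) {r : ℝ} (hr : 0 < r) : ∃ c : K, r ≤ v c ∧ v c ≤ 2 * r := by
  obtain ⟨a, ha⟩ := hv.exists_abv_gt_one
  obtain ⟨m, hm⟩ := pow_unbounded_of_one_lt (v a) (one_lt_two (α := ℝ))
  have hm0 : m ≠ 0 := by
    rintro rfl
    simp at hm; linarith
  obtain ⟨b, hb⟩ := IsAlgClosed.exists_pow_nat_eq a (Nat.pos_of_ne_zero hm0)
  have hvb : v b ^ m = v a := by rw [← map_pow, hb]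
  have hb1 : 1 < v b := by
    by_contra hc
    push Not at hc
    have := pow_le_one₀ (n := m) (v.nonneg b) hc
    linarith
  have hb2 : v b ≤ 2 := by
    by_contra hc
    push Not at hc
    have := pow_le_pow_left₀ (by norm_num) hc.le m
    linarith
  obtain ⟨j, hj1, hj2⟩ := exists_mem_Ico_zpow hr hb1
  refine ⟨b ^ (j + 1), ?_, ?_⟩
  · rw [map_zpow₀]; exact hj2.le
  · rw [map_zpow₀, zpow_add_one₀ (by positivity)]
    nlinarith

end EG

namespace EG

section levitzki
variable {F : Type*} [Field F] {α : Type*}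

lemma levitzki_exists_invariant {V : Type*} [AddCommGroup V] [Module F V] [FiniteDimensional F V]
    (x : α → Module.End F V) (hx : ∀ w : List α, w ≠ [] → IsNilpotent ((w.map x).prod))
    (i₀ : α) (hi : x i₀ ≠ 0) :
    ∃ U : Submodule F V, U ≠ ⊥ ∧ U ≠ ⊤ ∧ ∀ i, ∀ u ∈ U, x i u ∈ U := by
  classical
  let P : ℕ → Prop := fun r => ∃ w : List α, w ≠ [] ∧ (w.map x).prod ≠ 0 ∧
    Module.finrank F (LinearMap.range ((w.map x).prod)) = r
  have hP : ∃ r, P r := ⟨_, [i₀], by simp, by simpa using hi, rfl⟩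
  obtain ⟨w, hw, hs0, hwr⟩ := Nat.find_spec hP
  have hmin : ∀ w' : List α, w' ≠ [] → (w'.map x).prod ≠ 0 →
      Nat.find hP ≤ Module.finrank F (LinearMap.range ((w'.map x).prod)) := fun w' h1 h2 =>
    Nat.find_min' hP ⟨w', h1, h2, rfl⟩
  set s := (w.map x).prod with hs
  have hsts : ∀ t : List α, s * (t.map x).prod * s = 0 := by
    intro t
    by_contra hne
    have ew : ((w ++ t ++ w).map x).prod = s * (t.map x).prod * s := by
      rw [List.map_append, List.map_append, List.prod_append, List.prod_append]
    have h1 := hmin (w ++ t ++ w) (by simp [hw]) (by rw [ew]; exact hne)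
    rw [ew] at h1
    set T := (t.map x).prod
    have hle : LinearMap.range (s * T * s) ≤ LinearMap.range s := by
      rw [mul_assoc]; exact LinearMap.range_comp_le_range _ _
    have heq : LinearMap.range (s * T * s) = LinearMap.range s :=
      Submodule.eq_of_le_of_finrank_le hle (by rw [hwr]; exact h1)
    have hpow : ∀ k : ℕ, LinearMap.range ((s * T) ^ k * s) = LinearMap.range s := by
      intro k
      induction k with
      | zero => simp
      | succ k ih =>
        have : (s * T) ^ (k + 1) * s = (s * T) ^ k * ((s * T) * s) := by
          rw [pow_succ, mul_assoc]
        rw [this, Module.End.mul_eq_comp, LinearMap.range_comp, heq, ← LinearMap.range_comp,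
          ← Module.End.mul_eq_comp, ih]
    obtain ⟨k, hk⟩ := hx (w ++ t) (by simp [hw])
    simp only [List.map_append, List.prod_append, ← hs] at hk
    have := hpow k
    rw [hk, zero_mul] at this
    apply hs0
    rw [← LinearMap.range_eq_bot, ← this, LinearMap.range_zero]
  refine ⟨⨆ t : List α, LinearMap.range ((t.map x).prod * s), ?_, ?_, ?_⟩
  · intro hbot
    have h1 : LinearMap.range (((([] : List α)).map x).prod * s) ≤ ⊥ := by
      rw [← hbot]; exact le_iSup (fun t : List α => LinearMap.range ((t.map x).prod * s)) []
    simp only [List.map_nil, List.prod_nil, one_mul, le_bot_iff, LinearMap.range_eq_bot] at h1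
    exact hs0 h1
  · intro htop
    have h1 : (⨆ t : List α, LinearMap.range ((t.map x).prod * s)) ≤ LinearMap.ker s := by
      refine iSup_le fun t => ?_
      rintro _ ⟨u, rfl⟩
      rw [LinearMap.mem_ker]
      have := LinearMap.congr_fun (hsts t) u
      simpa [mul_assoc] using this
    rw [htop, top_le_iff, LinearMap.ker_eq_top] at h1
    exact hs0 h1
  · intro i u hu
    have h1 : (⨆ t : List α, LinearMap.range ((t.map x).prod * s)) ≤
        (⨆ t : List α, LinearMap.range ((t.map x).prod * s)).comap (x i) := by
      refine iSup_le fun t => ?_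
      rintro _ ⟨u, rfl⟩
      refine Submodule.mem_iSup_of_mem (i :: t) ?_
      exact ⟨u, by simp [mul_assoc]⟩
    exact h1 hu

theorem levitzki (n : ℕ) : ∀ {V : Type*} [AddCommGroup V] [Module F V] [FiniteDimensional F V]
    (hV : Module.finrank F V ≤ n)
    (x : α → Module.End F V) (hx : ∀ w : List α, w ≠ [] → IsNilpotent ((w.map x).prod))
    (w : List α) (hw : Module.finrank F V ≤ w.length), (w.map x).prod = 0 := by
  induction n with
  | zero =>
    intro V _ _ _ hV x hx w hw
    have : Module.finrank F V = 0 := by omega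
    have hsub : Subsingleton V := Module.finrank_zero_iff.mp this
    ext u
    exact Subsingleton.elim _ _
  | succ n ih =>
    intro V _ _ _ hV x hx w hw
    by_cases h0 : ∀ i, x i = 0
    · cases w with
      | nil =>
        have : Module.finrank F V = 0 := by simpa using hw
        have hsub : Subsingleton V := Module.finrank_zero_iff.mp this
        ext u
        exact Subsingleton.elim _ _
      | cons a w => simp [h0]
    push Not at h0
    obtain ⟨i₀, hi₀⟩ := h0
    obtain ⟨U, hU0, hU1, hinv⟩ := levitzki_exists_invariant x hx i₀ hi₀
    have hd : Module.finrank F (V ⧸ U) + Module.finrank F U = Module.finrank F V :=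
      Submodule.finrank_quotient_add_finrank U
    have hUlt : Module.finrank F U < Module.finrank F V :=
      Submodule.finrank_lt hU1
    have hUpos : 0 < Module.finrank F U := by
      rw [Module.finrank_pos_iff]
      exact Submodule.nontrivial_iff_ne_bot.mpr hU0
    let xU : α → Module.End F U := fun i => (x i).restrict (hinv i)
    let xQ : α → Module.End F (V ⧸ U) := fun i => U.mapQ U (x i) (hinv i)
    have eU : ∀ (w : List α) (u : U), (((w.map xU).prod u : U) : V) = (w.map x).prod u := by
      intro w
      induction w with
      | nil => intro u; simp
      | cons a w ih2 =>
        intro u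
        simp only [List.map_cons, List.prod_cons, Module.End.mul_apply]
        rw [← ih2]
        rfl
    have eQ : ∀ (w : List α) (u : V), (w.map xQ).prod (U.mkQ u) = U.mkQ ((w.map x).prod u) := by
      intro w
      induction w with
      | nil => intro u; simp
      | cons a w ih2 =>
        intro u
        simp only [List.map_cons, List.prod_cons, Module.End.mul_apply]
        rw [ih2]
        rfl
    have hpowlist : ∀ (w : List α) (k : ℕ) {W : Type _} [AddCommGroup W] [Module F W] (y : α → Module.End F W),
        ((w.map y).prod) ^ k = (((List.replicate k w).flatten).map y).prod := by
      intro w k W _ _ y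
      induction k with
      | zero => simp
      | succ k ihk => rw [pow_succ', ihk, List.replicate_succ, List.flatten_cons, List.map_append, List.prod_append]
    have nU : ∀ w : List α, w ≠ [] → IsNilpotent ((w.map xU).prod) := by
      intro w hw
      obtain ⟨k, hk⟩ := hx w hw
      refine ⟨k, ?_⟩
      ext u
      rw [hpowlist] at hk ⊢
      rw [eU, hk]; simp
    have nQ : ∀ w : List α, w ≠ [] → IsNilpotent ((w.map xQ).prod) := by
      intro w hw
      obtain ⟨k, hk⟩ := hx w hw
      refine ⟨k, ?_⟩
      refine LinearMap.ext fun q => ?_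
      obtain ⟨u, rfl⟩ := U.mkQ_surjective q
      rw [hpowlist] at hk ⊢
      rw [eQ, hk]; simp
    have hw' : w = w.take (Module.finrank F U) ++ w.drop (Module.finrank F U) := by simp
    have z1 := ih (V := U) (by omega) xU nU (w.take (Module.finrank F U)) (by
      rw [List.length_take]; omega)
    have z2 := ih (V := V ⧸ U) (by omega) xQ nQ (w.drop (Module.finrank F U)) (by
      rw [List.length_drop]; omega)
    rw [hw', List.map_append, List.prod_append]
    refine LinearMap.ext fun u => ?_
    rw [Module.End.mul_apply]
    have m1 : ((w.drop (Module.finrank F U)).map x).prod u ∈ U := by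
      have := eQ (w.drop (Module.finrank F U)) u
      rw [z2] at this
      rw [← Submodule.Quotient.mk_eq_zero]
      exact this.symm
    have := eU (w.take (Module.finrank F U)) ⟨_, m1⟩
    rw [z1] at this
    simpa using this.symm

theorem levitzki_matrix {n : ℕ} (x : α → Matrix (Fin n) (Fin n) F)
    (hx : ∀ w : List α, w ≠ [] → IsNilpotent ((w.map x).prod))
    (w : List α) (hw : n ≤ w.length) : (w.map x).prod = 0 := by
  have e : ∀ w : List α, (w.map (fun i => Matrix.toLinAlgEquiv' (x i))).prod =
      Matrix.toLinAlgEquiv' ((w.map x).prod) := by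
    intro w
    rw [map_list_prod, List.map_map]; rfl
  have := levitzki (F := F) n (V := Fin n → F) (by simp) (fun i => Matrix.toLinAlgEquiv' (x i))
    (by
      intro w hw
      rw [e]
      exact (hx w hw).map _) w (by simpa using hw)
  rw [e] at this
  exact (map_eq_zero_iff _ Matrix.toLinAlgEquiv'.injective).mp this

end levitzki

section radical

/-- all low coefficients of characteristic polynomials of short words are at most `η` -/
def SmallWords {n : ℕ} {α K : Type*} [Field K] (v : AbsoluteValue K ℝ) (x : α → Matrix (Fin n) (Fin n) K)
    (N : ℕ) (η : ℝ) : Prop :=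
  ∀ w : List α, w ≠ [] → w.length ≤ N → ∀ i < n, v (((w.map x).prod).charpoly.coeff i) ≤ η

/-- generic matrices -/
noncomputable def genMat (n : ℕ) (k : Fin n) :
    Matrix (Fin n) (Fin n) (MvPolynomial (Fin n × Fin n × Fin n) ℤ) :=
  Matrix.of fun i j => MvPolynomial.X (k, i, j)

/-- ideal of characteristic coefficients -/
noncomputable def charIdeal (n : ℕ) : Ideal (MvPolynomial (Fin n × Fin n × Fin n) ℤ) :=
  Ideal.span {q | ∃ w : List (Fin n), w ≠ [] ∧ ∃ i < n, q = ((w.map (genMat n)).prod).charpoly.coeff i}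

lemma map_word {n : ℕ} {A B : Type*} [CommRing A] [CommRing B] (φ : A →+* B) {α : Type*}
    (x : α → Matrix (Fin n) (Fin n) A) (w : List α) :
    ((w.map x).prod).map φ = (w.map (fun k => (x k).map φ)).prod := by
  induction w with
  | nil => simp
  | cons a w ih => simp [Matrix.map_mul, ih]

lemma mem_radical (n : ℕ) (w : List (Fin n)) (hw : n ≤ w.length) (a b : Fin n) :
    ((w.map (genMat n)).prod) a b ∈ (charIdeal n).radical := by
  rw [Ideal.radical_eq_sInf, Submodule.mem_sInf]
  rintro P ⟨hI, hP⟩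
  have : Ideal.IsPrime P := hP
  let φ : MvPolynomial (Fin n × Fin n × Fin n) ℤ →+*
      FractionRing (MvPolynomial (Fin n × Fin n × Fin n) ℤ ⧸ P) :=
    (algebraMap _ _).comp (Ideal.Quotient.mk P)
  have hker : ∀ q, φ q = 0 ↔ q ∈ P := by
    intro q
    rw [← Ideal.Quotient.eq_zero_iff_mem]
    exact map_eq_zero_iff (algebraMap (MvPolynomial (Fin n × Fin n × Fin n) ℤ ⧸ P)
      (FractionRing (MvPolynomial (Fin n × Fin n × Fin n) ℤ ⧸ P))) (IsFractionRing.injective _ _)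
  have hz := levitzki_matrix (fun k => (genMat n k).map φ) (by
    intro w hw
    rw [← map_word]
    set M := ((w.map (genMat n)).prod).map φ with hM
    have hc : M.charpoly = Polynomial.X ^ n := by
      ext i
      rw [hM, Matrix.charpoly_map]
      rw [Polynomial.coeff_map, Polynomial.coeff_X_pow]
      rcases lt_trichotomy i n with h | h | h
      · rw [if_neg h.ne, hker]
        exact hI (Ideal.subset_span ⟨w, hw, i, h, rfl⟩)
      · subst h
        rw [if_pos rfl]
        have := Matrix.charpoly_monic ((w.map (genMat i)).prod)
        have hd := Matrix.charpoly_natDegree_eq_dim ((w.map (genMat i)).prod)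
        rw [Fintype.card_fin] at hd
        rw [Polynomial.Monic, Polynomial.leadingCoeff, hd] at this
        rw [this, map_one]
      · rw [if_neg h.ne', Polynomial.coeff_eq_zero_of_natDegree_lt, map_zero]
        rw [Matrix.charpoly_natDegree_eq_dim, Fintype.card_fin]; exact h
    refine ⟨n, ?_⟩
    have := Matrix.aeval_self_charpoly M
    rw [hc] at this
    simpa using this) w hw
  rw [← map_word] at hz
  have := congrFun (congrFun hz a) b
  rw [Matrix.map_apply] at this
  exact (hker _).mp this

/-- evaluation -/
noncomputable def evalMat {n : ℕ} {K : Type} [Field K] (x : Fin n → Matrix (Fin n) (Fin n) K) :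
    MvPolynomial (Fin n × Fin n × Fin n) ℤ →+* K :=
  (MvPolynomial.aeval (fun t : Fin n × Fin n × Fin n => x t.1 t.2.1 t.2.2)).toRingHom

lemma evalMat_gen {n : ℕ} {K : Type} [Field K] (x : Fin n → Matrix (Fin n) (Fin n) K) (k : Fin n) :
    (genMat n k).map (evalMat x) = x k := by
  ext i j
  simp [genMat, evalMat]

lemma eval_bounded {n : ℕ} (q : MvPolynomial (Fin n × Fin n × Fin n) ℤ) :
    ∃ C : ℝ, 0 ≤ C ∧ ∀ (K : Type) [Field K] (v : AbsoluteValue K ℝ) (x : Fin n → Matrix (Fin n) (Fin n) K),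
      (∀ k i j, v (x k i j) ≤ 1) → v (evalMat x q) ≤ C := by
  induction q using MvPolynomial.induction_on with
  | C a =>
    refine ⟨|a|, by positivity, fun K _ v x hx => ?_⟩
    have hnat : ∀ m : ℕ, v (m : K) ≤ m := by
      intro m
      induction m with
      | zero => simp
      | succ m ih =>
        push_cast
        refine (v.add_le _ _).trans ?_
        rw [map_one]; linarith
    have e : evalMat x (MvPolynomial.C a) = (a : K) := by simp [evalMat]
    rw [e]
    rcases Int.natAbs_eq a with h | h
    · rw [h]; simpa using hnat a.natAbs
    · rw [h]; simpa using hnat a.natAbs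
  | add p q hp hq =>
    obtain ⟨C, hC0, hC⟩ := hp
    obtain ⟨D, hD0, hD⟩ := hq
    refine ⟨C + D, by positivity, fun K _ v x hx => ?_⟩
    rw [map_add]
    exact (v.add_le _ _).trans (add_le_add (hC K v x hx) (hD K v x hx))
  | mul_X p t hp =>
    obtain ⟨C, hC0, hC⟩ := hp
    refine ⟨C, hC0, fun K _ v x hx => ?_⟩
    rw [map_mul, map_mul]
    have e : evalMat x (MvPolynomial.X t) = x t.1 t.2.1 t.2.2 := by simp [evalMat]
    rw [e]
    calc _ ≤ C * 1 := mul_le_mul (hC K v x hx) (hx _ _ _) (v.nonneg _) hC0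
      _ = C := mul_one _

lemma controlled {n : ℕ} {q : MvPolynomial (Fin n × Fin n × Fin n) ℤ} (hq : q ∈ charIdeal n) :
    ∃ (C : ℝ) (N : ℕ), 0 ≤ C ∧ ∀ (K : Type) [Field K] (v : AbsoluteValue K ℝ)
      (x : Fin n → Matrix (Fin n) (Fin n) K) (η : ℝ), 0 ≤ η →
      (∀ k i j, v (x k i j) ≤ 1) → SmallWords v x N η → v (evalMat x q) ≤ C * η := by
  induction hq using Submodule.span_induction with
  | mem q hq =>
    obtain ⟨w, hw, i, hi, rfl⟩ := hq
    refine ⟨1, w.length, zero_le_one, fun K _ v x η hη hx hs => ?_⟩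
    rw [one_mul]
    have := hs w hw le_rfl i hi
    have e : (w.map x).prod = ((w.map (genMat n)).prod).map (evalMat x) := by
      rw [map_word]; congr 2; ext k : 1; rw [evalMat_gen]
    rw [e, Matrix.charpoly_map, Polynomial.coeff_map] at this
    exact this
  | zero => exact ⟨0, 0, le_rfl, fun K _ v x η hη hx hs => by simp⟩
  | add p q _ _ hp hq =>
    obtain ⟨C, N, hC0, hC⟩ := hp
    obtain ⟨D, M, hD0, hD⟩ := hq
    refine ⟨C + D, max N M, by positivity, fun K _ v x η hη hx hs => ?_⟩
    rw [map_add, add_mul]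
    refine (v.add_le _ _).trans (add_le_add (hC K v x η hη hx ?_) (hD K v x η hη hx ?_))
    · exact fun w h1 h2 => hs w h1 (h2.trans (le_max_left _ _))
    · exact fun w h1 h2 => hs w h1 (h2.trans (le_max_right _ _))
  | smul a q _ hq =>
    obtain ⟨C, N, hC0, hC⟩ := hq
    obtain ⟨D, hD0, hD⟩ := eval_bounded a
    refine ⟨D * C, N, by positivity, fun K _ v x η hη hx hs => ?_⟩
    rw [smul_eq_mul, map_mul, map_mul, mul_assoc]
    exact mul_le_mul (hD K v x hx) (hC K v x η hη hx hs) (v.nonneg _) hD0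

/-- quantitative nilpotency -/
theorem radical_lemma (n : ℕ) (δ : ℝ) (hδ : 0 < δ) : ∃ (η : ℝ) (N : ℕ), 0 < η ∧
    ∀ (K : Type) [Field K] (v : AbsoluteValue K ℝ) (x : Fin n → Matrix (Fin n) (Fin n) K),
      (∀ k i j, v (x k i j) ≤ 1) → SmallWords v x N η →
      ∀ i j, v ((List.ofFn x).prod i j) ≤ δ := by
  have key : ∀ ij : Fin n × Fin n, ∃ (η : ℝ) (N : ℕ), 0 < η ∧
    ∀ (K : Type) [Field K] (v : AbsoluteValue K ℝ) (x : Fin n → Matrix (Fin n) (Fin n) K),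
      (∀ k i j, v (x k i j) ≤ 1) → SmallWords v x N η → v ((List.ofFn x).prod ij.1 ij.2) ≤ δ := by
    rintro ⟨i, j⟩
    have hr := mem_radical n (List.ofFn id) (by simp) i j
    obtain ⟨m, hm⟩ := Ideal.mem_radical_iff.mp hr
    obtain ⟨C, N, hC0, hC⟩ := controlled hm
    refine ⟨δ ^ m / (C + 1), N, by positivity, fun K _ v x hx hs => ?_⟩
    have h1 := hC K v x _ (by positivity) hx hs
    have e : evalMat x (((List.ofFn id).map (genMat n)).prod i j) = (List.ofFn x).prod i j := by
      have : (((List.ofFn id).map (genMat n)).prod).map (evalMat x) = (List.ofFn x).prod := by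
        rw [map_word, List.map_ofFn]
        congr 2; ext k : 1; exact evalMat_gen x k
      rw [← this]; rfl
    rw [map_pow, map_pow, e] at h1
    have h2 : C * (δ ^ m / (C + 1)) ≤ δ ^ m := by
      rw [mul_div_assoc', div_le_iff₀ (by positivity)]
      nlinarith [pow_pos hδ m]
    by_contra hcon
    push Not at hcon
    have h3 : v ((List.ofFn x).prod i j) ^ m ≤ δ ^ m := h1.trans h2
    rcases Nat.eq_zero_or_pos m with h0 | h0
    · subst h0
      simp only [pow_zero] at h1
      have : C * (1 / (C + 1)) < 1 := by
        rw [mul_one_div, div_lt_one (by positivity)]; linarith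
      linarith
    · have := pow_lt_pow_left₀ hcon hδ.le h0.ne'
      linarith
  choose η N hη h using key
  by_cases hn : Nonempty (Fin n × Fin n)
  · refine ⟨Finset.univ.inf' (Finset.univ_nonempty) η, Finset.univ.sup N, ?_, fun K _ v x hx hs i j => ?_⟩
    · rw [Finset.lt_inf'_iff]; exact fun i _ => hη i
    · refine h (i, j) K v x hx fun w h1 h2 l hl => ?_
      refine (hs w h1 (h2.trans (Finset.le_sup (f := N) (Finset.mem_univ _))) l hl).trans ?_
      exact Finset.inf'_le _ (Finset.mem_univ _)
  · refine ⟨1, 0, one_pos, fun K _ v x hx hs i j => ?_⟩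
    exact absurd ⟨(i, j)⟩ hn

end radical
end EG

namespace EG

lemma coeff_small {K : Type*} [Field K] (v : AbsoluteValue K ℝ) {η : ℝ} (h0 : 0 ≤ η) (h1 : η ≤ 1)
    (s : Multiset K) (hs : ∀ a ∈ s, v a ≤ η) :
    (∀ i, v ((s.map (fun a => Polynomial.X - Polynomial.C a)).prod.coeff i) ≤ 2 ^ (Multiset.card s)) ∧
    ∀ i < Multiset.card s, v ((s.map (fun a => Polynomial.X - Polynomial.C a)).prod.coeff i) ≤
      2 ^ (Multiset.card s) * η := by
  induction s using Multiset.induction_on with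
  | empty =>
    refine ⟨fun i => ?_, by simp⟩
    simp only [Multiset.map_zero, Multiset.prod_zero, Polynomial.coeff_one, Multiset.card_zero, pow_zero]
    split_ifs <;> simp
  | cons a s ih =>
    obtain ⟨ih1, ih2⟩ := ih (fun b hb => hs b (Multiset.mem_cons_of_mem hb))
    have ha := hs a (Multiset.mem_cons_self a s)
    set p := (s.map (fun a => Polynomial.X - Polynomial.C a)).prod
    have hc0 : ((Polynomial.X - Polynomial.C a) * p).coeff 0 = - (a * p.coeff 0) := by
      rw [sub_mul, Polynomial.coeff_sub, Polynomial.coeff_C_mul]; simp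
    have hcs : ∀ i, ((Polynomial.X - Polynomial.C a) * p).coeff (i + 1) = p.coeff i - a * p.coeff (i + 1) := by
      intro i
      rw [sub_mul, Polynomial.coeff_sub, Polynomial.coeff_C_mul, Polynomial.coeff_X_mul]
    have hp : (0 : ℝ) < 2 ^ Multiset.card s := by positivity
    have hap : ∀ i, v (a * p.coeff i) ≤ 2 ^ Multiset.card s * η := by
      intro i
      rw [map_mul, mul_comm]
      exact mul_le_mul (ih1 i) ha (v.nonneg _) hp.le
    rw [Multiset.map_cons, Multiset.prod_cons, Multiset.card_cons, pow_succ]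
    constructor
    · rintro (_ | i)
      · rw [hc0, map_neg_eq_map]
        have := hap 0
        nlinarith
      · rw [hcs]
        have h3 := v.sub_le_add (p.coeff i) (a * p.coeff (i + 1))
        have := hap (i + 1)
        have := ih1 i
        nlinarith
    · rintro (_ | i) hi
      · rw [hc0, map_neg_eq_map]
        have := hap 0
        nlinarith
      · rw [hcs]
        have h3 := v.sub_le_add (p.coeff i) (a * p.coeff (i + 1))
        have := hap (i + 1)
        have := ih2 i (by omega)
        nlinarith

lemma charpoly_coeff_small {K : Type*} [Field K] [IsAlgClosed K] (v : AbsoluteValue K ℝ) {η : ℝ} (h0 : 0 ≤ η)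
    (h1 : η ≤ 1) {n : ℕ} (A : Matrix (Fin n) (Fin n) K) (h : ∀ μ, A.charpoly.IsRoot μ → v μ ≤ η)
    (i : ℕ) (hi : i < n) : v (A.charpoly.coeff i) ≤ 2 ^ n * η := by
  have hsp := IsAlgClosed.splits A.charpoly
  have hm := A.charpoly_monic
  have e : A.charpoly = (A.charpoly.roots.map (fun a => Polynomial.X - Polynomial.C a)).prod :=
    hsp.eq_prod_roots_of_monic hm
  have hcard : Multiset.card A.charpoly.roots = n := by
    rw [← hsp.natDegree_eq_card_roots, Matrix.charpoly_natDegree_eq_dim, Fintype.card_fin]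
  have := (coeff_small v h0 h1 A.charpoly.roots (fun a ha => h a (Polynomial.isRoot_of_mem_roots ha))).2 i
    (by rw [hcard]; exact hi)
  rw [← e, hcard] at this
  exact this

/-- the `ℓ¹` norm of a vector -/
def vn {K : Type*} [Field K] (v : AbsoluteValue K ℝ) {n : ℕ} (u : Fin n → K) : ℝ := ∑ i, v (u i)

lemma vn_smul {K : Type*} [Field K] (v : AbsoluteValue K ℝ) {n : ℕ} (c : K) (u : Fin n → K) :
    vn v (c • u) = v c * vn v u := by simp [vn, Finset.mul_sum]

lemma vn_nonneg {K : Type*} [Field K] (v : AbsoluteValue K ℝ) {n : ℕ} (u : Fin n → K) : 0 ≤ vn v u :=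
  Finset.sum_nonneg fun _ _ => v.nonneg _

lemma vn_mulVec {K : Type*} [Field K] (v : AbsoluteValue K ℝ) {n : ℕ} (A : Matrix (Fin n) (Fin n) K)
    (u : Fin n → K) : vn v (A *ᵥ u) ≤ nm v A * vn v u := by
  have := nm_mul_le v A (Matrix.of fun (i : Fin n) (_ : Fin 1) => u i)
  have e : nm v (Matrix.of fun (i : Fin n) (_ : Fin 1) => u i) = vn v u := by simp [nm, vn]
  have e2 : nm v (A * (Matrix.of fun (i : Fin n) (_ : Fin 1) => u i)) = vn v (A *ᵥ u) := by
    simp [nm, vn, Matrix.mul_apply, Matrix.mulVec, dotProduct]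
  rwa [e, e2] at this

lemma vn_pos {K : Type*} [Field K] (v : AbsoluteValue K ℝ) {n : ℕ} {u : Fin n → K} (hu : u ≠ 0) : 0 < vn v u := by
  refine lt_of_le_of_ne (vn_nonneg v u) fun h => hu ?_
  ext i
  have := Finset.single_le_sum (f := fun i => v (u i)) (fun _ _ => v.nonneg _) (Finset.mem_univ i)
  have h2 : v (u i) ≤ 0 := by rw [h]; exact this
  exact v.eq_zero.mp (le_antisymm h2 (v.nonneg _))

/-- approximate Auerbach basis for a homogeneous function -/
lemma auerbach {K : Type*} [Field K] [IsAlgClosed K] (v : AbsoluteValue K ℝ) (hv : v.IsNontrivial) {n : ℕ}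
    (ν : (Fin n → K) → ℝ) (hν : ∀ u, vn v u ≤ ν u) (hh : ∀ (c : K) u, ν (c • u) = v c * ν u) :
    ∃ B : Matrix (Fin n) (Fin n) K, B.det ≠ 0 ∧ ∀ (A : Matrix (Fin n) (Fin n) K) (τ : ℝ), 0 ≤ τ →
      (∀ u, ν (A *ᵥ u) ≤ τ * ν u) → ∀ i j, v ((B⁻¹ * A * B) i j) ≤ 4 * τ := by
  have hνpos : ∀ u, u ≠ 0 → 0 < ν u := fun u hu => (vn_pos v hu).trans_le (hν u)
  have hν0 : ∀ u, 0 ≤ ν u := fun u => (vn_nonneg v u).trans (hν u)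
  let Φ : Matrix (Fin n) (Fin n) K → ℝ := fun B => v B.det / ∏ j, ν (fun i => B i j)
  have hcol : ∀ B : Matrix (Fin n) (Fin n) K, B.det ≠ 0 → ∀ j, (fun i => B i j) ≠ 0 := by
    intro B hB j h
    exact hB (Matrix.det_eq_zero_of_column_eq_zero j fun i => congrFun h i)
  have hprod : ∀ B : Matrix (Fin n) (Fin n) K, B.det ≠ 0 → 0 < ∏ j, ν (fun i => B i j) :=
    fun B hB => Finset.prod_pos fun j _ => hνpos _ (hcol B hB j)
  have hΦ1 : ∀ B : Matrix (Fin n) (Fin n) K, B.det ≠ 0 → Φ B ≤ 1 := by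
    intro B hB
    rw [div_le_one (hprod B hB)]
    rw [← Matrix.det_transpose]
    refine (det_le_prod v _).trans ?_
    refine Finset.prod_le_prod (fun _ _ => Finset.sum_nonneg fun _ _ => v.nonneg _) fun j _ => hν _
  have hΦ0 : ∀ B : Matrix (Fin n) (Fin n) K, B.det ≠ 0 → 0 < Φ B := fun B hB =>
    div_pos (v.pos hB) (hprod B hB)
  obtain ⟨B₀, hB₀, hopt⟩ : ∃ B₀ : Matrix (Fin n) (Fin n) K, B₀.det ≠ 0 ∧
      ∀ B : Matrix (Fin n) (Fin n) K, B.det ≠ 0 → Φ B ≤ 2 * Φ B₀ := by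
    let T : Set ℝ := Φ '' {B | B.det ≠ 0}
    have hT : BddAbove T := ⟨1, by rintro _ ⟨B, hB, rfl⟩; exact hΦ1 B hB⟩
    have hne : T.Nonempty := ⟨Φ 1, 1, by simp, rfl⟩
    have hs : 0 < sSup T := (hΦ0 1 (by simp)).trans_le (le_csSup hT ⟨1, by simp, rfl⟩)
    obtain ⟨_, ⟨B₀, hB₀, rfl⟩, h⟩ := exists_lt_of_lt_csSup hne (show sSup T / 2 < sSup T by linarith)
    refine ⟨B₀, hB₀, fun B hB => ?_⟩
    have := le_csSup hT ⟨B, hB, rfl⟩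
    linarith
  -- scale
  have hsc : ∀ j, ∃ c : K, 1 ≤ ν (fun i => c * B₀ i j) ∧ ν (fun i => c * B₀ i j) ≤ 2 ∧ c ≠ 0 := by
    intro j
    have hp := hνpos _ (hcol B₀ hB₀ j)
    obtain ⟨c, hc1, hc2⟩ := dense_values v hv (r := (ν fun i => B₀ i j)⁻¹) (by positivity)
    have e : ν (fun i => c * B₀ i j) = v c * ν (fun i => B₀ i j) := hh c _
    refine ⟨c, ?_, ?_, ?_⟩
    · rw [e]
      calc (1 : ℝ) = (ν fun i => B₀ i j)⁻¹ * ν (fun i => B₀ i j) := by field_simp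
        _ ≤ _ := by gcongr
    · rw [e]
      calc _ ≤ 2 * (ν fun i => B₀ i j)⁻¹ * ν (fun i => B₀ i j) := by gcongr
        _ = 2 := by field_simp
    · rintro rfl
      rw [map_zero] at hc1
      have : 0 < (ν fun i => B₀ i j)⁻¹ := by positivity
      linarith
  choose c hc1 hc2 hc0 using hsc
  let B : Matrix (Fin n) (Fin n) K := B₀ * Matrix.diagonal c
  have hBij : ∀ i j, B i j = c j * B₀ i j := by
    intro i j; simp [B, Matrix.mul_diagonal, mul_comm]
  have hBdet : B.det = B₀.det * ∏ j, c j := by simp [B]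
  have hcp : ∏ j, c j ≠ 0 := Finset.prod_ne_zero_iff.mpr fun j _ => hc0 j
  have hB : B.det ≠ 0 := by rw [hBdet]; exact mul_ne_zero hB₀ hcp
  have hΦB : Φ B = Φ B₀ := by
    simp only [Φ, hBij, hBdet]
    have : ∀ j, ν (fun i => c j * B₀ i j) = v (c j) * ν (fun i => B₀ i j) := fun j => hh (c j) _
    simp only [this, Finset.prod_mul_distrib, map_mul, map_prod]
    rw [mul_comm, mul_div_mul_left]
    rw [← map_prod]
    exact (v.ne_zero_iff).mpr hcp
  refine ⟨B, hB, fun A τ hτ hA i j => ?_⟩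
  -- Cramer
  set u : Fin n → K := A *ᵥ (fun k => B k j) with hu
  have e1 : (B⁻¹ * A * B) i j = (B.updateCol i u).det / B.det := by
    have h2 : (B⁻¹ * A * B) i j = (B⁻¹ *ᵥ u) i := by
      rw [mul_assoc, hu, Matrix.mul_apply]
      rfl
    rw [h2, Matrix.inv_def, Matrix.smul_mulVec, ← Matrix.cramer_eq_adjugate_mulVec, Pi.smul_apply,
      Matrix.cramer_apply, Ring.inverse_eq_inv', smul_eq_mul]
    field_simp
  rw [e1, map_div₀, div_le_iff₀ (v.pos hB)]
  by_cases hz : (B.updateCol i u).det = 0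
  · rw [hz, map_zero]; have := v.nonneg B.det; positivity
  have h1 := hopt _ hz
  rw [← hΦB] at h1
  have hP := hprod B hB
  have hP' := hprod _ hz
  have h2 : v (B.updateCol i u).det = Φ (B.updateCol i u) * ∏ j, ν (fun k => B.updateCol i u k j) := by
    simp only [Φ]; field_simp
  have h3 : v B.det = Φ B * ∏ j, ν (fun k => B k j) := by
    simp only [Φ]; field_simp
  have h4 : ∏ j, ν (fun k => B.updateCol i u k j) ≤ 2 * τ * ∏ j, ν (fun k => B k j) := by
    rw [← Finset.mul_prod_erase _ _ (Finset.mem_univ i), ← Finset.mul_prod_erase (a := i) _ (fun j => ν (fun k => B k j)) (Finset.mem_univ i)]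
    have e5 : ∏ x ∈ Finset.univ.erase i, ν (fun k => B.updateCol i u k x) =
        ∏ x ∈ Finset.univ.erase i, ν (fun k => B k x) := by
      refine Finset.prod_congr rfl fun x hx => ?_
      congr 1; ext k
      rw [Matrix.updateCol_ne (Finset.ne_of_mem_erase hx)]
    have e6 : (fun k => B.updateCol i u k i) = u := by ext k; simp
    rw [e5, e6, ← mul_assoc]
    refine mul_le_mul_of_nonneg_right ?_ (Finset.prod_nonneg fun _ _ => hν0 _)
    have h7 : ν u ≤ τ * ν (fun k => B k j) := hA _
    have h8 : ν (fun k => B k j) ≤ 2 := by simpa only [hBij] using hc2 j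
    have h9 : 1 ≤ ν (fun k => B k i) := by simpa only [hBij] using hc1 i
    nlinarith [mul_le_mul_of_nonneg_left h8 hτ, mul_le_mul_of_nonneg_left h9 hτ]
  rw [h2, h3]
  have h10 := hΦ0 B hB
  have h11 := hΦ0 _ hz
  calc Φ (B.updateCol i u) * ∏ j, ν (fun k => B.updateCol i u k j)
      ≤ (2 * Φ B) * (2 * τ * ∏ j, ν (fun k => B k j)) := mul_le_mul h1 h4 hP'.le (by positivity)
    _ = _ := by ring

/-- if all products of length `n` are small, one can conjugate to make all matrices small -/
lemma conj_small {K : Type*} [Field K] [IsAlgClosed K] (v : AbsoluteValue K ℝ) (hv : v.IsNontrivial) {n : ℕ}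
    (hn : 1 ≤ n) {α : Type*} [Finite α] (x : α → Matrix (Fin n) (Fin n) K) (τ : ℝ) (hτ : 0 < τ)
    (hx : ∀ w : List α, w.length = n → nm v (w.map x).prod ≤ τ ^ n) :
    ∃ B : Matrix (Fin n) (Fin n) K, B.det ≠ 0 ∧ ∀ k i j, v ((B⁻¹ * x k * B) i j) ≤ 4 * τ := by
  classical
  let T : Finset (List α) := (List.finite_length_lt α n).toFinset
  have hT : ∀ w, w ∈ T ↔ w.length < n := by intro w; simp [T]
  have hTne : T.Nonempty := ⟨[], by rw [hT]; simp only [List.length_nil]; omega⟩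
  let ν : (Fin n → K) → ℝ := fun u => T.sup' hTne fun w => (τ⁻¹) ^ w.length * vn v ((w.map x).prod *ᵥ u)
  have hle : ∀ w : List α, w.length < n → ∀ u, (τ⁻¹) ^ w.length * vn v ((w.map x).prod *ᵥ u) ≤ ν u := by
    intro w hw u
    exact Finset.le_sup' (f := fun w => (τ⁻¹) ^ w.length * vn v ((w.map x).prod *ᵥ u)) ((hT w).mpr hw)
  have h1 : ∀ u, vn v u ≤ ν u := by
    intro u
    simpa using hle [] (by simp only [List.length_nil]; omega) u
  have h2 : ∀ (c : K) u, ν (c • u) = v c * ν u := by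
    intro c u
    simp only [ν]
    rw [Finset.mul₀_sup' (v.nonneg c)]
    congr 1; ext w
    rw [Matrix.mulVec_smul, vn_smul]; ring
  obtain ⟨B, hB, h⟩ := auerbach v hv ν h1 h2
  refine ⟨B, hB, fun k => h (x k) τ hτ.le fun u => ?_⟩
  refine Finset.sup'_le _ _ fun w hw => ?_
  rw [hT] at hw
  have e : (w.map x).prod *ᵥ (x k *ᵥ u) = ((w ++ [k]).map x).prod *ᵥ u := by simp
  rw [e]
  by_cases hw2 : w.length + 1 < n
  · have := hle (w ++ [k]) (by simpa using hw2) u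
    rw [List.length_append, List.length_singleton, pow_succ] at this
    have h3 := mul_le_mul_of_nonneg_left this hτ.le
    refine le_trans (le_of_eq ?_) h3
    field_simp
  · have hl : (w ++ [k]).length = n := by simp; omega
    have h3 := vn_mulVec v ((w ++ [k]).map x).prod u
    have h4 := hx _ hl
    have h5 : vn v (((w ++ [k]).map x).prod *ᵥ u) ≤ τ ^ n * ν u :=
      h3.trans (mul_le_mul h4 (h1 u) (vn_nonneg v u) (by positivity))
    have hwn : n = w.length + 1 := by omega
    calc _ ≤ (τ⁻¹) ^ w.length * (τ ^ n * ν u) := by gcongr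
      _ = τ * ν u := by
        rw [hwn, pow_succ, inv_pow]; field_simp

theorem jsr (n : ℕ) (hn : 1 ≤ n) : ∃ (N₀ : ℕ) (η₁ : ℝ), 1 ≤ N₀ ∧ 0 < η₁ ∧
    ∀ (K : Type) [Field K] [IsAlgClosed K] (v : AbsoluteValue K ℝ), v.IsNontrivial →
    ∀ (α : Type) [Finite α] [Nonempty α] (x : α → Matrix (Fin n) (Fin n) K), (∀ k, (x k).det = 1) →
    ∃ (b : Matrix (Fin n) (Fin n) K) (R : ℝ), b.det ≠ 0 ∧ 1 ≤ R ∧ (∀ k, nm v (b * x k * b⁻¹) ≤ R) ∧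
      ∃ w : List α, w ≠ [] ∧ w.length ≤ N₀ ∧ ∃ μ, ((w.map x).prod).charpoly.IsRoot μ ∧
        η₁ * R ^ w.length ≤ v μ := by
  have hn' : (1 : ℝ) ≤ n := by exact_mod_cast hn
  set τ : ℝ := 1 / (32 * n ^ 2) with hτd
  have hτ : 0 < τ := by positivity
  obtain ⟨η, N, hη, hrad⟩ := radical_lemma n (τ ^ n / n ^ 2) (by positivity)
  refine ⟨max N 1, min (η / 2 ^ n) 1, le_max_right _ _, by positivity, ?_⟩
  intro K _ _ v hv α _ _ x hx
  have : Nonempty (Fin n) := ⟨⟨0, hn⟩⟩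
  have := Fintype.ofFinite α
  let r : Matrix (Fin n) (Fin n) K → ℝ := fun b => Finset.univ.sup' Finset.univ_nonempty fun k => nm v (b * x k * b⁻¹)
  have hrle : ∀ b k, nm v (b * x k * b⁻¹) ≤ r b := fun b k =>
    Finset.le_sup' (f := fun k => nm v (b * x k * b⁻¹)) (Finset.mem_univ k)
  have hconjdet : ∀ b : Matrix (Fin n) (Fin n) K, b.det ≠ 0 → ∀ k, (b * x k * b⁻¹).det = 1 := by
    intro b hb k
    rw [Matrix.det_conj (by rwa [Matrix.isUnit_iff_isUnit_det, isUnit_iff_ne_zero]), hx]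
  have hr1 : ∀ b : Matrix (Fin n) (Fin n) K, b.det ≠ 0 → 1 ≤ r b := fun b hb =>
    (one_le_nm v (hconjdet b hb (Classical.arbitrary α))).trans (hrle b _)
  obtain ⟨b, hb, hopt⟩ : ∃ b : Matrix (Fin n) (Fin n) K, b.det ≠ 0 ∧ ∀ b' : Matrix (Fin n) (Fin n) K, b'.det ≠ 0 →
      r b ≤ 2 * r b' := by
    let T : Set ℝ := r '' {B | B.det ≠ 0}
    have hT : BddBelow T := ⟨1, by rintro _ ⟨B, hB, rfl⟩; exact hr1 B hB⟩
    have hne : T.Nonempty := ⟨r 1, 1, by simp, rfl⟩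
    have hs : 1 ≤ sInf T := le_csInf hne (by rintro _ ⟨B, hB, rfl⟩; exact hr1 B hB)
    obtain ⟨_, ⟨B₀, hB₀, rfl⟩, h⟩ := exists_lt_of_csInf_lt hne (show sInf T < 2 * sInf T by linarith)
    refine ⟨B₀, hB₀, fun B hB => ?_⟩
    have := csInf_le hT ⟨B, hB, rfl⟩
    linarith
  have hR1 := hr1 b hb
  refine ⟨b, r b, hb, hR1, hrle b, ?_⟩
  set R := r b with hR
  by_contra hcon
  push Not at hcon
  obtain ⟨c, hc1, hc2⟩ := dense_values v hv (r := R) (by linarith)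
  have hc0 : c ≠ 0 := by
    rintro rfl
    rw [map_zero] at hc1; linarith
  have hvc : 0 < v c := v.pos hc0
  let y : α → Matrix (Fin n) (Fin n) K := fun k => c⁻¹ • (b * x k * b⁻¹)
  have hbb : b⁻¹ * b = 1 := Matrix.nonsing_inv_mul _ (isUnit_iff_ne_zero.mpr hb)
  have hbb' : b * b⁻¹ = 1 := Matrix.mul_nonsing_inv _ (isUnit_iff_ne_zero.mpr hb)
  have hy1 : ∀ k, nm v (y k) ≤ 1 := by
    intro k
    simp only [y]
    rw [nm_smul, map_inv₀, inv_mul_le_iff₀ hvc, mul_one]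
    exact (hrle b k).trans hc1
  have hyw : ∀ w : List α, (w.map y).prod = (c⁻¹) ^ w.length • (b * (w.map x).prod * b⁻¹) := by
    intro w
    induction w with
    | nil => simp [hbb']
    | cons a w ih =>
      rw [List.map_cons, List.prod_cons, ih, List.length_cons, List.map_cons, List.prod_cons]
      simp only [y, Matrix.smul_mul, Matrix.mul_smul, smul_smul]
      rw [pow_succ]
      congr 1
      calc b * x a * b⁻¹ * (b * (w.map x).prod * b⁻¹) = b * x a * (b⁻¹ * b) * (w.map x).prod * b⁻¹ := by
            simp only [mul_assoc]
        _ = _ := by rw [hbb]; simp only [mul_assoc, one_mul]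
  have hroot : ∀ (w : List α) μ, ((w.map y).prod).charpoly.IsRoot μ →
      ((w.map x).prod).charpoly.IsRoot (c ^ w.length * μ) := by
    intro w μ hμ
    rw [Polynomial.IsRoot, Matrix.eval_charpoly] at hμ ⊢
    rw [hyw] at hμ
    have e : Matrix.scalar (Fin n) (c ^ w.length * μ) - (w.map x).prod =
        c ^ w.length • (b⁻¹ * (Matrix.scalar (Fin n) μ - (c⁻¹) ^ w.length • (b * (w.map x).prod * b⁻¹)) * b) := by
      have hs : ∀ t : K, Matrix.scalar (Fin n) t = t • (1 : Matrix (Fin n) (Fin n) K) := by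
        intro t; rw [Matrix.scalar_apply, Matrix.smul_one_eq_diagonal]
      rw [hs, hs, mul_sub, sub_mul, smul_sub]
      simp only [Matrix.smul_mul, Matrix.mul_smul, mul_one, hbb, smul_smul]
      congr 1
      rw [← mul_pow, mul_inv_cancel₀ hc0, one_pow, one_smul]
      calc (w.map x).prod = (b⁻¹ * b) * (w.map x).prod * (b⁻¹ * b) := by rw [hbb]; simp
        _ = _ := by simp only [mul_assoc]
    rw [e, Matrix.det_smul, Matrix.det_mul, Matrix.det_mul, hμ]; simp
  have hsmall : SmallWords v y N η := by
    intro w hw hwl i hi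
    have := charpoly_coeff_small v (η := min (η / 2 ^ n) 1) (by positivity) (min_le_right _ _) (w.map y).prod ?_ i hi
    · refine this.trans ?_
      calc 2 ^ n * min (η / 2 ^ n) 1 ≤ 2 ^ n * (η / 2 ^ n) := by gcongr; exact min_le_left _ _
        _ = η := by field_simp
    · intro μ hμ
      have h1 := hcon w hw (hwl.trans (le_max_left _ _)) _ (hroot w μ hμ)
      rw [map_mul, map_pow] at h1
      by_contra h2
      push Not at h2
      have h3 : R ^ w.length ≤ v c ^ w.length := pow_le_pow_left₀ (by linarith) hc1 _
      have h4 : 0 < min (η / 2 ^ n) 1 := by positivity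
      have h5 : 0 < R ^ w.length := by positivity
      nlinarith [mul_le_mul h3 h2.le h4.le (by positivity)]
  have hprod : ∀ w : List α, w.length = n → nm v (w.map y).prod ≤ τ ^ n := by
    intro w hw
    subst hw
    have h1 := hrad K v (fun k : Fin w.length => y (w.get k)) (fun k i j => (entry_le v _ i j).trans (hy1 _)) ?_
    · have e : List.ofFn (fun k : Fin w.length => y (w.get k)) = w.map y := by
        have e0 : List.map y (List.ofFn w.get) = List.ofFn (y ∘ w.get) := List.map_ofFn
        have e1 : List.map y (List.ofFn w.get) = List.map y w := congrArg _ (List.ofFn_get w)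
        rw [← e1, e0]; rfl
      rw [e] at h1
      refine (nm_le_sqcard v h1).trans (le_of_eq ?_)
      rw [Fintype.card_fin]
      field_simp
    · intro u hu hul i hi
      have := hsmall (u.map w.get) (by simpa using hu) (by simpa using hul) i hi
      rw [List.map_map] at this
      exact this
  obtain ⟨B, hB, hBs⟩ := conj_small v hv hn y τ hτ hprod
  have hBu : IsUnit B.det := isUnit_iff_ne_zero.mpr hB
  have hBi : (B⁻¹).det ≠ 0 := by
    rw [Matrix.det_nonsing_inv, Ring.inverse_eq_inv']; exact inv_ne_zero hB
  have h1 := hopt (B⁻¹ * b) (by rw [Matrix.det_mul]; exact mul_ne_zero hBi hb)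
  have h2 : r (B⁻¹ * b) ≤ R / 4 := by
    refine Finset.sup'_le _ _ fun k _ => ?_
    have e : B⁻¹ * b * x k * (B⁻¹ * b)⁻¹ = c • (B⁻¹ * y k * B) := by
      rw [Matrix.mul_inv_rev, Matrix.nonsing_inv_nonsing_inv _ hBu]
      simp only [y, Matrix.mul_smul, Matrix.smul_mul, smul_smul, mul_inv_cancel₀ hc0, one_smul]
      simp only [mul_assoc]
    rw [e, nm_smul]
    have h3 := nm_le_sqcard v (hBs k)
    rw [Fintype.card_fin] at h3
    calc v c * nm v (B⁻¹ * y k * B) ≤ (2 * R) * (n ^ 2 * (4 * τ)) :=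
          mul_le_mul hc2 h3 (nm_nonneg _ _) (by linarith)
      _ = R / 4 := by rw [hτd]; field_simp; norm_num
  linarith

end EG

namespace EG

open Polynomial in
lemma power_bound {K : Type*} [Field K] (v : AbsoluteValue K ℝ) {n : ℕ} (B : Matrix (Fin n) (Fin n) K)
    {ρ : ℝ} (hρ : 0 < ρ) (s : Multiset K) (hs : ∀ a ∈ s, v a ≤ ρ) :
    ∀ E : Matrix (Fin n) (Fin n) K, aeval B ((s.map (fun a => X - C a)).prod) * E = 0 →
    ∀ M : ℕ, nm v (B ^ M * E) ≤ (2 * ρ) ^ M * ((1 + nm v B / ρ) ^ (Multiset.card s) * nm v E) := by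
  induction s using Multiset.induction_on with
  | empty =>
    intro E hE M
    simp only [Multiset.map_zero, Multiset.prod_zero, map_one, one_mul] at hE
    subst hE
    simp
  | cons a s ih =>
    have ih := ih (fun b hb => hs b (Multiset.mem_cons_of_mem hb))
    have ha := hs a (Multiset.mem_cons_self a s)
    intro E hE
    have hE' : aeval B ((s.map (fun a => X - C a)).prod) * (B * E - a • E) = 0 := by
      rw [Multiset.map_cons, Multiset.prod_cons, mul_comm, map_mul, mul_assoc] at hE
      rw [← hE]
      congr 1
      simp [sub_mul, Algebra.algebraMap_eq_smul_one]
    have h1 := ih _ hE'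
    have hnE' : nm v (B * E - a • E) ≤ (nm v B + ρ) * nm v E := by
      refine (nm_sub_le v _ _).trans ?_
      rw [nm_smul, add_mul]
      exact add_le_add (nm_mul_le v _ _) (mul_le_mul_of_nonneg_right ha (nm_nonneg v E))
    have hB := nm_nonneg v B
    have hE0 := nm_nonneg v E
    have hc : (0 : ℝ) ≤ nm v B / ρ := by positivity
    have hck : (1 : ℝ) ≤ (1 + nm v B / ρ) ^ Multiset.card s := one_le_pow₀ (by linarith)
    rw [Multiset.card_cons]
    intro M
    induction M with
    | zero =>
      simp only [pow_zero, one_mul]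
      have : (1 : ℝ) ≤ (1 + nm v B / ρ) ^ (Multiset.card s + 1) := one_le_pow₀ (by linarith)
      nlinarith
    | succ M ihM =>
      have e : B ^ (M + 1) * E = a • (B ^ M * E) + B ^ M * (B * E - a • E) := by
        rw [pow_succ, mul_sub, Matrix.mul_smul, mul_assoc]; abel
      rw [e]
      refine (nm_add_le v _ _).trans ?_
      rw [nm_smul]
      have h2 : v a * nm v (B ^ M * E) ≤ ρ * ((2 * ρ) ^ M * ((1 + nm v B / ρ) ^ (Multiset.card s + 1) * nm v E)) :=
        mul_le_mul ha ihM (nm_nonneg _ _) hρ.le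
      have h3 : nm v (B ^ M * (B * E - a • E)) ≤
          ρ * ((2 * ρ) ^ M * ((1 + nm v B / ρ) ^ (Multiset.card s + 1) * nm v E)) := by
        refine (h1 M).trans ?_
        calc _ ≤ (2 * ρ) ^ M * ((1 + nm v B / ρ) ^ Multiset.card s * ((nm v B + ρ) * nm v E)) := by
              gcongr
          _ = _ := by
              rw [pow_succ]; field_simp; ring
      calc _ ≤ _ := add_le_add h2 h3
        _ = _ := by rw [pow_succ]; ring

open Polynomial in
lemma aeval_prod_le {K : Type*} [Field K] (v : AbsoluteValue K ℝ) {n : ℕ} (B : Matrix (Fin n) (Fin n) K)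
    {c : ℝ} (hc : (n : ℝ) ≤ c) (s : Multiset K[X]) (hs : ∀ f ∈ s, nm v (aeval B f) ≤ c) :
    nm v (aeval B s.prod) ≤ c ^ (Multiset.card s + 1) := by
  induction s using Multiset.induction_on with
  | empty => simpa using hc
  | cons a s ih =>
    rw [Multiset.prod_cons, map_mul, Multiset.card_cons, pow_succ']
    exact nm_mul_le_of v (hs a (Multiset.mem_cons_self a s)) (ih fun b hb => hs b (Multiset.mem_cons_of_mem hb))

open Polynomial in
lemma aeval_commute {K A : Type*} [Field K] [Ring A] [Algebra K A] {g h : A} (hgh : Commute g h) (f : K[X]) :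
    Commute (aeval g f) h := by
  induction f using Polynomial.induction_on' with
  | add p q hp hq => rw [map_add]; exact hp.add_left hq
  | monomial k a =>
    rw [aeval_monomial]
    exact Commute.mul_left (show Commute (algebraMap K A a) h from Algebra.commutes a h) (hgh.pow_left k)

open Polynomial in
lemma aeval_inv {K : Type*} [Field K] {n : ℕ} (g : Matrix (Fin n) (Fin n) K) (hg : g.det ≠ 0)
    (s : Multiset K) (hs : ∀ a ∈ s, a ≠ 0) :
    ∃ D, aeval g⁻¹ (((s.map (fun a => a⁻¹)).map (fun a => X - C a)).prod) =
      D * aeval g ((s.map (fun a => X - C a)).prod) := by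
  induction s using Multiset.induction_on with
  | empty => exact ⟨1, by simp⟩
  | cons a s ih =>
    obtain ⟨D, hD⟩ := ih (fun b hb => hs b (Multiset.mem_cons_of_mem hb))
    have ha := hs a (Multiset.mem_cons_self a s)
    have hgg : g⁻¹ * g = 1 := Matrix.nonsing_inv_mul _ (isUnit_iff_ne_zero.mpr hg)
    refine ⟨D * (-(a⁻¹ • g⁻¹)), ?_⟩
    simp only [Multiset.map_cons, Multiset.prod_cons]
    rw [mul_comm, map_mul, hD, map_mul]
    have e1 : aeval g⁻¹ (X - C a⁻¹) = (-(a⁻¹ • g⁻¹)) * aeval g (X - C a) := by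
      simp only [map_sub, aeval_X, aeval_C, Algebra.algebraMap_eq_smul_one, mul_sub, neg_mul, Matrix.smul_mul,
        Matrix.mul_smul, mul_one, hgg, smul_neg, smul_smul, mul_inv_cancel₀ ha, one_smul]
      abel
    have hcomm : Commute (aeval g ((s.map (fun a => X - C a)).prod)) (-(a⁻¹ • g⁻¹)) := by
      have h1 : Commute g g⁻¹ := by
        show g * g⁻¹ = g⁻¹ * g
        rw [hgg, Matrix.mul_nonsing_inv _ (isUnit_iff_ne_zero.mpr hg)]
      have h2 : Commute (aeval g ((s.map (fun a => X - C a)).prod)) g⁻¹ := by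
        exact aeval_commute h1 _
      exact (h2.smul_right _).neg_right
    rw [e1, mul_assoc, mul_assoc, ← mul_assoc (aeval g _), hcomm.eq]
    rw [mul_assoc, ← map_mul, ← map_mul, mul_comm (X - C a)]

open Polynomial in
/-- spectral idempotent as a polynomial -/
lemma exists_idem_poly {K : Type*} [Field K] (L S : Multiset K) (hLS : ∀ a ∈ L, ∀ b ∈ S, a ≠ b) :
    (L.map (fun a => X - C a)).prod ∣
      (L.map fun a => 1 - (S.map fun b => C ((a - b)⁻¹) * (X - C b)).prod).prod ∧
    (S.map (fun a => X - C a)).prod ∣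
      1 - (L.map fun a => 1 - (S.map fun b => C ((a - b)⁻¹) * (X - C b)).prod).prod := by
  have hroot : ∀ a ∈ L, X - C a ∣ 1 - (S.map fun b => C ((a - b)⁻¹) * (X - C b)).prod := by
    intro a ha
    rw [dvd_iff_isRoot, IsRoot, eval_sub, eval_one, sub_eq_zero, eval_multiset_prod, Multiset.map_map]
    symm
    apply Multiset.prod_eq_one
    intro x hx
    rw [Multiset.mem_map] at hx
    obtain ⟨b, hb, rfl⟩ := hx
    have := sub_ne_zero.mpr (hLS a ha b hb)
    simp [this]
  have hdiv : ∀ a : K, (S.map (fun a => X - C a)).prod ∣ (S.map fun b => C ((a - b)⁻¹) * (X - C b)).prod := by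
    intro a
    rw [Multiset.prod_map_mul]
    exact dvd_mul_left _ _
  clear hLS
  induction L using Multiset.induction_on with
  | empty => simp
  | cons a L ih =>
    obtain ⟨h1, h2⟩ := ih (fun b hb => hroot b (Multiset.mem_cons_of_mem hb))
    simp only [Multiset.map_cons, Multiset.prod_cons]
    refine ⟨mul_dvd_mul (hroot a (Multiset.mem_cons_self a L)) h1, ?_⟩
    set Q := (S.map fun b => C ((a - b)⁻¹) * (X - C b)).prod
    set T := (L.map fun a => 1 - (S.map fun b => C ((a - b)⁻¹) * (X - C b)).prod).prod
    have : 1 - (1 - Q) * T = (1 - T) + Q * T := by ring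
    rw [this]
    exact dvd_add h2 ((hdiv a).mul_right T)

lemma exists_gap {K : Type*} [Field K] [IsAlgClosed K] (v : AbsoluteValue K ℝ) {n : ℕ} 
    (g : Matrix (Fin n) (Fin n) K) (Θ : ℝ) (hΘ : 1 ≤ Θ) (μ : K) (hμ : g.charpoly.IsRoot μ) (hμv : Θ ^ n ≤ v μ) :
    ∃ i < n, ∀ a ∈ g.charpoly.roots, v a ≤ Θ ^ i ∨ Θ ^ (i + 1) ≤ v a := by
  classical
  by_contra hcon
  push Not at hcon
  choose! f hf using hcon
  have hinj : Set.InjOn f (Finset.range n) := by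
    intro i hi j hj hij
    simp only [Finset.coe_range, Set.mem_Iio] at hi hj
    by_contra hne
    rcases lt_or_gt_of_ne hne with h | h
    · have h1 := (hf i hi).2.2
      have h2 := (hf j hj).2.1
      rw [hij] at h1
      have h3 : Θ ^ (i + 1) ≤ Θ ^ j := pow_le_pow_right₀ hΘ h
      linarith
    · have h1 := (hf j hj).2.2
      have h2 := (hf i hi).2.1
      rw [hij] at h2
      have h3 : Θ ^ (j + 1) ≤ Θ ^ i := pow_le_pow_right₀ hΘ h
      linarith
  have hsub : (Finset.range n).image f ⊆ g.charpoly.roots.toFinset.erase μ := by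
    intro a ha
    rw [Finset.mem_image] at ha
    obtain ⟨i, hi, rfl⟩ := ha
    rw [Finset.mem_range] at hi
    rw [Finset.mem_erase, Multiset.mem_toFinset]
    refine ⟨?_, (hf i hi).1⟩
    intro h
    have h1 := (hf i hi).2.2
    rw [h] at h1
    have h3 : Θ ^ (i + 1) ≤ Θ ^ n := pow_le_pow_right₀ hΘ hi
    linarith
  have h1 := Finset.card_le_card hsub
  have hmem : μ ∈ g.charpoly.roots.toFinset := by
    rw [Multiset.mem_toFinset, Polynomial.mem_roots g.charpoly_monic.ne_zero]; exact hμ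
  have h3 : 0 < g.charpoly.roots.toFinset.card := Finset.card_pos.mpr ⟨μ, hmem⟩
  rw [Finset.card_image_of_injOn hinj, Finset.card_range, Finset.card_erase_of_mem hmem] at h1
  have h2 := Multiset.toFinset_card_le g.charpoly.roots
  have h4 := Polynomial.card_roots' g.charpoly
  rw [Matrix.charpoly_natDegree_eq_dim, Fintype.card_fin] at h4
  omega

set_option maxHeartbeats 600000 in
open Polynomial in
theorem spectral (n C₀ : ℕ) (hn : 1 ≤ n) : ∃ (C' : ℕ) (Θ₀ : ℝ), 16 ≤ Θ₀ ∧ ∀ q : ℕ, ∃ M : ℕ, 1 ≤ M ∧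
    ∀ (K : Type) [Field K] [IsAlgClosed K] (v : AbsoluteValue K ℝ) (Θ : ℝ), Θ₀ ≤ Θ →
    ∀ g : Matrix (Fin n) (Fin n) K, g.det = 1 → nm v g ≤ Θ ^ C₀ → nm v g⁻¹ ≤ Θ ^ C₀ →
    ∀ μ, g.charpoly.IsRoot μ → Θ ^ n ≤ v μ →
    ∃ p : Matrix (Fin n) (Fin n) K, p * p = p ∧ p ≠ 0 ∧ p ≠ 1 ∧ Commute g p ∧ nm v p ≤ Θ ^ C' ∧ nm v (1 - p) ≤ Θ ^ C' ∧
      nm v (g ^ M * (1 - p)) * nm v ((g⁻¹) ^ M * p) ≤ (Θ ^ q)⁻¹ := by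
  set C₁ := ((C₀ + 1) * (n + 1) + 1) * (n + 1) with hC₁
  set C₂ := (C₁ + 1) + (C₀ + 1) * n + ((C₁ + 1) + (C₀ + n + 1) * n) with hC₂
  refine ⟨C₁ + 1, max 16 (n + 1), le_max_left _ _, fun q => ⟨2 * (C₂ + q) + 1, by omega, ?_⟩⟩
  intro K _ _ v Θ hΘ g hg hgn hgn' μ hμ hμv
  classical
  have hΘ16 : 16 ≤ Θ := (le_max_left _ _).trans hΘ
  have hΘn : (n : ℝ) + 1 ≤ Θ := (le_max_right _ _).trans hΘ
  have hΘ1 : 1 ≤ Θ := by linarith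
  have hΘ0 : 0 < Θ := by linarith
  obtain ⟨i, hi, hgap⟩ := exists_gap v g Θ hΘ1 μ hμ hμv
  set L := g.charpoly.roots.filter (fun a => Θ ^ (i + 1) ≤ v a) with hL
  set S := g.charpoly.roots.filter (fun a => ¬ Θ ^ (i + 1) ≤ v a) with hS
  have hmono : ∀ a b : ℕ, a ≤ b → Θ ^ a ≤ Θ ^ b := fun a b h => pow_le_pow_right₀ hΘ1 h
  have hone : ∀ a : ℕ, 1 ≤ Θ ^ a := fun a => one_le_pow₀ hΘ1
  have hplus : ∀ (a : ℕ) (x : ℝ), x ≤ Θ ^ a → n + x ≤ Θ ^ (a + 1) := by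
    intro a x hx
    rw [pow_succ]
    have := hone a
    nlinarith
  have hSv : ∀ a ∈ S, v a ≤ Θ ^ i := by
    intro a ha
    rw [hS, Multiset.mem_filter] at ha
    exact (hgap a ha.1).resolve_right ha.2
  have hLv : ∀ a ∈ L, Θ ^ (i + 1) ≤ v a := by
    intro a ha
    rw [hL, Multiset.mem_filter] at ha
    exact ha.2
  have hdiff : ∀ a ∈ L, ∀ b ∈ S, 1 ≤ v (a - b) := by
    intro a ha b hb
    have h1 := hLv a ha
    have h2 := hSv b hb
    have h3 : v a ≤ v (a - b) + v b := by
      have := v.add_le (a - b) b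
      simpa using this
    rw [pow_succ] at h1
    have := hone i
    nlinarith
  have hLS : ∀ a ∈ L, ∀ b ∈ S, a ≠ b := by
    rintro a ha b hb rfl
    have := hdiff a ha a hb
    simp at this
    linarith
  have hadd : L + S = g.charpoly.roots := Multiset.filter_add_not _ _
  have hroots : ∀ a ∈ g.charpoly.roots, v a ≤ Θ ^ C₀ := fun a ha =>
    (root_le v (Polynomial.isRoot_of_mem_roots ha)).trans hgn
  have hmemr : ∀ a, a ∈ g.charpoly.roots ↔ g.charpoly.IsRoot a := fun a =>
    Polynomial.mem_roots g.charpoly_monic.ne_zero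
  have hsp := IsAlgClosed.splits g.charpoly
  have hchi : g.charpoly = (L.map (fun a => X - C a)).prod * (S.map (fun a => X - C a)).prod := by
    rw [← Multiset.prod_add, ← Multiset.map_add, hadd]
    exact hsp.eq_prod_roots_of_monic g.charpoly_monic
  have hcard : Multiset.card L + Multiset.card S = n := by
    rw [← Multiset.card_add, hadd, ← hsp.natDegree_eq_card_roots, Matrix.charpoly_natDegree_eq_dim, Fintype.card_fin]
  have hL0 : ∀ a ∈ L, a ≠ 0 := by
    rintro a ha rfl
    have := hLv _ ha
    rw [map_zero] at this
    linarith [hone (i + 1)]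
  have hμL : μ ∈ L := by
    rw [hL, Multiset.mem_filter]
    exact ⟨(hmemr μ).mpr hμ, (hmono _ _ hi).trans hμv⟩
  have hSne : ∃ b, b ∈ S := by
    by_contra hc
    push Not at hc
    have hS0 : S = 0 := Multiset.eq_zero_of_forall_notMem hc
    have hLr : L = g.charpoly.roots := by rw [← hadd, hS0, add_zero]
    have hd : g.det = g.charpoly.roots.prod := Matrix.det_eq_prod_roots_charpoly g
    have h1 : ∀ s : Multiset K, (∀ a ∈ s, 1 ≤ v a) → 1 ≤ v s.prod := by
      intro s
      induction s using Multiset.induction_on with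
      | empty => intro _; simp
      | cons a s ih =>
        intro h
        rw [Multiset.prod_cons, map_mul]
        exact one_le_mul_of_one_le_of_one_le (h a (Multiset.mem_cons_self a s))
          (ih fun b hb => h b (Multiset.mem_cons_of_mem hb))
    have h2 : μ ::ₘ (g.charpoly.roots.erase μ) = g.charpoly.roots := Multiset.cons_erase ((hmemr μ).mpr hμ)
    have h3 := h1 (g.charpoly.roots.erase μ) (by
      intro a ha
      have : a ∈ L := by rw [hLr]; exact Multiset.mem_of_mem_erase ha
      exact (hone _).trans (hLv a this))
    rw [hg, ← h2, Multiset.prod_cons] at hd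
    have h4 : (1 : ℝ) = v μ * v (g.charpoly.roots.erase μ).prod := by rw [← map_mul, ← hd, map_one]
    have h5 : Θ ^ 1 ≤ v μ := (hmono _ _ hn).trans hμv
    rw [pow_one] at h5
    nlinarith
  obtain ⟨b, hb⟩ := hSne
  obtain ⟨hd1, hd2⟩ := exists_idem_poly L S hLS
  set T := (L.map fun a => 1 - (S.map fun b => C ((a - b)⁻¹) * (X - C b)).prod).prod with hT
  have hz : ∀ f : K[X], g.charpoly ∣ f → aeval g f = 0 := by
    rintro f ⟨u, rfl⟩
    rw [map_mul, Matrix.aeval_self_charpoly, zero_mul]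
  set p := aeval g (1 - T) with hp
  have hp1 : 1 - p = aeval g T := by rw [hp, map_sub, map_one]; abel
  clear_value p T L S C₁ C₂
  have hidem : p * p = p := by
    have : p * (1 - p) = 0 := by
      rw [hp1, hp, ← map_mul]
      apply hz
      rw [hchi, mul_comm (1 - T)]
      exact mul_dvd_mul hd1 hd2
    rw [mul_sub, mul_one, sub_eq_zero] at this
    exact this.symm
  have hspec : ∀ a ∈ g.charpoly.roots, ∀ f : K[X], eval a f ∈ spectrum K (aeval g f) := by
    intro a ha f
    apply spectrum.subset_polynomial_aeval
    refine ⟨a, ?_, rfl⟩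
    rw [Matrix.mem_spectrum_iff_isRoot_charpoly]
    exact (hmemr a).mp ha
  have hnt : Nonempty (Fin n) := ⟨⟨0, hn⟩⟩
  have hp0 : p ≠ 0 := by
    intro h0
    have h1 := hspec μ ((hmemr μ).mpr hμ) (1 - T)
    rw [← hp, h0, spectrum.zero_eq, Set.mem_singleton_iff] at h1
    have h2 : eval μ T = 0 := by
      have : X - C μ ∣ T := (Multiset.dvd_prod (Multiset.mem_map_of_mem (fun a : K => X - C a) hμL)).trans hd1
      exact dvd_iff_isRoot.mp this
    rw [eval_sub, h2] at h1
    simp at h1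
  have hp1' : p ≠ 1 := by
    intro h0
    have hbr : b ∈ g.charpoly.roots := Multiset.mem_of_mem_filter (by rw [hS] at hb; exact hb)
    have h1 := hspec b hbr T
    rw [← hp1, h0, sub_self, spectrum.zero_eq, Set.mem_singleton_iff] at h1
    have h2 : eval b (1 - T) = 0 := by
      have : X - C b ∣ 1 - T := (Multiset.dvd_prod (Multiset.mem_map_of_mem (fun a : K => X - C a) hb)).trans hd2
      exact dvd_iff_isRoot.mp this
    rw [eval_sub, h1] at h2
    simp at h2
  have hcomm : Commute g p := by rw [hp]; exact (aeval_commute (Commute.refl g) (1 - T)).symm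
  -- norm bounds
  have hn1 : (n : ℝ) ≤ Θ := by linarith
  have hge : ∀ a : ℕ, 1 ≤ a → (n : ℝ) ≤ Θ ^ a := fun a ha => hn1.trans (by simpa using hmono 1 a ha)
  have hq1 : ∀ a ∈ L, ∀ b ∈ S, nm v (aeval g (C ((a - b)⁻¹) * (X - C b))) ≤ Θ ^ (C₀ + 1) := by
    intro a ha b hb
    rw [map_mul, aeval_C, Algebra.algebraMap_eq_smul_one, Matrix.smul_mul, one_mul, nm_smul, map_inv₀]
    have h1 := hdiff a ha b hb
    have h2 : nm v (aeval g (X - C b)) ≤ Θ ^ (C₀ + 1) := by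
      rw [map_sub, aeval_X, aeval_C, Algebra.algebraMap_eq_smul_one]
      refine (nm_sub_le v _ _).trans ?_
      rw [nm_smul, nm_one, Fintype.card_fin, pow_succ]
      have h3 := hroots b (Multiset.mem_of_mem_filter (by rw [hS] at hb; exact hb))
      have h4 := hone C₀
      nlinarith [mul_le_mul_of_nonneg_right h3 (Nat.cast_nonneg n : (0 : ℝ) ≤ n)]
    calc _ ≤ 1 * nm v (aeval g (X - C b)) := by
          gcongr
          · exact nm_nonneg _ _
          · exact inv_le_one_of_one_le₀ h1
      _ ≤ _ := by rw [one_mul]; exact h2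
  have hq2 : ∀ a ∈ L, nm v (aeval g (1 - (S.map fun b => C ((a - b)⁻¹) * (X - C b)).prod)) ≤ 
      Θ ^ ((C₀ + 1) * (n + 1) + 1) := by
    intro a ha
    rw [map_sub, map_one]
    refine (nm_sub_le v _ _).trans ?_
    rw [nm_one, Fintype.card_fin]
    apply hplus
    have := aeval_prod_le v g (c := Θ ^ (C₀ + 1)) (hge _ (by omega)) (S.map fun b => C ((a - b)⁻¹) * (X - C b)) (by
      intro f hf
      rw [Multiset.mem_map] at hf
      obtain ⟨b, hb, rfl⟩ := hf
      exact hq1 a ha b hb)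
    refine this.trans ?_
    rw [← pow_mul, Multiset.card_map]
    apply hmono
    apply Nat.mul_le_mul_left
    omega
  have hT1 : nm v (aeval g T) ≤ Θ ^ C₁ := by
    rw [hT]
    have := aeval_prod_le v g (c := Θ ^ ((C₀ + 1) * (n + 1) + 1)) (hge _ (by omega))
      (L.map fun a => 1 - (S.map fun b => C ((a - b)⁻¹) * (X - C b)).prod) (by
      intro f hf
      rw [Multiset.mem_map] at hf
      obtain ⟨b, hb, rfl⟩ := hf
      exact hq2 b hb)
    refine this.trans ?_
    rw [← pow_mul, Multiset.card_map]
    apply hmono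
    rw [hC₁]
    apply Nat.mul_le_mul_left
    omega
  have hpn' : nm v (1 - p) ≤ Θ ^ (C₁ + 1) := by
    rw [hp1]; exact hT1.trans (hmono _ _ (Nat.le_succ _))
  have hpn : nm v p ≤ Θ ^ (C₁ + 1) := by
    rw [hp, map_sub, map_one]
    refine (nm_sub_le v _ _).trans ?_
    rw [nm_one, Fintype.card_fin]
    exact hplus _ _ hT1
  refine ⟨p, hidem, hp0, hp1', hcomm, hpn, hpn', ?_⟩
  obtain ⟨M, hM⟩ : ∃ M, M = 2 * (C₂ + q) + 1 := ⟨_, rfl⟩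
  rw [← hM]
  -- contraction on the small part
  have hb1 : nm v (g ^ M * (1 - p)) ≤ (2 * Θ ^ i) ^ M * Θ ^ ((C₁ + 1) + (C₀ + 1) * n) := by
    have := power_bound v g (ρ := Θ ^ i) (by positivity) S hSv (1 - p) (by
      rw [hp1, ← map_mul]
      apply hz
      rw [hchi, mul_comm]
      exact mul_dvd_mul_left _ hd1) M
    refine this.trans ?_
    have h1 : 1 + nm v g / Θ ^ i ≤ Θ ^ (C₀ + 1) := by
      have h2 : nm v g / Θ ^ i ≤ Θ ^ C₀ := by
        rw [div_le_iff₀ (by positivity)]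
        have := hone i
        nlinarith [nm_nonneg v g]
      have h3 : (1 : ℝ) ≤ n := by exact_mod_cast hn
      linarith [hplus _ _ h2]
    have h0 : 0 ≤ 1 + nm v g / Θ ^ i := by have := nm_nonneg v g; positivity
    have h4 : (1 + nm v g / Θ ^ i) ^ Multiset.card S ≤ Θ ^ ((C₀ + 1) * n) := by
      calc _ ≤ (Θ ^ (C₀ + 1)) ^ Multiset.card S := pow_le_pow_left₀ h0 h1 _
        _ ≤ _ := by rw [← pow_mul]; apply hmono; apply Nat.mul_le_mul_left; omega
    rw [pow_add, mul_comm (Θ ^ (C₁ + 1))]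
    have := nm_nonneg v (1 - p)
    gcongr
  have hb2 : nm v ((g⁻¹) ^ M * p) ≤ (2 * (Θ ^ (i + 1))⁻¹) ^ M * Θ ^ ((C₁ + 1) + (C₀ + n + 1) * n) := by
    have := power_bound v g⁻¹ (ρ := (Θ ^ (i + 1))⁻¹) (by positivity) (L.map (fun a => a⁻¹)) (by
      intro a ha
      rw [Multiset.mem_map] at ha
      obtain ⟨c, hc, rfl⟩ := ha
      rw [map_inv₀]
      exact inv_anti₀ (by positivity) (hLv c hc)) p (by
      obtain ⟨D, hD⟩ := aeval_inv g (by rw [hg]; exact one_ne_zero) L hL0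
      rw [hD, mul_assoc, hp, ← map_mul, hz, mul_zero]
      rw [hchi]
      exact mul_dvd_mul_left _ hd2) M
    refine this.trans ?_
    rw [Multiset.card_map]
    have h1 : 1 + nm v g⁻¹ / (Θ ^ (i + 1))⁻¹ ≤ Θ ^ (C₀ + n + 1) := by
      have h2 : nm v g⁻¹ / (Θ ^ (i + 1))⁻¹ ≤ Θ ^ (C₀ + n) := by
        rw [div_inv_eq_mul, pow_add Θ C₀ n]
        exact mul_le_mul hgn' (hmono _ _ hi) (by positivity) (by positivity)
      have h3 : (1 : ℝ) ≤ n := by exact_mod_cast hn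
      linarith [hplus _ _ h2]
    have h0 : 0 ≤ 1 + nm v g⁻¹ / (Θ ^ (i + 1))⁻¹ := by have := nm_nonneg v g⁻¹; positivity
    have h4 : (1 + nm v g⁻¹ / (Θ ^ (i + 1))⁻¹) ^ Multiset.card L ≤ Θ ^ ((C₀ + n + 1) * n) := by
      calc _ ≤ (Θ ^ (C₀ + n + 1)) ^ Multiset.card L := pow_le_pow_left₀ h0 h1 _
        _ ≤ _ := by rw [← pow_mul]; apply hmono; apply Nat.mul_le_mul_left; omega
    rw [pow_add Θ (C₁ + 1), mul_comm (Θ ^ (C₁ + 1))]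
    have := nm_nonneg v p
    gcongr
  calc nm v (g ^ M * (1 - p)) * nm v ((g⁻¹) ^ M * p)
      ≤ ((2 * Θ ^ i) ^ M * Θ ^ ((C₁ + 1) + (C₀ + 1) * n)) *
        ((2 * (Θ ^ (i + 1))⁻¹) ^ M * Θ ^ ((C₁ + 1) + (C₀ + n + 1) * n)) :=
        mul_le_mul hb1 hb2 (nm_nonneg _ _) (by positivity)
    _ = (4 / Θ) ^ M * Θ ^ C₂ := by
        have e : (2 * Θ ^ i) ^ M * (2 * (Θ ^ (i + 1))⁻¹) ^ M = (4 / Θ) ^ M := by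
          rw [← mul_pow]
          congr 1
          rw [pow_succ]; field_simp; norm_num
        rw [← e, hC₂, pow_add Θ (C₁ + 1 + (C₀ + 1) * n)]; ring
    _ ≤ (Θ ^ (C₂ + q))⁻¹ * Θ ^ C₂ := by
        gcongr
        rw [hM, pow_succ, pow_mul]
        have h1 : 4 / Θ ≤ 1 := by rw [div_le_one hΘ0]; linarith
        have h2 : (4 / Θ) ^ 2 ≤ Θ⁻¹ := by
          rw [div_pow, div_le_iff₀ (by positivity)]
          field_simp
          linarith
        calc ((4 / Θ) ^ 2) ^ (C₂ + q) * (4 / Θ) ≤ (Θ⁻¹) ^ (C₂ + q) * 1 := by gcongr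
          _ = _ := by rw [mul_one, inv_pow]
    _ = (Θ ^ q)⁻¹ := by
        rw [pow_add]; field_simp

end EG

namespace EG

lemma pp_alg {R : Type*} [Ring R] {p x a E W : R} (hp : p * p = p) (ha1 : a * p = a) (ha2 : p * a = a)
    (ha3 : p * x * p * a = p) (ha4 : a * (p * x * p) = p) (hE1 : E * p = E) (hE2 : p * E = 0)
    (hW1 : (1 + p * x * E * a) * W = 1) (hW2 : W * (1 + p * x * E * a) = 1) :
    ∃ E'' b b' : R, p * b = b ∧ b * p = b ∧ p * b' = b' ∧ b' * p = b' ∧ b * b' = p ∧ b' * b = p ∧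
      x * (p + E) = (p + E'') * b ∧ p * E'' = 0 ∧ E'' * p = E'' ∧
      E'' - (x * a - p) = (x * E * a - x * a * (p * x * E * a)) * W * p := by
  set u := p * x * E * a with hu
  have hpu : p * u = u := by rw [hu]; simp only [← mul_assoc, hp]
  have hup : u * p = u := by rw [hu, mul_assoc, ha1]
  have hWp : W * p = p * W := by
    calc W * p = W * p * ((1 + u) * W) := by rw [hW1, mul_one]
      _ = W * (p * (1 + u)) * W := by simp only [mul_assoc]
      _ = W * ((1 + u) * p) * W := by rw [mul_add, add_mul, hpu, hup, mul_one, one_mul]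
      _ = (W * (1 + u)) * p * W := by simp only [mul_assoc]
      _ = p * W := by rw [hW2, one_mul]
  have hua : u * (p * x * p) = p * x * E := by
    rw [hu, mul_assoc, ha4, mul_assoc, hE1]
  set b := p * x * (p + E) with hb
  set b' := a * W * p with hb'
  have hb1 : b = (p + u) * (p * x * p) := by
    rw [add_mul, hua, hb, mul_add, ← mul_assoc p (p * x), ← mul_assoc p p, hp]
  have hb2 : b = p * (1 + u) * (p * x * p) := by rw [hb1, mul_add, mul_one, hpu]
  have hpb : p * b = b := by rw [hb]; simp only [← mul_assoc, hp]
  have hbp : b * p = b := by rw [hb, mul_assoc, add_mul, hp, hE1]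
  have hpb' : p * b' = b' := by rw [hb', ← mul_assoc, ← mul_assoc, ha2]
  have hbp' : b' * p = b' := by rw [hb', mul_assoc, hp]
  have hbb' : b * b' = p := by
    calc b * b' = p * (1 + u) * ((p * x * p) * a) * W * p := by rw [hb2, hb']; simp only [mul_assoc]
      _ = p * (1 + u) * (p * W) * p := by rw [ha3]; simp only [mul_assoc]
      _ = p * ((1 + u) * W) * (p * p) := by rw [← hWp]; simp only [mul_assoc]
      _ = p := by rw [hW1, mul_one, hp, hp]
  have hb'b : b' * b = p := by
    calc b' * b = a * W * (p * p) * (1 + u) * (p * x * p) := by rw [hb2, hb']; simp only [mul_assoc]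
      _ = a * (p * W) * (1 + u) * (p * x * p) := by rw [hp, ← hWp]; simp only [mul_assoc]
      _ = (a * p) * (W * (1 + u)) * (p * x * p) := by simp only [mul_assoc]
      _ = p := by rw [hW2, mul_one, ha1, ha4]
  refine ⟨x * (p + E) * b' - p, b, b', hpb, hbp, hpb', hbp', hbb', hb'b, ?_, ?_, ?_, ?_⟩
  · rw [add_sub_cancel, mul_assoc, hb'b, mul_assoc, add_mul, hp, hE1]
  · rw [mul_sub, hp, show p * (x * (p + E) * b') = b * b' by rw [hb]; simp only [mul_assoc], hbb', sub_self]
  · rw [sub_mul, hp, mul_assoc, hbp']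
  · have e1 : W = 1 - u * W := by
      rw [eq_sub_iff_add_eq]
      calc W + u * W = (1 + u) * W := by rw [add_mul, one_mul]
        _ = 1 := hW1
    have e2 : a * W * p = a - a * u * W * p := by
      calc a * W * p = a * (1 - u * W) * p := by rw [← e1]
        _ = _ := by rw [mul_sub, sub_mul, mul_one, ha1]; simp only [mul_assoc]
    calc x * (p + E) * b' - p - (x * a - p) = x * E * (a * W * p) + x * (p * (a * W * p)) - x * a := by
          rw [hb']; noncomm_ring
      _ = x * E * (a * W * p) + x * (a - a * u * W * p) - x * a := by
          rw [show p * (a * W * p) = a * W * p by simpa [hb'] using hpb', ← e2]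
      _ = _ := by noncomm_ring

theorem pp_main {K : Type*} [Field K] (v : AbsoluteValue K ℝ) {n : ℕ} (hn : 1 ≤ n) {Γ : Type*} [Group Γ]
    (φ : Γ →* Matrix (Fin n) (Fin n) K) (g h : Γ) (p x a : Matrix (Fin n) (Fin n) K) (c : K) (hc : c ≠ 0)
    (hx : φ h = c • x) (hp : p * p = p) (hgp : Commute (φ g) p) (ha1 : a * p = a) (ha2 : p * a = a)
    (ha3 : p * x * p * a = p) (ha4 : a * (p * x * p) = p)
    (A κ : ℝ) (hA : 1 ≤ A) (hκ0 : 0 ≤ κ) (hκ : nm v (φ g * (1 - p)) * nm v (φ g⁻¹ * p) ≤ κ)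
    (hxA : nm v x ≤ A) (hpA : nm v p ≤ A) (haA : nm v a ≤ A) (hκA : 32 * n * A ^ 6 * κ ≤ 1)
    (hz : (1 - p) * x * p ≠ 0) : FreePair g (h * g) := by
  set z := x * a - p with hzdef
  have hz0 : z ≠ 0 := by
    intro h0
    apply hz
    have e : x * a = p := by rwa [hzdef, sub_eq_zero] at h0
    have e2 : x * p = p * (p * x * p) := by
      calc x * p = x * (a * (p * x * p)) := by rw [ha4]
        _ = _ := by rw [← mul_assoc, e]
    rw [mul_assoc, e2, ← mul_assoc, sub_mul, one_mul, hp, sub_self, zero_mul]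
  have hNz := nm_pos v hz0
  have hpz : p * z = 0 := by
    rw [hzdef, mul_sub, hp, ← mul_assoc]
    nth_rewrite 1 [← ha2]
    rw [← mul_assoc, ha3, sub_self]
  have hn' : (1 : ℝ) ≤ n := by exact_mod_cast hn
  have hA0 : 0 ≤ A := by linarith
  have hNz2 : nm v z ≤ 2 * A ^ 2 := by
    refine (nm_sub_le v _ _).trans ?_
    have := nm_mul_le_of v hxA haA
    nlinarith
  set G := φ g with hG
  set Gi := φ g⁻¹ with hGi
  have hGG : G * Gi = 1 := by rw [hG, hGi, ← map_mul, mul_inv_cancel, map_one]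
  have hGG' : Gi * G = 1 := by rw [hG, hGi, ← map_mul, inv_mul_cancel, map_one]
  have hpG : G * p = p * G := hgp.eq
  have hpGi : Gi * p = p * Gi := by
    calc Gi * p = Gi * p * (G * Gi) := by rw [hGG, mul_one]
      _ = Gi * (p * G) * Gi := by simp only [mul_assoc]
      _ = (Gi * G) * p * Gi := by rw [← hpG]; simp only [mul_assoc]
      _ = _ := by rw [hGG', one_mul]
  let Ωs : Set (Matrix (Fin n) (Fin n) K) := {E | E * p = E ∧ p * E = 0}
  let U : Set (Matrix (Fin n) (Fin n) K) := {Y | p * Y = Y ∧ ∃ Y', Y * Y' = p ∧ Y' * Y = p}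
  -- uniqueness
  have huniq : ∀ E₁ ∈ Ωs, ∀ E₂ ∈ Ωs, ∀ Y₁ ∈ U, ∀ Y₂ ∈ U, (p + E₁) * Y₁ = (p + E₂) * Y₂ → E₁ = E₂ := by
    rintro E₁ ⟨h1, h2⟩ E₂ ⟨h3, h4⟩ Y₁ ⟨h5, Y₁', h6, h7⟩ Y₂ ⟨h8, _⟩ he
    have e1 : p * ((p + E₁) * Y₁) = Y₁ := by rw [← mul_assoc, mul_add, hp, h2, add_zero, h5]
    have e2 : p * ((p + E₂) * Y₂) = Y₂ := by rw [← mul_assoc, mul_add, hp, h4, add_zero, h8]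
    have e3 : Y₁ = Y₂ := by rw [← e1, ← e2, he]
    subst e3
    rw [add_mul, add_mul, add_right_inj] at he
    calc E₁ = E₁ * Y₁ * Y₁' := by rw [mul_assoc, h6, h1]
      _ = E₂ * Y₁ * Y₁' := by rw [he]
      _ = E₂ := by rw [mul_assoc, h6, h3]
  -- the action of G
  have hact : ∀ E ∈ Ωs, ∀ Y ∈ U, ∃ E₁ ∈ Ωs, ∃ Y₁ ∈ U, G * ((p + E) * Y) = (p + E₁) * Y₁ ∧ nm v E₁ ≤ κ * nm v E := by
    rintro E ⟨h1, h2⟩ Y ⟨h5, Y', h6, h7⟩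
    refine ⟨G * E * Gi, ⟨?_, ?_⟩, G * Y, ⟨?_, Y' * Gi, ?_, ?_⟩, ?_, ?_⟩
    · rw [mul_assoc, hpGi, ← mul_assoc, mul_assoc G E p, h1]
    · rw [← mul_assoc, ← mul_assoc, ← hpG, mul_assoc G p E, h2, mul_zero, zero_mul]
    · rw [← mul_assoc, ← hpG, mul_assoc, h5]
    · calc G * Y * (Y' * Gi) = G * (Y * Y') * Gi := by simp only [mul_assoc]
        _ = p * (G * Gi) := by rw [h6, hpG, mul_assoc]
        _ = p := by rw [hGG, mul_one]
    · calc Y' * Gi * (G * Y) = Y' * (Gi * G) * Y := by simp only [mul_assoc]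
        _ = p := by rw [hGG', mul_one, h7]
    · calc G * ((p + E) * Y) = (G * p) * Y + G * E * Y := by noncomm_ring
        _ = p * G * Y + G * E * (Gi * G) * Y := by rw [hpG, hGG', mul_one]
        _ = _ := by noncomm_ring
    · have e : G * E * Gi = (G * (1 - p)) * E * (Gi * p) := by
        have : G * (1 - p) * E = G * E := by rw [mul_assoc, sub_mul, one_mul, h2, sub_zero]
        rw [this, hpGi, ← mul_assoc, mul_assoc G E p, h1]
      rw [e]
      calc _ ≤ (nm v (G * (1 - p)) * nm v E) * nm v (Gi * p) :=
            nm_mul_le_of v (nm_mul_le v _ _) le_rfl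
        _ = (nm v (G * (1 - p)) * nm v (Gi * p)) * nm v E := by ring
        _ ≤ _ := mul_le_mul_of_nonneg_right hκ (nm_nonneg _ _)
  have hA6 : ∀ k : ℕ, k ≤ 6 → A ^ k * κ ≤ A ^ 6 * κ := fun k hk =>
    mul_le_mul_of_nonneg_right (pow_le_pow_right₀ hA hk) hκ0
  have hA6n : A ^ 6 * κ ≤ n * (A ^ 6 * κ) := by
    have : 0 ≤ A ^ 6 * κ := by positivity
    nlinarith
  have hacth : ∀ E ∈ Ωs, ∀ Y ∈ U, nm v E ≤ κ * (2 * nm v z) → ∃ E₁ ∈ Ωs, ∃ Y₁ ∈ U,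
      φ h * ((p + E) * Y) = (p + E₁) * Y₁ ∧ nm v (E₁ - z) ≤ nm v z / 4 := by
    rintro E ⟨h1, h2⟩ Y ⟨h5, Y', h6, h7⟩ hE
    have hE0 := nm_nonneg v E
    have hu : nm v (p * x * E * a) ≤ A * A * nm v E * A :=
      nm_mul_le_of v (nm_mul_le_of v (nm_mul_le_of v hpA hxA) le_rfl) haA
    have hu2 : nm v (p * x * E * a) ≤ 1 / 2 := by
      refine hu.trans ?_
      have h8 : nm v E ≤ κ * (4 * A ^ 2) := hE.trans (mul_le_mul_of_nonneg_left (by linarith) hκ0)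
      have h9 := hA6 5 (by norm_num)
      calc A * A * nm v E * A = A ^ 3 * nm v E := by ring
        _ ≤ A ^ 3 * (κ * (4 * A ^ 2)) := by gcongr
        _ = 4 * (A ^ 5 * κ) := by ring
        _ ≤ 1 / 2 := by nlinarith
    have hdet := det_one_add_ne v hu2
    obtain ⟨E₁, b, b', c1, c2, c3, c4, c5, c6, c7, c8, c9, c10⟩ := pp_alg hp ha1 ha2 ha3 ha4 h1 h2
      (Matrix.mul_nonsing_inv _ (isUnit_iff_ne_zero.mpr hdet)) (Matrix.nonsing_inv_mul _ (isUnit_iff_ne_zero.mpr hdet))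
    refine ⟨E₁, ⟨c9, c8⟩, c • (b * Y), ⟨?_, c⁻¹ • (Y' * b'), ?_, ?_⟩, ?_, ?_⟩
    · rw [Matrix.mul_smul, ← mul_assoc, c1]
    · rw [Matrix.smul_mul, Matrix.mul_smul, smul_smul, mul_inv_cancel₀ hc, one_smul]
      calc b * Y * (Y' * b') = b * (Y * Y') * b' := by simp only [mul_assoc]
        _ = p := by rw [h6, c2, c5]
    · rw [Matrix.smul_mul, Matrix.mul_smul, smul_smul, inv_mul_cancel₀ hc, one_smul]
      calc Y' * b' * (b * Y) = Y' * (b' * b * Y) := by simp only [mul_assoc]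
        _ = p := by rw [c6, h5, h7]
    · rw [hx, Matrix.mul_smul, Matrix.smul_mul, ← mul_assoc, ← mul_assoc, c7]
    · rw [hzdef, c10]
      have hW := inv_one_add_le v hu2
      rw [Fintype.card_fin] at hW
      have k1 : nm v (x * E * a - x * a * (p * x * E * a)) ≤ A * nm v E * A + A * A * (A * A * nm v E * A) :=
        (nm_sub_le v _ _).trans (add_le_add (nm_mul_le_of v (nm_mul_le_of v hxA le_rfl) haA)
          (nm_mul_le_of v (nm_mul_le_of v hxA haA) hu))
      have k2 := nm_mul_le_of v (nm_mul_le_of v k1 hW) hpA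
      refine k2.trans ?_
      have k3 : A ^ 2 ≤ A ^ 5 := pow_le_pow_right₀ hA (by norm_num)
      calc _ = 2 * n * A * ((A ^ 2 + A ^ 5) * nm v E) := by ring
        _ ≤ 2 * n * A * ((A ^ 5 + A ^ 5) * (κ * (2 * nm v z))) := by gcongr
        _ = (32 * n * A ^ 6 * κ) * (nm v z / 4) := by ring
        _ ≤ 1 * (nm v z / 4) := by gcongr
        _ = _ := one_mul _
  have hκ4 : κ ≤ 1 / 32 := by
    have := hA6 0 (by norm_num)
    nlinarith
  refine pingpong φ g (h * g) {X | ∃ E ∈ Ωs, ∃ Y ∈ U, nm v E ≤ 2 * nm v z ∧ X = (p + E) * Y} ?_ ?_ ?_ ?_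
  · exact ⟨(p + 0) * p, 0, ⟨by simp, by simp⟩, p, ⟨hp, p, hp, hp⟩, by simp [hNz.le], rfl⟩
  · rintro _ ⟨E, hE, Y, hY, hb, rfl⟩
    obtain ⟨E₁, hE₁, Y₁, hY₁, e, hb₁⟩ := hact E hE Y hY
    refine ⟨E₁, hE₁, Y₁, hY₁, ?_, e⟩
    nlinarith [nm_nonneg v E]
  · rintro _ ⟨E, hE, Y, hY, hb, rfl⟩
    obtain ⟨E₁, hE₁, Y₁, hY₁, e, hb₁⟩ := hact E hE Y hY
    obtain ⟨E₂, hE₂, Y₂, hY₂, e₂, hb₂⟩ := hacth E₁ hE₁ Y₁ hY₁ (hb₁.trans (mul_le_mul_of_nonneg_left hb hκ0))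
    refine ⟨E₂, hE₂, Y₂, hY₂, ?_, ?_⟩
    · have : nm v E₂ ≤ nm v (E₂ - z) + nm v z := by
        have := nm_add_le v (E₂ - z) z
        simpa using this
      linarith
    · rw [map_mul, mul_assoc, ← hG, e, e₂]
  · rintro _ ⟨E, hE, Y, hY, hb, rfl⟩ _ ⟨E', hE', Y', hY', hb', rfl⟩ he
    obtain ⟨E₁, hE₁, Y₁, hY₁, e, hb₁⟩ := hact E hE Y hY
    obtain ⟨F₁, hF₁, Z₁, hZ₁, f, hf₁⟩ := hact E' hE' Y' hY'
    obtain ⟨F₂, hF₂, Z₂, hZ₂, f₂, hf₂⟩ := hacth F₁ hF₁ Z₁ hZ₁ (hf₁.trans (mul_le_mul_of_nonneg_left hb' hκ0))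
    rw [map_mul, mul_assoc, ← hG, e, f, f₂] at he
    have := huniq _ hE₁ _ hF₂ _ hY₁ _ hZ₂ he
    subst this
    have k1 : nm v z ≤ nm v E₁ + nm v (E₁ - z) := by
      have := nm_sub_le v E₁ (E₁ - z)
      simpa using this
    nlinarith [nm_nonneg v E]

/-- version with the determinant criterion -/
theorem pp_det {K : Type*} [Field K] (v : AbsoluteValue K ℝ) {n : ℕ} (hn : 1 ≤ n) {Γ : Type*} [Group Γ]
    (φ : Γ →* Matrix (Fin n) (Fin n) K) (g h : Γ) (p x : Matrix (Fin n) (Fin n) K) (c : K) (hc : c ≠ 0)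
    (hx : φ h = c • x) (hp : p * p = p) (hgp : Commute (φ g) p)
    (A δ κ : ℝ) (hA : n + 1 ≤ A) (hδ : 0 < δ) (hκ0 : 0 ≤ κ) (hκ : nm v (φ g * (1 - p)) * nm v (φ g⁻¹ * p) ≤ κ)
    (hxA : nm v x ≤ A) (hpA : nm v p ≤ A) (hpA' : nm v (1 - p) ≤ A)
    (hdet : δ ≤ v (p * x * p + (1 - p)).det) 
    (hκA : 32 * n * (A ^ 2 * ((n ^ 2 * (A ^ 3 + A + 1) ^ n) / δ) + A) ^ 6 * κ ≤ 1)
    (hz : (1 - p) * x * p ≠ 0) : FreePair g (h * g) := by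
  set D := p * x * p + (1 - p) with hD
  have hn' : (1 : ℝ) ≤ n := by exact_mod_cast hn
  have hA0 : 0 ≤ A := by linarith
  have hd0 : D.det ≠ 0 := by
    intro h0
    rw [h0, map_zero] at hdet
    linarith
  have hU := isUnit_iff_ne_zero.mpr hd0
  have h1 : D * D⁻¹ = 1 := Matrix.mul_nonsing_inv _ hU
  have h2 : D⁻¹ * D = 1 := Matrix.nonsing_inv_mul _ hU
  have hpD : p * D = p * x * p := by
    rw [hD, mul_add, mul_sub, mul_one, hp, sub_self, add_zero, ← mul_assoc, ← mul_assoc, hp]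
  have hDp : D * p = p * x * p := by
    rw [hD, add_mul, sub_mul, one_mul, hp, sub_self, add_zero, mul_assoc, hp]
  have hND : nm v D ≤ A ^ 3 + A := by
    refine (nm_add_le v _ _).trans (add_le_add ?_ hpA')
    calc _ ≤ A * A * A := nm_mul_le_of v (nm_mul_le_of v hpA hxA) hpA
      _ = _ := by ring
  have hNi : nm v D⁻¹ ≤ n ^ 2 * (A ^ 3 + A + 1) ^ n / δ := by
    rw [Matrix.inv_def, nm_smul, Ring.inverse_eq_inv', map_inv₀, div_eq_inv_mul]
    have k1 := adjugate_le v D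
    rw [Fintype.card_fin] at k1
    have k0 := nm_nonneg v D
    have : (nm v D + 1) ^ n ≤ (A ^ 3 + A + 1) ^ n := pow_le_pow_left₀ (by linarith) (by linarith) _
    gcongr
    · exact nm_nonneg _ _
    · refine k1.trans ?_
      gcongr
  have hB0 : 0 ≤ n ^ 2 * (A ^ 3 + A + 1) ^ n / δ := by positivity
  refine pp_main v hn φ g h p x (p * D⁻¹ * p) c hc hx hp hgp ?_ ?_ ?_ ?_
    (A ^ 2 * ((n ^ 2 * (A ^ 3 + A + 1) ^ n) / δ) + A) κ ?_ hκ0 hκ ?_ ?_ ?_ hκA hz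
  · rw [mul_assoc, hp]
  · rw [← mul_assoc, ← mul_assoc, hp]
  · calc p * x * p * (p * D⁻¹ * p) = p * x * (p * p) * D⁻¹ * p := by simp only [mul_assoc]
      _ = p * (D * D⁻¹) * p := by rw [hp, ← hpD]; simp only [mul_assoc]
      _ = p := by rw [h1, mul_one, hp]
  · calc p * D⁻¹ * p * (p * x * p) = p * D⁻¹ * ((p * p) * x * p) := by simp only [mul_assoc]
      _ = p * (D⁻¹ * D) * p := by rw [hp, ← hDp]; simp only [mul_assoc]
      _ = p := by rw [h2, mul_one, hp]
  · nlinarith [mul_nonneg (sq_nonneg A) hB0]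
  · nlinarith [mul_nonneg (sq_nonneg A) hB0]
  · nlinarith [mul_nonneg (sq_nonneg A) hB0]
  · have := nm_mul_le_of v (nm_mul_le_of v hpA hNi) hpA
    nlinarith

end EG

namespace EG

lemma near_tri {K : Type*} [Field K] (v : AbsoluteValue K ℝ) {m : ℕ} (F : Matrix (Fin m) (Fin m) K)
    (δ B τ Q : ℝ) (hδ : 0 < δ) (hB : 0 ≤ B) (hτ : 0 ≤ τ) (hQ : 1 ≤ Q) (h1 : ∀ a, δ ≤ v (F a a)) (h2 : ∀ a b, v (F a b) ≤ B)
    (h3 : ∀ a b, b < a → v (F a b) ≤ τ) (hQB : 4 * m * B ≤ δ * Q) (hQτ : 4 * m * (τ * Q ^ m) ≤ δ) : F.det ≠ 0 := by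
  intro h0
  obtain ⟨x, hx, he⟩ := Matrix.exists_mulVec_eq_zero_iff.mpr h0
  have hne : (Finset.univ : Finset (Fin m)).Nonempty := by
    by_contra hc
    rw [Finset.not_nonempty_iff_eq_empty] at hc
    apply hx
    funext i
    exact absurd (Finset.mem_univ i) (by rw [hc]; simp)
  have hQ0 : 0 < Q := by linarith
  obtain ⟨a, -, ha⟩ := Finset.exists_max_image Finset.univ (fun a : Fin m => v (x a) * Q ^ (a : ℕ)) hne
  have hxa : 0 < v (x a) := by
    obtain ⟨i, hi⟩ := Function.ne_iff.mp hx
    have h4 := ha i (Finset.mem_univ i)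
    have h5 : 0 < v (x i) := v.pos hi
    have h6 : 0 < v (x i) * Q ^ (i : ℕ) := by positivity
    have h7 : 0 < v (x a) * Q ^ (a : ℕ) := h6.trans_le h4
    exact (pos_iff_pos_of_mul_pos h7).mpr (by positivity)
  have hsum : F a a * x a = - ∑ b ∈ Finset.univ.erase a, F a b * x b := by
    have := congrFun he a
    simp only [Matrix.mulVec, dotProduct, Pi.zero_apply] at this
    rw [← Finset.add_sum_erase _ _ (Finset.mem_univ a)] at this
    exact eq_neg_of_add_eq_zero_left this
  have hterm : ∀ b ∈ Finset.univ.erase a, v (F a b * x b) ≤ (B / Q + τ * Q ^ m) * v (x a) := by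
    intro b hb
    have hba : b ≠ a := (Finset.mem_erase.mp hb).1
    have hb' := ha b (Finset.mem_univ b)
    rw [map_mul]
    rcases lt_or_gt_of_ne hba with hlt | hgt
    · have k1 : v (x b) ≤ v (x a) * Q ^ m := by
        calc v (x b) ≤ v (x b) * Q ^ (b : ℕ) := le_mul_of_one_le_right (v.nonneg _) (one_le_pow₀ hQ)
          _ ≤ v (x a) * Q ^ (a : ℕ) := hb'
          _ ≤ _ := mul_le_mul_of_nonneg_left (pow_le_pow_right₀ hQ a.2.le) hxa.le
      calc v (F a b) * v (x b) ≤ τ * (v (x a) * Q ^ m) := mul_le_mul (h3 a b hlt) k1 (v.nonneg _) hτ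
        _ ≤ _ := by
          have : 0 ≤ B / Q * v (x a) := by positivity
          nlinarith
    · have k1 : v (x b) ≤ v (x a) / Q := by
        rw [le_div_iff₀ hQ0]
        have k2 : Q ^ ((a : ℕ) + 1) ≤ Q ^ (b : ℕ) := pow_le_pow_right₀ hQ hgt
        have k3 : v (x b) * Q ^ ((a : ℕ) + 1) ≤ v (x a) * Q ^ (a : ℕ) :=
          (mul_le_mul_of_nonneg_left k2 (v.nonneg _)).trans hb'
        rw [pow_succ'] at k3
        have k4 : 0 < Q ^ (a : ℕ) := by positivity
        rw [← mul_assoc] at k3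
        exact le_of_mul_le_mul_right k3 k4
      calc v (F a b) * v (x b) ≤ B * (v (x a) / Q) := mul_le_mul (h2 a b) k1 (v.nonneg _) hB
        _ ≤ _ := by
          have : 0 ≤ τ * Q ^ m * v (x a) := by positivity
          have e : B * (v (x a) / Q) = B / Q * v (x a) := by ring
          rw [e]; nlinarith
  have hfin : v (F a a * x a) ≤ m * ((B / Q + τ * Q ^ m) * v (x a)) := by
    rw [hsum, v.map_neg]
    refine (v.sum_le _ _).trans ((Finset.sum_le_card_nsmul _ _ _ hterm).trans ?_)
    rw [nsmul_eq_mul]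
    apply mul_le_mul_of_nonneg_right
    · have : (Finset.univ.erase a).card ≤ m := by
        have := Finset.card_le_card (Finset.erase_subset a Finset.univ)
        simpa using this
      exact_mod_cast this
    · positivity
  rw [map_mul] at hfin
  have h8 : δ * v (x a) ≤ (m * (B / Q + τ * Q ^ m)) * v (x a) := by
    calc _ ≤ v (F a a) * v (x a) := mul_le_mul_of_nonneg_right (h1 a) hxa.le
      _ ≤ _ := hfin
      _ = _ := by ring
  have h9 := le_of_mul_le_mul_right h8 hxa
  have h10 : m * (B / Q) ≤ δ / 4 := by
    rw [← mul_div_assoc, div_le_iff₀ hQ0]; linarith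
  nlinarith

/-- the determinant of the corner `p x p` -/
def cdet {K : Type*} [Field K] {n : ℕ} (p x : Matrix (Fin n) (Fin n) K) : K := (p * x * p + (1 - p)).det

lemma cdet_factor {K : Type*} [Field K] {n : ℕ} (p : Matrix (Fin n) (Fin n) K) (hp : p * p = p) :
    ∃ U W : Matrix (Fin n) (Fin n) K → (Fin n → Fin n ⊕ Fin n) → K,
      ∀ y x, cdet p (y * x) = ∑ s, W x s * U y s := by
  refine ⟨fun y s => ∏ i, (fromCols (p * y) (1 - p)) i (s i), fun x s => Matrix.det (fun i => (fromRows (x * p) (1 - p)) (s i)), ?_⟩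
  intro y x
  have e : p * (y * x) * p + (1 - p) = fromCols (p * y) (1 - p) * fromRows (x * p) (1 - p) := by
    rw [fromCols_mul_fromRows, mul_sub, sub_mul, sub_mul, hp, one_mul, one_mul, mul_one, sub_self, sub_zero]
    simp only [mul_assoc]
  rw [cdet, e]
  set A := fromCols (p * y) (1 - p)
  set B := fromRows (x * p) (1 - p)
  have e2 : A * B = fun i => ∑ j, A i j • B j := by
    ext i k
    simp [Matrix.mul_apply, Finset.sum_apply]
  rw [e2]
  change Matrix.detRowAlternating (fun i => ∑ j, A i j • B j) = _
  have e3 := (Matrix.detRowAlternating (n := Fin n) (R := K)).toMultilinearMap.map_sum (fun i (j : Fin n ⊕ Fin n) => A i j • B j)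
  simp only [AlternatingMap.coe_multilinearMap] at e3
  rw [e3]
  refine Finset.sum_congr rfl fun s _ => ?_
  have e4 := (Matrix.detRowAlternating (n := Fin n) (R := K)).toMultilinearMap.map_smul_univ (fun i => A i (s i)) (fun i => B (s i))
  simp only [AlternatingMap.coe_multilinearMap] at e4
  rw [e4, smul_eq_mul, mul_comm]
  rfl

lemma cdet_sing {K : Type*} [Field K] {n m : ℕ} (p : Matrix (Fin n) (Fin n) K) (hp : p * p = p)
    (hm : (2 * n) ^ n < m) (x y : Fin m → Matrix (Fin n) (Fin n) K) :
    (Matrix.of fun a b => cdet p (y b * x a)).det = 0 := by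
  obtain ⟨U, W, hUW⟩ := cdet_factor p hp
  by_contra hne
  have e : (Matrix.of fun a b => cdet p (y b * x a)) =
      (Matrix.of fun a s => W (x a) s) * (Matrix.of fun s b => U (y b) s) := by
    ext a b
    simp [Matrix.mul_apply, hUW]
  have h1 := Matrix.rank_of_isUnit _ ((Matrix.isUnit_iff_isUnit_det _).mpr (isUnit_iff_ne_zero.mpr hne))
  rw [e] at h1
  have h2 := (Matrix.rank_mul_le_left (Matrix.of fun a s => W (x a) s) (Matrix.of fun s b => U (y b) s)).trans
    (Matrix.rank_le_card_width _)
  rw [h1] at h2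
  simp at h2
  have : n + n = 2 * n := by ring
  rw [this] at h2
  omega

lemma cdet_inv {K : Type*} [Field K] {n : ℕ} (p x x' : Matrix (Fin n) (Fin n) K) (hp : p * p = p)
    (hx' : x' * x = 1) (h : (1 - p) * x * p = 0) : (1 - p) * x' * p = 0 ∧ cdet p x' * cdet p x = 1 := by
  have hxp : x * p = p * x * p := by
    rw [sub_mul, sub_mul, one_mul, sub_eq_zero] at h
    exact h
  set D := p * x * p + (1 - p) with hD
  have hpD : p * D = p * x * p := by
    rw [hD, mul_add, mul_sub, mul_one, hp, sub_self, add_zero, ← mul_assoc, ← mul_assoc, hp]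
  have hDp : D * p = p * x * p := by
    rw [hD, add_mul, sub_mul, one_mul, hp, sub_self, add_zero, mul_assoc, hp]
  have hDq : (1 - p) * D = 1 - p := by
    rw [sub_mul, one_mul, hpD, hD]; abel
  have key : (x' * p + (1 - p)) * D = 1 := by
    rw [add_mul, hDq, mul_assoc, hpD, ← hxp, ← mul_assoc, hx', one_mul]; abel
  have hdet : D.det ≠ 0 := by
    intro h0
    have := congrArg Matrix.det key
    rw [Matrix.det_mul, h0, mul_zero, Matrix.det_one] at this
    exact zero_ne_one this
  have hU := isUnit_iff_ne_zero.mpr hdet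
  have h1 : D * D⁻¹ = 1 := Matrix.mul_nonsing_inv _ hU
  have hDi : x' * p + (1 - p) = D⁻¹ := by
    calc x' * p + (1 - p) = (x' * p + (1 - p)) * (D * D⁻¹) := by rw [h1, mul_one]
      _ = _ := by rw [← mul_assoc, key, one_mul]
  have h2 : D⁻¹ * D = 1 := Matrix.nonsing_inv_mul _ hU
  have hcomm : p * D⁻¹ = D⁻¹ * p := by
    calc p * D⁻¹ = D⁻¹ * D * p * D⁻¹ := by rw [h2, one_mul]
      _ = D⁻¹ * (p * D) * D⁻¹ := by rw [mul_assoc D⁻¹ D p, hDp, ← hpD]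
      _ = D⁻¹ * p * (D * D⁻¹) := by simp only [mul_assoc]
      _ = _ := by rw [h1, mul_one]
  have hx'p : x' * p = D⁻¹ * p := by
    rw [← hDi, add_mul, sub_mul, one_mul, hp, sub_self, add_zero, mul_assoc, hp]
  have hz : (1 - p) * x' * p = 0 := by
    rw [mul_assoc, hx'p, ← hcomm, ← mul_assoc, sub_mul, one_mul, hp, sub_self, zero_mul]
  refine ⟨hz, ?_⟩
  have hx'p2 : p * x' * p = x' * p := by
    rw [sub_mul, sub_mul, one_mul, sub_eq_zero] at hz
    exact hz.symm
  rw [cdet, cdet, hx'p2, ← Matrix.det_mul, ← hD, key, Matrix.det_one]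

lemma cdet_le {K : Type*} [Field K] (v : AbsoluteValue K ℝ) {n : ℕ} (p x : Matrix (Fin n) (Fin n) K) {B b : ℝ} 
    (hB : 1 ≤ B) (hb : 1 ≤ b) (hp : nm v p ≤ B) (hp' : nm v (1 - p) ≤ B) (hx : nm v x ≤ b) :
    v (cdet p x) ≤ (2 * (B ^ 2 * b)) ^ n := by
  have h1 := det_le v (p * x * p + (1 - p))
  rw [Fintype.card_fin] at h1
  refine h1.trans (pow_le_pow_left₀ (nm_nonneg _ _) ?_ _)
  have h2 := (nm_add_le v (p * x * p) (1 - p)).trans (add_le_add (nm_mul_le_of v (nm_mul_le_of v hp hx) hp) hp')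
  refine h2.trans ?_
  have : B ≤ B ^ 2 * b := by
    have : 1 ≤ B * b := one_le_mul_of_one_le_of_one_le hB hb
    nlinarith
  nlinarith

/-- stabiliser of the image of `p` -/
def stab {K : Type*} [Field K] {n : ℕ} {Γ : Type*} [Group Γ] (φ : Γ →* Matrix (Fin n) (Fin n) K)
    (p : Matrix (Fin n) (Fin n) K) (hp : p * p = p) : Subgroup Γ where
  carrier := {γ | (1 - p) * φ γ * p = 0}
  one_mem' := by simp [sub_mul, hp]
  mul_mem' := by
    intro a b ha hb
    simp only [Set.mem_ofPred_eq] at *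
    have e : φ b * p = p * φ b * p := by
      rw [sub_mul, sub_mul, one_mul, sub_eq_zero] at hb
      exact hb
    rw [map_mul, mul_assoc, mul_assoc, e, ← mul_assoc, ← mul_assoc, ← mul_assoc, ha, zero_mul, zero_mul]
  inv_mem' := by
    intro a ha
    exact (cdet_inv p (φ a) (φ a⁻¹) hp (by rw [← map_mul, inv_mul_cancel, map_one]) ha).1

theorem orbit {K : Type*} [Field K] (v : AbsoluteValue K ℝ) {n : ℕ} (hn : 1 ≤ n) {Γ : Type*} [Group Γ]
    (S : Set Γ) (h1S : (1 : Γ) ∈ S) (hS : Subgroup.closure S = ⊤)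
    (φ : Γ →* Matrix (Fin n) (Fin n) K) (p : Matrix (Fin n) (Fin n) K) (hp : p * p = p)
    (D e : ℕ) (hD : D = (2 * n) ^ n) (he : e = D.factorial) (B δ β : ℝ) (hB1 : 1 ≤ B) (hBn : n ≤ B) (hδ : 0 ≤ δ)
    (hβ : β = (2 * (B ^ 2 * B ^ (2 * e))) ^ n)
    (hδβ : 4 * (D + 1) * (δ * (4 * (D + 1) * β ^ 2) ^ (D + 1)) ≤ β⁻¹)
    (hpB : nm v p ≤ B) (hpB' : nm v (1 - p) ≤ B)
    (hfix : ∀ h ∈ S ^ (D * e), ∀ (c : K) x, c ≠ 0 → φ h = c • x → nm v x ≤ B ^ e → δ ≤ v (cdet p x) → (1 - p) * x * p = 0)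
    (hnorm : ∀ h ∈ S ^ D, ∃ (c : K) (x x' : Matrix (Fin n) (Fin n) K), c ≠ 0 ∧ φ h = c • x ∧ x * x' = 1 ∧ nm v x ≤ B ∧ nm v x' ≤ B) :
    (stab φ p hp).index ≠ 0 ∧ (stab φ p hp).index ≤ D := by
  have hD1 : 1 ≤ D := by rw [hD]; exact Nat.one_le_pow _ _ (by omega)
  have heD : D ≤ e := by rw [he]; exact Nat.self_le_factorial D
  have he1 : 1 ≤ e := hD1.trans heD
  have hB0 : 0 ≤ B := by linarith
  have hβ1 : 1 ≤ β := by
    rw [hβ]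
    apply one_le_pow₀
    have := one_le_mul_of_one_le_of_one_le (one_le_pow₀ hB1 : 1 ≤ B ^ 2) (one_le_pow₀ hB1 : 1 ≤ B ^ (2 * e))
    linarith
  have hβ0 : 0 < β := by linarith
  have hβi : β⁻¹ ≤ 1 := inv_le_one_of_one_le₀ hβ1
  have hfle : ∀ x, nm v x ≤ B ^ (2 * e) → v (cdet p x) ≤ β := by
    intro x hx
    rw [hβ]
    exact cdet_le v p x hB1 (one_le_pow₀ hB1) hpB hpB' hx
  have hpw : ∀ (x : Matrix (Fin n) (Fin n) K) (i : ℕ), nm v x ≤ B → i ≤ e → nm v (x ^ i) ≤ B ^ e := by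
    intro x i hx hi
    rcases Nat.eq_zero_or_pos i with rfl | hi0
    · rw [pow_zero, nm_one, Fintype.card_fin]
      exact hBn.trans (le_self_pow₀ hB1 (by omega))
    · exact (nm_pow_le' v x i (by omega)).trans
        ((pow_le_pow_left₀ (nm_nonneg _ _) hx _).trans (pow_le_pow_right₀ hB1 hi))
  -- the matrix lemma
  have hmat : ∀ F : Matrix (Fin (D + 1)) (Fin (D + 1)) K, (∀ a, β⁻¹ ≤ v (F a a)) → (∀ a b, v (F a b) ≤ β) →
      (∀ a b, b < a → v (F a b) ≤ δ) → F.det ≠ 0 := by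
    intro F k1 k2 k3
    refine near_tri v F β⁻¹ β δ (4 * (D + 1) * β ^ 2) (by positivity) hβ0.le hδ ?_ k1 k2 k3 ?_ ?_
    · have : (1 : ℝ) ≤ β ^ 2 := one_le_pow₀ hβ1
      have : (1 : ℝ) ≤ D := by exact_mod_cast hD1
      nlinarith
    · push_cast
      apply le_of_eq
      field_simp
    · push_cast
      exact hδβ
  have hscal : ∀ (γ : Γ) (c : K) x, c ≠ 0 → φ γ = c • x → ((1 - p) * x * p = 0 ↔ γ ∈ stab φ p hp) := by
    intro γ c x hc h
    change _ ↔ (1 - p) * φ γ * p = 0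
    rw [h, Matrix.mul_smul, Matrix.smul_mul, smul_eq_zero]
    simp [hc]
  -- each power
  have step2 : ∀ h ∈ S ^ D, h ^ e ∈ stab φ p hp := by
    intro h hh
    obtain ⟨c, x, x', hc, hx, hxx', hxB, hxB'⟩ := hnorm h hh
    have hx'x : x' * x = 1 := mul_eq_one_comm.mp hxx'
    have hcx : ∀ i : ℕ, φ (h ^ i) = c ^ i • x ^ i := fun i => by rw [map_pow, hx, smul_pow]
    by_contra hcon
    have hall : ∀ i : ℕ, 1 ≤ i → i ≤ D → v (cdet p (x ^ i)) ≤ δ := by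
      intro i hi1 hiD
      by_contra hlt
      push Not at hlt
      have hmem : h ^ i ∈ S ^ (D * e) := by
        refine pow_mono_set h1S (Nat.mul_le_mul_left D (hiD.trans heD)) ?_
        rw [pow_mul]
        exact Set.pow_mem_pow hh
      have h0 := hfix (h ^ i) hmem (c ^ i) (x ^ i) (pow_ne_zero _ hc) (hcx i) (hpw x i hxB (hiD.trans heD)) hlt.le
      rw [hscal (h ^ i) (c ^ i) (x ^ i) (pow_ne_zero _ hc) (hcx i)] at h0
      apply hcon
      have hdvd : i ∣ e := by rw [he]; exact Nat.dvd_factorial hi1 hiD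
      obtain ⟨j, hj⟩ := hdvd
      rw [hj, pow_mul]
      exact pow_mem h0 j
    have hpp : ∀ i : ℕ, x' ^ i * x ^ i = 1 := fun i => by
      have hc : Commute x' x := by rw [Commute, SemiconjBy, hx'x, hxx']
      rw [← hc.mul_pow, hx'x, one_pow]
    refine hmat (Matrix.of fun a b => cdet p (x' ^ (b : ℕ) * x ^ (a : ℕ))) ?_ ?_ ?_
      (cdet_sing p hp (by omega) (fun a : Fin (D + 1) => x ^ (a : ℕ)) (fun a : Fin (D + 1) => x' ^ (a : ℕ)))
    · intro a
      rw [Matrix.of_apply, hpp, cdet, mul_one, hp, add_sub_cancel, Matrix.det_one, map_one]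
      exact hβi
    · intro a b
      rw [Matrix.of_apply]
      apply hfle
      rw [two_mul, pow_add]
      exact nm_mul_le_of v (hpw _ _ hxB' (by omega)) (hpw _ _ hxB (by omega))
    · intro a b hab
      have hab' : (b : ℕ) < a := hab
      rw [Matrix.of_apply]
      have : x' ^ (b : ℕ) * x ^ (a : ℕ) = x ^ ((a : ℕ) - b) := by
        conv_lhs => rw [show (a : ℕ) = b + (a - b) by omega, pow_add, ← mul_assoc, hpp, one_mul]
      rw [this]
      exact hall _ (by omega) (by omega)
  -- cosets
  apply index_le_of_collision S h1S hS
  intro f hf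
  choose c x x' hc hx hxx' hxB hxB' using fun i => hnorm (f i) (hf i)
  by_contra hcon
  push Not at hcon
  have hel : ∀ a b, φ (f b ^ (e - 1) * f a) = (c b ^ (e - 1) * c a) • (x b ^ (e - 1) * x a) := by
    intro a b
    rw [map_mul, map_pow, hx, hx, smul_pow, Matrix.smul_mul, Matrix.mul_smul, smul_smul]
  have hnmle : ∀ a b, nm v (x b ^ (e - 1) * x a) ≤ B ^ e := by
    intro a b
    rcases Nat.eq_zero_or_pos (e - 1) with h0 | h0
    · rw [h0, pow_zero, one_mul]
      exact (hxB a).trans (le_self_pow₀ hB1 (by omega))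
    · have := nm_mul_le_of v ((nm_pow_le' v (x b) (e - 1) (by omega)).trans
        (pow_le_pow_left₀ (nm_nonneg _ _) (hxB b) _)) (hxB a)
      rwa [← pow_succ, show e - 1 + 1 = e by omega] at this
  have hBe : B ^ e ≤ B ^ (2 * e) := pow_le_pow_right₀ hB1 (by omega)
  refine hmat (Matrix.of fun a b => cdet p (x b ^ (e - 1) * x a)) ?_ ?_ ?_
      (cdet_sing p hp (by omega) x (fun b => x b ^ (e - 1)))
  · intro a
    rw [Matrix.of_apply, ← pow_succ, show e - 1 + 1 = e by omega]
    have hx'x : x' a * x a = 1 := mul_eq_one_comm.mp (hxx' a)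
    have hcm : Commute (x' a) (x a) := by rw [Commute, SemiconjBy, hx'x, hxx']
    have h0 := step2 (f a) (hf a)
    rw [← hscal (f a ^ e) (c a ^ e) (x a ^ e) (pow_ne_zero _ (hc a)) (by rw [map_pow, hx, smul_pow])] at h0
    have h2 := (cdet_inv p (x a ^ e) (x' a ^ e) hp (by rw [← hcm.mul_pow, hx'x, one_pow]) h0).2
    have h3 : v (cdet p (x' a ^ e)) * v (cdet p (x a ^ e)) = 1 := by rw [← map_mul, h2, map_one]
    have h4 := hfle _ ((hpw _ e (hxB' a) le_rfl).trans hBe)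
    rw [inv_le_iff_one_le_mul₀ hβ0]
    rw [← h3, mul_comm]
    exact mul_le_mul_of_nonneg_left h4 (v.nonneg _)
  · intro a b
    rw [Matrix.of_apply]
    exact hfle _ ((hnmle a b).trans hBe)
  · intro a b hab
    rw [Matrix.of_apply]
    by_contra hlt
    push Not at hlt
    have hc0 : c b ^ (e - 1) * c a ≠ 0 := mul_ne_zero (pow_ne_zero _ (hc b)) (hc a)
    have hmem : f b ^ (e - 1) * f a ∈ S ^ (D * e) := by
      rw [show D * e = D * (e - 1) + D by
        conv_lhs => rw [show e = (e - 1) + 1 by omega, mul_add, mul_one], pow_add, pow_mul]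
      exact Set.mul_mem_mul (Set.pow_mem_pow (hf b)) (hf a)
    have h0 := hfix _ hmem _ _ hc0 (hel a b) (hnmle a b) hlt.le
    rw [hscal _ _ _ hc0 (hel a b)] at h0
    refine hcon b a hab.ne ?_
    have h2 := mul_mem (inv_mem (step2 (f b) (hf b))) h0
    convert h2 using 1
    have : f b ^ e = f b ^ (e - 1) * f b := by rw [← pow_succ, show e - 1 + 1 = e by omega]
    rw [← mul_assoc, this]
    have hcomm : f b ^ (e - 1) * f b = f b * f b ^ (e - 1) := (Commute.pow_self (f b) _).eq
    rw [hcomm, _root_.mul_inv_rev, mul_assoc (f b ^ (e - 1))⁻¹]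
    have : (f b ^ (e - 1))⁻¹ * ((f b)⁻¹ * f b ^ (e - 1)) = (f b)⁻¹ := by
      have h3 : Commute ((f b)⁻¹) (f b ^ (e - 1)) := (Commute.inv_left (Commute.self_pow (f b) _))
      rw [h3.eq, ← mul_assoc, inv_mul_cancel, one_mul]
    rw [this]

end EG

namespace EG

theorem half (n cB : ℕ) (hn : 1 ≤ n) (hcB : 1 ≤ cB) (D e : ℕ) (hD : D = (2 * n) ^ n) (he : e = D.factorial) :
    ∃ (q : ℕ) (Θ₁ : ℝ), 1 ≤ Θ₁ ∧ ∀ (K : Type) [Field K] (v : AbsoluteValue K ℝ) (Θ : ℝ), Θ₁ ≤ Θ →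
    ∀ (Γ : Type) [Group Γ] (S : Set Γ), (1 : Γ) ∈ S → Subgroup.closure S = ⊤ →
    ∀ (φ : Γ →* Matrix (Fin n) (Fin n) K) (p : Matrix (Fin n) (Fin n) K) (hp : p * p = p),
    nm v p ≤ Θ ^ cB → nm v (1 - p) ≤ Θ ^ cB → ∀ (N' : ℕ) (a : Γ), a ∈ S ^ N' → Commute (φ a) p →
    nm v (φ a * (1 - p)) * nm v (φ a⁻¹ * p) ≤ (Θ ^ q)⁻¹ → NoFree S (D * e + N') →
    (∀ h ∈ S ^ D, ∃ (c : K) (x x' : Matrix (Fin n) (Fin n) K), c ≠ 0 ∧ φ h = c • x ∧ x * x' = 1 ∧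
      nm v x ≤ Θ ^ cB ∧ nm v x' ≤ Θ ^ cB) →
    (stab φ p hp).index ≠ 0 ∧ (stab φ p hp).index ≤ D := by
  obtain ⟨c1, hc1⟩ : ∃ c1, c1 = (1 + (cB * 2 + cB * (2 * e))) * n := ⟨_, rfl⟩
  obtain ⟨c2, hc2⟩ : ∃ c2, c2 = 1 + (1 + c1 * 2) * (D + 1) + c1 := ⟨_, rfl⟩
  obtain ⟨cA, hcA⟩ : ∃ cA, cA = cB * e := ⟨_, rfl⟩
  obtain ⟨c3, hc3⟩ : ∃ c3, c3 = 2 * cA + 2 + (3 * cA + 1) * n + c2 := ⟨_, rfl⟩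
  refine ⟨1 + 6 * c3, 4 * (D + 1) + 32 * n + n ^ 2 + 3, by nlinarith [(Nat.cast_nonneg D : (0:ℝ) ≤ D), (Nat.cast_nonneg n : (0:ℝ) ≤ n)], ?_⟩
  intro K _ v Θ hΘ Γ _ S h1S hS φ p hp hpB hpB' N' a ha hap hcon hNF hnorm
  have hD0 : (0 : ℝ) ≤ D := Nat.cast_nonneg D
  have hn1 : (1 : ℝ) ≤ n := by exact_mod_cast hn
  have hΘ1 : 1 ≤ Θ := by nlinarith
  have hΘ3 : 3 ≤ Θ := by nlinarith
  have hΘ0 : 0 < Θ := by linarith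
  have hΘD : 4 * ((D : ℝ) + 1) ≤ Θ := by nlinarith
  have hΘn : 32 * (n : ℝ) ≤ Θ := by nlinarith
  have hΘn2 : (n : ℝ) ^ 2 ≤ Θ := by nlinarith
  have he1 : 1 ≤ e := by rw [he]; exact Nat.factorial_pos D
  have hmono : ∀ a b : ℕ, a ≤ b → Θ ^ a ≤ Θ ^ b := fun a b h => pow_le_pow_right₀ hΘ1 h
  have hone : ∀ a : ℕ, 1 ≤ Θ ^ a := fun a => one_le_pow₀ hΘ1
  have hself : ∀ a : ℕ, 1 ≤ a → Θ ≤ Θ ^ a := fun a h => le_self_pow₀ hΘ1 (by omega)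
  have hcA1 : 1 ≤ cA := by rw [hcA]; exact one_le_mul_of_one_le_of_one_le hcB he1
  have hcAB : cB ≤ cA := by rw [hcA]; exact Nat.le_mul_of_pos_right _ he1
  set β := (2 * ((Θ ^ cB) ^ 2 * (Θ ^ cB) ^ (2 * e))) ^ n with hβ
  have hβ0 : 0 < β := by positivity
  have hβle : β ≤ Θ ^ c1 := by
    rw [hβ, hc1, pow_mul Θ _ n]
    apply pow_le_pow_left₀ (by positivity)
    rw [← pow_mul, ← pow_mul, ← pow_add, pow_add Θ 1, pow_one]
    gcongr
    linarith
  have hδ0 : 0 < (Θ ^ c2)⁻¹ := by positivity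
  refine orbit v hn S h1S hS φ p hp D e hD he (Θ ^ cB) (Θ ^ c2)⁻¹ β (hone _) ?_ hδ0.le hβ ?_ hpB hpB' ?_ hnorm
  · have := hself cB hcB
    linarith
  · have k1 : 4 * ((D : ℝ) + 1) * β ^ 2 ≤ Θ ^ (1 + c1 * 2) := by
      rw [pow_add, pow_one, pow_mul]
      gcongr
    have k2 : β⁻¹ ≥ (Θ ^ c1)⁻¹ := inv_anti₀ hβ0 hβle
    calc 4 * ((D : ℝ) + 1) * ((Θ ^ c2)⁻¹ * (4 * (D + 1) * β ^ 2) ^ (D + 1))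
        ≤ Θ * ((Θ ^ c2)⁻¹ * (Θ ^ (1 + c1 * 2)) ^ (D + 1)) := by gcongr
      _ = (Θ ^ c1)⁻¹ := by
        rw [hc2, ← pow_mul, pow_add Θ _ c1, pow_add Θ 1, pow_one]
        field_simp
      _ ≤ _ := k2
  · intro h hh c x hc hx hxB hdet
    by_contra hz
    refine hNF a ?_ (h * a) ?_ (pp_det v hn φ a h p x c hc hx hp hap (Θ ^ cA) (Θ ^ c2)⁻¹ ((Θ ^ (1 + 6 * c3))⁻¹) ?_ hδ0
      (by positivity) hcon ?_ (hpB.trans (hmono _ _ hcAB)) (hpB'.trans (hmono _ _ hcAB)) hdet ?_ hz)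
    · exact pow_mono_set h1S (by omega) ha
    · rw [pow_add]; exact Set.mul_mem_mul hh ha
    · have := hself cA hcA1
      linarith
    · rw [hcA, pow_mul]; exact hxB
    · set A := Θ ^ cA with hA
      have hA1 : 1 ≤ A := hone _
      have k1 : A ^ 3 + A + 1 ≤ Θ ^ (3 * cA + 1) := by
        have e1 : Θ ^ (3 * cA + 1) = A ^ 3 * Θ := by rw [hA]; ring
        have e2 : A ≤ A ^ 3 := le_self_pow₀ hA1 (by norm_num)
        rw [e1]
        nlinarith
      have k2 : (n : ℝ) ^ 2 * (A ^ 3 + A + 1) ^ n / (Θ ^ c2)⁻¹ ≤ Θ ^ (1 + (3 * cA + 1) * n + c2) := by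
        rw [div_inv_eq_mul, pow_add, pow_add, pow_one, pow_mul Θ (3 * cA + 1)]
        gcongr
      have k3 : A ^ 2 * ((n : ℝ) ^ 2 * (A ^ 3 + A + 1) ^ n / (Θ ^ c2)⁻¹) + A ≤ Θ ^ c3 := by
        have e1 : A ^ 2 * ((n : ℝ) ^ 2 * (A ^ 3 + A + 1) ^ n / (Θ ^ c2)⁻¹) ≤ Θ ^ (2 * cA + 1 + (3 * cA + 1) * n + c2) := by
          calc _ ≤ A ^ 2 * Θ ^ (1 + (3 * cA + 1) * n + c2) := by gcongr
            _ = _ := by rw [hA]; ring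
        have e2 : A ≤ Θ ^ (2 * cA + 1 + (3 * cA + 1) * n + c2) := hmono _ _ (by omega)
        have e3 : Θ ^ c3 = Θ ^ (2 * cA + 1 + (3 * cA + 1) * n + c2) * Θ := by
          rw [hc3, ← pow_succ]; congr 1; ring
        rw [e3]
        nlinarith [hone (2 * cA + 1 + (3 * cA + 1) * n + c2)]
      calc 32 * (n : ℝ) * (A ^ 2 * ((n : ℝ) ^ 2 * (A ^ 3 + A + 1) ^ n / (Θ ^ c2)⁻¹) + A) ^ 6 * (Θ ^ (1 + 6 * c3))⁻¹
          ≤ Θ * (Θ ^ c3) ^ 6 * (Θ ^ (1 + 6 * c3))⁻¹ := by gcongr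
        _ = 1 := by
          rw [pow_add, pow_one, mul_comm 6 c3, pow_mul]
          field_simp

/-- contragredient -/
def dual {K : Type*} [Field K] {n : ℕ} {Γ : Type*} [Group Γ] (φ : Γ →* Matrix (Fin n) (Fin n) K) :
    Γ →* Matrix (Fin n) (Fin n) K where
  toFun γ := (φ γ⁻¹)ᵀ
  map_one' := by simp
  map_mul' a b := by rw [_root_.mul_inv_rev, map_mul, Matrix.transpose_mul]

lemma mem_list_of_pow {Γ : Type*} [Group Γ] {S : Set Γ} {k : ℕ} {h : Γ} (hh : h ∈ S ^ k) :
    ∃ L : List S, L.length = k ∧ (L.map (fun s : S => (s : Γ))).prod = h := by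
  induction k generalizing h with
  | zero => 
    rw [pow_zero, Set.mem_one] at hh
    exact ⟨[], rfl, by simp [hh]⟩
  | succ k ih =>
    rw [pow_succ', Set.mem_mul] at hh
    obtain ⟨s, hs, t, ht, rfl⟩ := hh
    obtain ⟨L, hL, hp⟩ := ih ht
    exact ⟨⟨s, hs⟩ :: L, by simp [hL], by rw [List.map_cons, List.prod_cons, hp]⟩

lemma list_mem_pow {Γ : Type*} [Group Γ] {S : Set Γ} (L : List S) :
    (L.map (fun s : S => (s : Γ))).prod ∈ S ^ L.length := by
  induction L with
  | nil => simp
  | cons s L ih =>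
    rw [List.map_cons, List.prod_cons, List.length_cons, pow_succ']
    exact Set.mul_mem_mul s.2 ih

lemma inv_le_pow {K : Type*} [Field K] (v : AbsoluteValue K ℝ) {n : ℕ} {A : Matrix (Fin n) (Fin n) K} (h : A.det = 1)
    {Θ : ℝ} (h2 : 2 ≤ Θ) (hn : (n : ℝ) ^ 2 ≤ Θ) {a : ℕ} (hA : nm v A ≤ Θ ^ a) : nm v A⁻¹ ≤ Θ ^ ((a + 1) * n + 1) := by
  refine (inv_le v h).trans ?_
  rw [Fintype.card_fin, pow_succ Θ, mul_comm, pow_mul Θ]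
  have h1 : 1 ≤ Θ ^ a := one_le_pow₀ (by linarith)
  have h0 := nm_nonneg v A
  have : nm v A + 1 ≤ Θ ^ (a + 1) := by rw [pow_succ]; nlinarith
  gcongr

lemma word_scal {K : Type*} [Field K] {n : ℕ} {Γ : Type*} [Group Γ] (ψ : Γ →* Matrix (Fin n) (Fin n) K) {S : Set Γ}
    (c : S → K) (hc : ∀ s, c s ≠ 0) (y : S → Matrix (Fin n) (Fin n) K) (h : ∀ s : S, y s = c s • ψ s) (L : List S) :
    ∃ d : K, d ≠ 0 ∧ ψ (L.map (fun s : S => (s : Γ))).prod = d • (L.map y).prod := by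
  induction L with
  | nil => exact ⟨1, one_ne_zero, by simp⟩
  | cons s L ih =>
    obtain ⟨d, hd, e⟩ := ih
    refine ⟨(c s)⁻¹ * d, mul_ne_zero (inv_ne_zero (hc s)) hd, ?_⟩
    rw [List.map_cons, List.prod_cons, map_mul, e, List.map_cons, List.prod_cons, h, Matrix.smul_mul, smul_smul,
      Matrix.mul_smul, mul_right_comm, inv_mul_cancel₀ (hc s), one_mul]

/-- conjugated representation -/
noncomputable def conjRep {K : Type*} [Field K] {n : ℕ} {Γ : Type*} [Group Γ] (φ : Γ →* Matrix (Fin n) (Fin n) K)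
    (b : Matrix (Fin n) (Fin n) K) (hb : b.det ≠ 0) : Γ →* Matrix (Fin n) (Fin n) K where
  toFun γ := b * φ γ * b⁻¹
  map_one' := by rw [map_one, mul_one, Matrix.mul_nonsing_inv _ (isUnit_iff_ne_zero.mpr hb)]
  map_mul' x y := by
    have h : b⁻¹ * b = 1 := Matrix.nonsing_inv_mul _ (isUnit_iff_ne_zero.mpr hb)
    rw [map_mul]
    calc b * (φ x * φ y) * b⁻¹ = b * φ x * 1 * φ y * b⁻¹ := by simp only [mul_assoc, one_mul]
      _ = _ := by rw [← h]; simp only [mul_assoc]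

lemma det_rep_ne {K : Type*} [Field K] {n : ℕ} {Γ : Type*} [Group Γ] (φ : Γ →* Matrix (Fin n) (Fin n) K) (γ : Γ) :
    (φ γ).det ≠ 0 := by
  intro h0
  have : (φ γ * φ γ⁻¹).det = 1 := by rw [← map_mul, mul_inv_cancel, map_one, Matrix.det_one]
  rw [Matrix.det_mul, h0, zero_mul] at this
  exact zero_ne_one this

lemma exists_det_one {K : Type*} [Field K] [IsAlgClosed K] {n : ℕ} (hn : 1 ≤ n) (A : Matrix (Fin n) (Fin n) K)
    (hA : A.det ≠ 0) : ∃ c : K, c ≠ 0 ∧ (c • A).det = 1 := by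
  obtain ⟨c, hc⟩ := IsAlgClosed.exists_pow_nat_eq (A.det)⁻¹ (show 0 < n by omega)
  refine ⟨c, ?_, ?_⟩
  · rintro rfl
    rw [zero_pow (by omega)] at hc
    exact inv_ne_zero hA hc.symm
  · rw [Matrix.det_smul, Fintype.card_fin, hc, inv_mul_cancel₀ hA]

theorem splitting (n : ℕ) (hn : 1 ≤ n) : ∃ (R₀ : ℝ) (N I : ℕ), 1 ≤ R₀ ∧ 1 ≤ N ∧ 1 ≤ I ∧
    ∀ (K : Type) [Field K] [IsAlgClosed K] (v : AbsoluteValue K ℝ), v.IsNontrivial →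
    ∀ (Γ : Type) [Group Γ] (S : Set Γ), S.Finite → (1 : Γ) ∈ S → Subgroup.closure S = ⊤ → NoFree S N →
    ∀ φ : Γ →* Matrix (Fin n) (Fin n) K,
    (∃ b : Matrix (Fin n) (Fin n) K, b.det ≠ 0 ∧ ∀ s ∈ S, ∃ c : K, c ≠ 0 ∧ (c • φ s).det = 1 ∧
      nm v (b * (c • φ s) * b⁻¹) ≤ R₀) ∨
    (∃ p : Matrix (Fin n) (Fin n) K, p * p = p ∧ p ≠ 0 ∧ p ≠ 1 ∧ ∃ H : Subgroup Γ, H.index ≠ 0 ∧ H.index ≤ I ∧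
      ∀ γ ∈ H, Commute (φ γ) p) := by
  obtain ⟨N₀, η₁, hN₀, hη₁, hjsr⟩ := jsr n hn
  obtain ⟨D, hD⟩ : ∃ D, D = (2 * n) ^ n := ⟨_, rfl⟩
  obtain ⟨e, he⟩ : ∃ e, e = D.factorial := ⟨_, rfl⟩
  have hD1 : 1 ≤ D := by rw [hD]; exact Nat.one_le_pow _ _ (by omega)
  obtain ⟨C', Θ₀, hΘ₀, hspec⟩ := spectral n ((2 * n * N₀ + 1) * n + 1 + 2 * n * N₀) hn
  obtain ⟨cB, hcB⟩ : ∃ cB, cB = C' + ((2 * n * D + 1) * n + 1) + 2 * n * D := ⟨_, rfl⟩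
  obtain ⟨q, Θ₁, hΘ₁, hhalf⟩ := half n cB hn (by omega) D e hD he
  obtain ⟨M, hM, hspec⟩ := hspec q
  obtain ⟨Θ₂, hΘ₂⟩ : ∃ Θ₂ : ℝ, Θ₂ = Θ₀ + Θ₁ + n ^ 2 + 2 + η₁⁻¹ := ⟨_, rfl⟩
  have hη₁' : 0 < η₁⁻¹ := by positivity
  have hn2 : (0 : ℝ) ≤ n ^ 2 := by positivity
  refine ⟨Θ₂ ^ (2 * n), D * e + N₀ * M, D * D, one_le_pow₀ (by linarith), ?_, ?_, ?_⟩
  · have := Nat.mul_le_mul hN₀ hM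
    omega
  · exact one_le_mul_of_one_le_of_one_le hD1 hD1
  intro K _ _ v hv Γ _ S hSf h1S hS hNF φ
  choose c hc hcdet using fun s : S => exists_det_one hn (φ s) (det_rep_ne φ s)
  have : Finite S := hSf
  have : Nonempty S := ⟨⟨1, h1S⟩⟩
  obtain ⟨b, R, hb, hR1, hbR, w, hw0, hwN, μ, hμ, hμR⟩ := hjsr K v hv S (fun s => c s • φ s) hcdet
  rcases le_or_gt R (Θ₂ ^ (2 * n)) with hRle | hRgt
  · left
    exact ⟨b, hb, fun s hs => ⟨c ⟨s, hs⟩, hc _, hcdet _, (hbR ⟨s, hs⟩).trans hRle⟩⟩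
  right
  obtain ⟨Θ, hΘ0, hΘR⟩ : ∃ Θ : ℝ, 0 ≤ Θ ∧ Θ ^ (2 * n) = R := by
    refine ⟨R ^ ((2 * n : ℕ) : ℝ)⁻¹, by positivity, ?_⟩
    exact Real.rpow_inv_natCast_pow (by linarith) (by omega)
  have hΘΘ₂ : Θ₂ ≤ Θ := by
    rw [← hΘR] at hRgt
    exact (lt_of_pow_lt_pow_left₀ _ hΘ0 hRgt).le
  have hΘ2 : 2 ≤ Θ := by linarith
  have hΘ1 : 1 ≤ Θ := by linarith
  have hΘn2 : (n : ℝ) ^ 2 ≤ Θ := by linarith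
  have hmono : ∀ a b : ℕ, a ≤ b → Θ ^ a ≤ Θ ^ b := fun a b h => pow_le_pow_right₀ hΘ1 h
  have hbU := isUnit_iff_ne_zero.mpr hb
  have hbi : b⁻¹ * b = 1 := Matrix.nonsing_inv_mul _ hbU
  have hbi' : b * b⁻¹ = 1 := Matrix.mul_nonsing_inv _ hbU
  set ψ := conjRep φ b hb with hψ
  set y : S → Matrix (Fin n) (Fin n) K := fun s => b * (c s • φ s) * b⁻¹ with hy
  have hyψ : ∀ s : S, y s = c s • ψ s := by
    intro s
    simp only [hy, Matrix.mul_smul, Matrix.smul_mul]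
    rfl
  have hydet : ∀ s, (y s).det = 1 := by
    intro s
    simp only [hy]
    rw [Matrix.det_mul, Matrix.det_mul, hcdet, mul_one, ← Matrix.det_mul, hbi', Matrix.det_one]
  have hprod : ∀ L : List S, (L.map y).prod = b * (L.map (fun s => c s • φ s)).prod * b⁻¹ := by
    intro L
    induction L with
    | nil => simp [hbi']
    | cons s L ih =>
      rw [List.map_cons, List.prod_cons, ih, List.map_cons, List.prod_cons]
      simp only [hy]
      calc _ = b * (c s • φ s) * (b⁻¹ * b) * (L.map (fun s => c s • φ s)).prod * b⁻¹ := by simp only [mul_assoc]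
        _ = _ := by rw [hbi, mul_one]; simp only [mul_assoc]
  have hLdet : ∀ L : List S, ((L.map y).prod).det = 1 := by
    intro L
    induction L with
    | nil => simp
    | cons s L ih => rw [List.map_cons, List.prod_cons, Matrix.det_mul, ih, hydet, one_mul]
  have hR0 : 0 ≤ R := by linarith
  have hLnm : ∀ L : List S, L ≠ [] → ∀ k, L.length ≤ k → nm v (L.map y).prod ≤ Θ ^ (2 * n * k) := by
    intro L hL k hk
    have h1 := nm_prod_le' v hR0 (L.map y) (by simpa using hL) (by
      intro x hx
      rw [List.mem_map] at hx
      obtain ⟨s, -, rfl⟩ := hx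
      exact hbR s)
    rw [List.length_map] at h1
    refine h1.trans ?_
    rw [pow_mul, hΘR]
    exact pow_le_pow_right₀ hR1 hk
  set g := (w.map y).prod with hg
  have hgdet : g.det = 1 := hLdet w
  have hgn : nm v g ≤ Θ ^ (2 * n * N₀) := hLnm w hw0 N₀ hwN
  have hgn' := inv_le_pow v hgdet hΘ2 hΘn2 hgn
  have hgchar : g.charpoly.IsRoot μ := by
    have e1 : g.charpoly = ((w.map (fun s => c s • φ s)).prod).charpoly := by
      rw [hg, hprod]
      have := Matrix.charpoly_units_conj (Matrix.nonsingInvUnit b hbU) ((w.map (fun s => c s • φ s)).prod)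
      rw [← this]
      rfl
    rw [e1]; exact hμ
  have hμΘ : Θ ^ n ≤ v μ := by
    refine le_trans ?_ hμR
    have h1 : R ≤ R ^ w.length := le_self_pow₀ hR1 (by simpa using hw0)
    have h2 : 1 ≤ η₁ * Θ ^ n := by
      have h3 : Θ ≤ Θ ^ n := le_self_pow₀ hΘ1 (by omega)
      have h4 : η₁⁻¹ ≤ Θ ^ n := by linarith
      calc 1 = η₁ * η₁⁻¹ := (mul_inv_cancel₀ hη₁.ne').symm
        _ ≤ _ := mul_le_mul_of_nonneg_left h4 hη₁.le
    calc Θ ^ n = 1 * Θ ^ n := (one_mul _).symm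
      _ ≤ (η₁ * Θ ^ n) * Θ ^ n := mul_le_mul_of_nonneg_right h2 (by positivity)
      _ = η₁ * R := by rw [← hΘR]; ring
      _ ≤ _ := mul_le_mul_of_nonneg_left h1 hη₁.le
  obtain ⟨p, hp, hp0, hp1, hgp, hpn, hpn', hcon⟩ := hspec K v Θ (by linarith) g hgdet
    (hgn.trans (hmono _ _ (by omega))) (hgn'.trans (hmono _ _ (by omega))) μ hgchar hμΘ
  obtain ⟨d, hd, hdg⟩ := word_scal ψ c hc y hyψ w
  set γ := (w.map (fun s : S => (s : Γ))).prod with hγ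
  rw [← hg] at hdg
  have hγS : γ ∈ S ^ N₀ := pow_mono_set h1S hwN (list_mem_pow w)
  have haS : γ ^ M ∈ S ^ (N₀ * M) := by rw [pow_mul]; exact Set.pow_mem_pow hγS
  have hψa : ψ (γ ^ M) = d ^ M • g ^ M := by rw [map_pow, hdg, smul_pow]
  have hgU : IsUnit g.det := by rw [hgdet]; exact isUnit_one
  have hgg : g⁻¹ * g = 1 := Matrix.nonsing_inv_mul _ hgU
  have hgg' : g * g⁻¹ = 1 := Matrix.mul_nonsing_inv _ hgU
  have hψγi : ψ γ⁻¹ = d⁻¹ • g⁻¹ := by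
    have hone : ψ γ * (d⁻¹ • g⁻¹) = 1 := by
      rw [hdg, Matrix.smul_mul, Matrix.mul_smul, hgg', smul_smul, mul_inv_cancel₀ hd, one_smul]
    calc ψ γ⁻¹ = ψ γ⁻¹ * (ψ γ * (d⁻¹ • g⁻¹)) := by rw [hone, mul_one]
      _ = _ := by rw [← mul_assoc, ← map_mul, inv_mul_cancel, map_one, one_mul]
  have hψai : ψ (γ ^ M)⁻¹ = d⁻¹ ^ M • g⁻¹ ^ M := by rw [← inv_pow, map_pow, hψγi, smul_pow]
  have hcomm : Commute (ψ (γ ^ M)) p := by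
    rw [hψa]; exact (hgp.pow_left M).smul_left _
  have hvd : v (d ^ M) * v (d⁻¹ ^ M) = 1 := by
    rw [← map_mul, ← mul_pow, mul_inv_cancel₀ hd, one_pow, map_one]
  have hcon' : nm v (ψ (γ ^ M) * (1 - p)) * nm v (ψ (γ ^ M)⁻¹ * p) ≤ (Θ ^ q)⁻¹ := by
    rw [hψa, hψai, Matrix.smul_mul, Matrix.smul_mul, nm_smul, nm_smul]
    calc _ = (v (d ^ M) * v (d⁻¹ ^ M)) * (nm v (g ^ M * (1 - p)) * nm v (g⁻¹ ^ M * p)) := by ring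
      _ ≤ _ := by rw [hvd, one_mul]; exact hcon
  have hnorm : ∀ h ∈ S ^ D, ∃ (c : K) (x x' : Matrix (Fin n) (Fin n) K), c ≠ 0 ∧ ψ h = c • x ∧ x * x' = 1 ∧
      nm v x ≤ Θ ^ cB ∧ nm v x' ≤ Θ ^ cB := by
    intro h hh
    obtain ⟨L, hL, rfl⟩ := mem_list_of_pow hh
    obtain ⟨t, ht, hte⟩ := word_scal ψ c hc y hyψ L
    have h1 := hLnm L (by rintro rfl; simp at hL; omega) D hL.le
    have h2 := inv_le_pow v (hLdet L) hΘ2 hΘn2 h1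
    exact ⟨t, _, (L.map y).prod⁻¹, ht, hte, Matrix.mul_nonsing_inv _ (by rw [hLdet]; exact isUnit_one),
      h1.trans (hmono _ _ (by omega)), h2.trans (hmono _ _ (by omega))⟩
  have hA := hhalf K v Θ (by linarith) Γ S h1S hS ψ p hp (hpn.trans (hmono _ _ (by omega)))
    (hpn'.trans (hmono _ _ (by omega))) (N₀ * M) (γ ^ M) haS hcomm hcon' hNF hnorm
  have hpT : pᵀ * pᵀ = pᵀ := by rw [← Matrix.transpose_mul, hp]
  have hT1 : (1 : Matrix (Fin n) (Fin n) K) - pᵀ = (1 - p)ᵀ := by rw [Matrix.transpose_sub, Matrix.transpose_one]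
  have hcomm' : Commute (dual ψ (γ ^ M)⁻¹) pᵀ := by
    change (ψ (γ ^ M)⁻¹⁻¹)ᵀ * pᵀ = pᵀ * (ψ (γ ^ M)⁻¹⁻¹)ᵀ
    rw [inv_inv, ← Matrix.transpose_mul, ← Matrix.transpose_mul, hcomm.eq]
  have hpi : ψ (γ ^ M)⁻¹ * p = p * ψ (γ ^ M)⁻¹ := by
    have h1 : ψ (γ ^ M)⁻¹ * ψ (γ ^ M) = 1 := by rw [← map_mul, inv_mul_cancel, map_one]
    have h2 : ψ (γ ^ M) * ψ (γ ^ M)⁻¹ = 1 := by rw [← map_mul, mul_inv_cancel, map_one]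
    calc ψ (γ ^ M)⁻¹ * p = ψ (γ ^ M)⁻¹ * (p * ψ (γ ^ M)) * ψ (γ ^ M)⁻¹ := by
          rw [mul_assoc, mul_assoc, h2, mul_one]
      _ = _ := by rw [← hcomm.eq, ← mul_assoc, h1, one_mul]
  have hBb := hhalf K v Θ (by linarith) Γ S⁻¹ (by simpa using h1S) (by rw [Subgroup.closure_inv, hS]) (dual ψ) pᵀ hpT
    (by rw [nm_transpose]; exact hpn.trans (hmono _ _ (by omega)))
    (by rw [hT1, nm_transpose]; exact hpn'.trans (hmono _ _ (by omega))) (N₀ * M) (γ ^ M)⁻¹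
    (by rw [inv_pow, Set.mem_inv, inv_inv]; exact haS) hcomm' (by
      have e1 : dual ψ (γ ^ M)⁻¹ * (1 - pᵀ) = (ψ (γ ^ M) * (1 - p))ᵀ := by
        change (ψ (γ ^ M)⁻¹⁻¹)ᵀ * _ = _
        rw [inv_inv, hT1, ← Matrix.transpose_mul, mul_sub, sub_mul, hcomm.eq, one_mul, mul_one]
      have e2 : dual ψ (γ ^ M)⁻¹⁻¹ * pᵀ = (ψ (γ ^ M)⁻¹ * p)ᵀ := by
        change (ψ (γ ^ M)⁻¹⁻¹⁻¹)ᵀ * _ = _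
        rw [inv_inv, ← Matrix.transpose_mul, hpi]
      rw [e1, e2, nm_transpose, nm_transpose]
      exact hcon') hNF.inv (by
      intro h hh
      rw [inv_pow, Set.mem_inv] at hh
      obtain ⟨t, x, x', ht, hx, hxx', h1, h2⟩ := hnorm h⁻¹ hh
      refine ⟨t, xᵀ, x'ᵀ, ht, ?_, ?_, by rw [nm_transpose]; exact h1, by rw [nm_transpose]; exact h2⟩
      · change (ψ h⁻¹)ᵀ = _
        rw [hx, Matrix.transpose_smul]
      · rw [← Matrix.transpose_mul, mul_eq_one_comm.mp hxx', Matrix.transpose_one])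
  refine ⟨b⁻¹ * p * b, ?_, ?_, ?_, stab ψ p hp ⊓ stab (dual ψ) pᵀ hpT, Subgroup.index_inf_ne_zero hA.1 hBb.1,
    Subgroup.index_inf_le.trans (Nat.mul_le_mul hA.2 hBb.2), ?_⟩
  · calc b⁻¹ * p * b * (b⁻¹ * p * b) = b⁻¹ * p * (b * b⁻¹) * p * b := by simp only [mul_assoc]
      _ = b⁻¹ * (p * p) * b := by rw [hbi']; simp only [mul_assoc, one_mul]
      _ = _ := by rw [hp]
  · intro h0
    apply hp0
    calc p = b * (b⁻¹ * p * b) * b⁻¹ := by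
          rw [← mul_assoc, ← mul_assoc, hbi', one_mul, mul_assoc, hbi', mul_one]
      _ = 0 := by rw [h0, mul_zero, zero_mul]
  · intro h0
    apply hp1
    calc p = b * (b⁻¹ * p * b) * b⁻¹ := by
          rw [← mul_assoc, ← mul_assoc, hbi', one_mul, mul_assoc, hbi', mul_one]
      _ = 1 := by rw [h0, mul_one, hbi']
  · intro s hs
    have h1 : (1 - p) * ψ s * p = 0 := hs.1
    have h2 : (1 - pᵀ) * (ψ s⁻¹⁻¹)ᵀ * pᵀ = 0 := (inv_mem hs).2
    rw [inv_inv, hT1, ← Matrix.transpose_mul, ← Matrix.transpose_mul] at h2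
    have h3 : p * (ψ s * (1 - p)) = 0 := by simpa using congrArg Matrix.transpose h2
    have h4 : ψ s * p = p * ψ s := by
      rw [sub_mul, sub_mul, one_mul, sub_eq_zero] at h1
      rw [mul_sub, mul_sub, mul_one, sub_eq_zero, ← mul_assoc] at h3
      rw [h1, ← h3]
    have h5 : b * φ s * b⁻¹ * p = p * (b * φ s * b⁻¹) := h4
    change φ s * (b⁻¹ * p * b) = b⁻¹ * p * b * φ s
    calc φ s * (b⁻¹ * p * b) = (b⁻¹ * b) * φ s * b⁻¹ * p * b := by rw [hbi, one_mul]; simp only [mul_assoc]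
      _ = b⁻¹ * (b * φ s * b⁻¹ * p) * b := by simp only [mul_assoc]
      _ = b⁻¹ * p * b * φ s * (b⁻¹ * b) := by rw [h5]; simp only [mul_assoc]
      _ = _ := by rw [hbi, mul_one]

end EG

namespace EG

lemma idem_half {K : Type*} [Field K] {n : ℕ} (p : Matrix (Fin n) (Fin n) K) (hp : p * p = p) :
    ∃ (m : ℕ) (V : Matrix (Fin n) (Fin m) K) (V' : Matrix (Fin m) (Fin n) K), V * V' = p ∧ V' * V = 1 := by
  set f := Matrix.toLin' p with hf
  have hff : ∀ x, f (f x) = f x := by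
    intro x
    rw [hf, Matrix.toLin'_apply, Matrix.toLin'_apply, Matrix.mulVec_mulVec, hp]
  set W := LinearMap.range f with hW
  let B := (Module.finBasis K W).equivFun
  refine ⟨Module.finrank K W, LinearMap.toMatrix' (W.subtype ∘ₗ B.symm.toLinearMap),
    LinearMap.toMatrix' (B.toLinearMap ∘ₗ f.rangeRestrict), ?_, ?_⟩
  · rw [← LinearMap.toMatrix'_comp]
    rw [← LinearMap.toMatrix'_toLin' p]
    congr 1
    refine LinearMap.ext fun x => ?_
    simp only [LinearMap.comp_apply, LinearEquiv.coe_coe, LinearEquiv.symm_apply_apply, Submodule.subtype_apply]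
    rfl
  · rw [← LinearMap.toMatrix'_comp, ← LinearMap.toMatrix'_id]
    congr 1
    refine LinearMap.ext fun x => ?_
    have : f.rangeRestrict ((B.symm x : W) : Fin n → K) = B.symm x := by
      apply Subtype.ext
      obtain ⟨y, hy⟩ := (B.symm x).2
      change f _ = _
      rw [← hy, hff]
    simp only [LinearMap.comp_apply, LinearEquiv.coe_coe, Submodule.subtype_apply, this, LinearEquiv.apply_symm_apply,
      LinearMap.id_apply]

/-- A splitting of `K^n` in two summands. -/
structure Split2 (K : Type) [Field K] (n n1 n2 : ℕ) where
  V : Matrix (Fin n) (Fin n1) K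
  V' : Matrix (Fin n1) (Fin n) K
  U : Matrix (Fin n) (Fin n2) K
  U' : Matrix (Fin n2) (Fin n) K
  hV : V' * V = 1
  hU : U' * U = 1
  hs : V * V' + U * U' = 1
  hVU : V' * U = 0
  hUV : U' * V = 0

lemma idem_split {K : Type} [Field K] {n : ℕ} (p : Matrix (Fin n) (Fin n) K) (hp : p * p = p) (h0 : p ≠ 0) (h1 : p ≠ 1) :
    ∃ (n1 n2 : ℕ) (σ : Split2 K n n1 n2), 1 ≤ n1 ∧ 1 ≤ n2 ∧ n1 + n2 = n ∧ σ.V * σ.V' = p := by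
  obtain ⟨n1, V, V', hVV, hV⟩ := idem_half p hp
  obtain ⟨n2, U, U', hUU, hU⟩ := idem_half (1 - p) (by simp [mul_sub, sub_mul, hp])
  have hVU : V' * U = 0 := by
    calc V' * U = (V' * V) * V' * (U * (U' * U)) := by rw [hV, hU, Matrix.one_mul, Matrix.mul_one]
      _ = V' * ((V * V') * (U * U')) * U := by simp only [Matrix.mul_assoc]
      _ = 0 := by rw [hVV, hUU, mul_sub, mul_one, hp, sub_self, Matrix.mul_zero, Matrix.zero_mul]
  have hUV : U' * V = 0 := by
    calc U' * V = (U' * U) * U' * (V * (V' * V)) := by rw [hV, hU, Matrix.one_mul, Matrix.mul_one]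
      _ = U' * ((U * U') * (V * V')) * V := by simp only [Matrix.mul_assoc]
      _ = 0 := by rw [hVV, hUU, sub_mul, one_mul, hp, sub_self, Matrix.mul_zero, Matrix.zero_mul]
  have hs : V * V' + U * U' = 1 := by rw [hVV, hUU]; abel
  refine ⟨n1, n2, ⟨V, V', U, U', hV, hU, hs, hVU, hUV⟩, ?_, ?_, ?_, hVV⟩
  · rcases Nat.eq_zero_or_pos n1 with h | h
    · subst h
      exact absurd (by rw [← hVV]; ext i j; simp [Matrix.mul_apply]) h0
    · exact h
  · rcases Nat.eq_zero_or_pos n2 with h | h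
    · subst h
      refine absurd ?_ h1
      have : (1 : Matrix (Fin n) (Fin n) K) - p = 0 := by rw [← hUU]; ext i j; simp [Matrix.mul_apply]
      exact (sub_eq_zero.mp this).symm
    · exact h
  · have := Matrix.square_of_invertible (Matrix.fromRows V' U') (Matrix.fromCols V U)
      (by rw [Matrix.fromRows_mul_fromCols, hV, hU, hVU, hUV, Matrix.fromBlocks_one])
      (by rw [Matrix.fromCols_mul_fromRows, hs])
    simpa using this

namespace Split2
variable {K : Type} [Field K] {n n1 n2 : ℕ} (σ : Split2 K n n1 n2)

/-- joining two matrices -/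
def J : Matrix (Fin n1) (Fin n1) K × Matrix (Fin n2) (Fin n2) K →* Matrix (Fin n) (Fin n) K where
  toFun X := σ.V * X.1 * σ.V' + σ.U * X.2 * σ.U'
  map_one' := by simp [σ.hs]
  map_mul' X Y := by
    have e1 : σ.V * X.1 * σ.V' * (σ.V * Y.1 * σ.V') = σ.V * (X.1 * Y.1) * σ.V' := by
      calc _ = σ.V * X.1 * (σ.V' * σ.V) * Y.1 * σ.V' := by simp only [Matrix.mul_assoc]
        _ = _ := by rw [σ.hV, Matrix.mul_one]; simp only [Matrix.mul_assoc]
    have e2 : σ.U * X.2 * σ.U' * (σ.U * Y.2 * σ.U') = σ.U * (X.2 * Y.2) * σ.U' := by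
      calc _ = σ.U * X.2 * (σ.U' * σ.U) * Y.2 * σ.U' := by simp only [Matrix.mul_assoc]
        _ = _ := by rw [σ.hU, Matrix.mul_one]; simp only [Matrix.mul_assoc]
    have e3 : σ.V * X.1 * σ.V' * (σ.U * Y.2 * σ.U') = 0 := by
      calc _ = σ.V * X.1 * (σ.V' * σ.U) * Y.2 * σ.U' := by simp only [Matrix.mul_assoc]
        _ = _ := by rw [σ.hVU]; simp
    have e4 : σ.U * X.2 * σ.U' * (σ.V * Y.1 * σ.V') = 0 := by
      calc _ = σ.U * X.2 * (σ.U' * σ.V) * Y.1 * σ.V' := by simp only [Matrix.mul_assoc]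
        _ = _ := by rw [σ.hUV]; simp
    simp only [Prod.fst_mul, Prod.snd_mul, Matrix.add_mul, Matrix.mul_add, e1, e2, e3, e4]
    abel

lemma J_apply (X : Matrix (Fin n1) (Fin n1) K × Matrix (Fin n2) (Fin n2) K) :
    σ.J X = σ.V * X.1 * σ.V' + σ.U * X.2 * σ.U' := rfl

lemma V'_J (X : Matrix (Fin n1) (Fin n1) K × Matrix (Fin n2) (Fin n2) K) : σ.V' * σ.J X = X.1 * σ.V' := by
  rw [J_apply, Matrix.mul_add, ← Matrix.mul_assoc, ← Matrix.mul_assoc, σ.hV, ← Matrix.mul_assoc, ← Matrix.mul_assoc,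
    σ.hVU]
  simp

lemma U'_J (X : Matrix (Fin n1) (Fin n1) K × Matrix (Fin n2) (Fin n2) K) : σ.U' * σ.J X = X.2 * σ.U' := by
  rw [J_apply, Matrix.mul_add, ← Matrix.mul_assoc, ← Matrix.mul_assoc, σ.hUV, ← Matrix.mul_assoc, ← Matrix.mul_assoc,
    σ.hU]
  simp

variable {G : Type} [Group G] (φ : G →* Matrix (Fin n) (Fin n) K) (hc : ∀ g, Commute (φ g) (σ.V * σ.V'))

/-- first component -/
def rep1 : G →* Matrix (Fin n1) (Fin n1) K where
  toFun g := σ.V' * φ g * σ.V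
  map_one' := by simp [σ.hV]
  map_mul' g h := by
    calc σ.V' * φ (g * h) * σ.V = (σ.V' * σ.V) * σ.V' * (φ g * φ h) * σ.V := by rw [σ.hV, map_mul, Matrix.one_mul]
      _ = σ.V' * ((σ.V * σ.V') * φ g) * φ h * σ.V := by simp only [Matrix.mul_assoc]
      _ = _ := by rw [← (hc g).eq]; simp only [Matrix.mul_assoc]

lemma hcU (hc : ∀ g, Commute (φ g) (σ.V * σ.V')) (g : G) : Commute (φ g) (σ.U * σ.U') := by
  have : σ.U * σ.U' = 1 - σ.V * σ.V' := by rw [← σ.hs]; abel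
  rw [this]
  exact (Commute.one_right _).sub_right (hc g)

/-- second component -/
def rep2 : G →* Matrix (Fin n2) (Fin n2) K where
  toFun g := σ.U' * φ g * σ.U
  map_one' := by simp [σ.hU]
  map_mul' g h := by
    calc σ.U' * φ (g * h) * σ.U = (σ.U' * σ.U) * σ.U' * (φ g * φ h) * σ.U := by rw [σ.hU, map_mul, Matrix.one_mul]
      _ = σ.U' * ((σ.U * σ.U') * φ g) * φ h * σ.U := by simp only [Matrix.mul_assoc]
      _ = _ := by rw [← (σ.hcU φ hc g).eq]; simp only [Matrix.mul_assoc]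

lemma rep_eq (g : G) : φ g = σ.J (σ.rep1 φ hc g, σ.rep2 φ hc g) := by
  have h1 : (σ.V * σ.V') * (σ.V * σ.V') = σ.V * σ.V' := by
    calc _ = σ.V * (σ.V' * σ.V) * σ.V' := by simp only [Matrix.mul_assoc]
      _ = _ := by rw [σ.hV, Matrix.mul_one]
  have h2 : (σ.U * σ.U') * (σ.U * σ.U') = σ.U * σ.U' := by
    calc _ = σ.U * (σ.U' * σ.U) * σ.U' := by simp only [Matrix.mul_assoc]
      _ = _ := by rw [σ.hU, Matrix.mul_one]
  have e1 : σ.V * (σ.V' * φ g * σ.V) * σ.V' = φ g * (σ.V * σ.V') := by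
    calc _ = (σ.V * σ.V') * φ g * (σ.V * σ.V') := by simp only [Matrix.mul_assoc]
      _ = _ := by rw [← (hc g).eq, mul_assoc, h1]
  have e2 : σ.U * (σ.U' * φ g * σ.U) * σ.U' = φ g * (σ.U * σ.U') := by
    calc _ = (σ.U * σ.U') * φ g * (σ.U * σ.U') := by simp only [Matrix.mul_assoc]
      _ = _ := by rw [← (σ.hcU φ hc g).eq, mul_assoc, h2]
  rw [J_apply]
  change φ g = σ.V * (σ.V' * φ g * σ.V) * σ.V' + σ.U * (σ.U' * φ g * σ.U) * σ.U'
  rw [e1, e2, ← mul_add, σ.hs, mul_one]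

end Split2

/-- The bounded block form statement. -/
def LDAt (n : ℕ) (R : ℝ) (k N m : ℕ) : Prop :=
  ∀ (K : Type) [Field K] [IsAlgClosed K] (v : AbsoluteValue K ℝ), v.IsNontrivial →
    ∀ (Γ : Type) [Group Γ] (S : Set Γ), S.Finite → (1 : Γ) ∈ S → Subgroup.closure S = ⊤ → NoFree S N →
    ∀ φ : Γ →* Matrix (Fin n) (Fin n) K,
    ∃ (G : Type) (_ : Group G) (f : G →* Γ) (S' : Set G), Function.Injective f ∧ f.range.index ≠ 0 ∧
      S'.Finite ∧ (1 : G) ∈ S' ∧ Subgroup.closure S' = ⊤ ∧ f '' S' ⊆ S ^ m ∧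
      ∃ (ι : Type) (_ : Fintype ι) (_ : DecidableEq ι) (P : Matrix ι (Fin n) K) (P' : Matrix (Fin n) ι K)
        (z : G → (Matrix (Fin n) (Fin n) K)ˣ),
        Fintype.card ι = n ∧ P * P' = 1 ∧ P' * P = 1 ∧
        (∀ g h, Commute (z g : Matrix (Fin n) (Fin n) K) (z h)) ∧
        (∀ g h, Commute (z g : Matrix (Fin n) (Fin n) K) (φ (f h))) ∧
        ∀ w ∈ S' ^ k, nm v (P * (φ (f w) * (z w : Matrix (Fin n) (Fin n) K)) * P') ≤ R ∧
          nm v (P * (φ (f w⁻¹) * (((z w)⁻¹ : (Matrix (Fin n) (Fin n) K)ˣ) : Matrix (Fin n) (Fin n) K)) * P') ≤ R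

lemma finite_pow {G : Type*} [Group G] {S : Set G} (h : S.Finite) (k : ℕ) : (S ^ k).Finite := by
  induction k with
  | zero => simp
  | succ k ih => rw [pow_succ]; exact ih.mul h

lemma closure_pow {G : Type*} [Group G] {S : Set G} (h1 : (1 : G) ∈ S) (h : Subgroup.closure S = ⊤) {k : ℕ} (hk : 1 ≤ k) :
    Subgroup.closure (S ^ k) = ⊤ := by
  rw [eq_top_iff, ← h]
  refine Subgroup.closure_mono ?_
  conv_lhs => rw [← pow_one S]
  exact pow_mono_set h1 hk

lemma image_pow_le {G H : Type*} [Group G] [Group H] (f : G →* H) {T : Set G} {S : Set H} {m : ℕ}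
    (h : f '' T ⊆ S ^ m) (k : ℕ) : f '' (T ^ k) ⊆ S ^ (m * k) := by
  rw [Set.image_pow, pow_mul]; exact Set.pow_subset_pow_left h

lemma nm_blocks {K : Type*} [Field K] (v : AbsoluteValue K ℝ) {ι κ : Type*} [Fintype ι] [Fintype κ]
    (A : Matrix ι ι K) (B : Matrix κ κ K) : nm v (Matrix.fromBlocks A 0 0 B) = nm v A + nm v B := by
  simp [nm]

/-- the combination step -/
lemma ld_combine {K : Type} [Field K] (v : AbsoluteValue K ℝ) {n n1 n2 : ℕ} (σ : Split2 K n n1 n2) (hn : n1 + n2 = n)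
    {G : Type} [Group G] (ψ : G →* Matrix (Fin n) (Fin n) K) (ψ1 : G →* Matrix (Fin n1) (Fin n1) K)
    (ψ2 : G →* Matrix (Fin n2) (Fin n2) K) (hψ : ∀ g, ψ g = σ.J (ψ1 g, ψ2 g)) (W : Set G) (R1 R2 : ℝ)
    (h1 : ∃ (ι : Type) (_ : Fintype ι) (_ : DecidableEq ι) (P : Matrix ι (Fin n1) K) (P' : Matrix (Fin n1) ι K)
        (z : G → (Matrix (Fin n1) (Fin n1) K)ˣ),
        Fintype.card ι = n1 ∧ P * P' = 1 ∧ P' * P = 1 ∧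
        (∀ g h, Commute (z g : Matrix (Fin n1) (Fin n1) K) (z h)) ∧
        (∀ g h, Commute (z g : Matrix (Fin n1) (Fin n1) K) (ψ1 h)) ∧
        ∀ w ∈ W, nm v (P * (ψ1 w * (z w : Matrix (Fin n1) (Fin n1) K)) * P') ≤ R1 ∧
          nm v (P * (ψ1 w⁻¹ * (((z w)⁻¹ : (Matrix (Fin n1) (Fin n1) K)ˣ) : Matrix (Fin n1) (Fin n1) K)) * P') ≤ R1)
    (h2 : ∃ (ι : Type) (_ : Fintype ι) (_ : DecidableEq ι) (P : Matrix ι (Fin n2) K) (P' : Matrix (Fin n2) ι K)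
        (z : G → (Matrix (Fin n2) (Fin n2) K)ˣ),
        Fintype.card ι = n2 ∧ P * P' = 1 ∧ P' * P = 1 ∧
        (∀ g h, Commute (z g : Matrix (Fin n2) (Fin n2) K) (z h)) ∧
        (∀ g h, Commute (z g : Matrix (Fin n2) (Fin n2) K) (ψ2 h)) ∧
        ∀ w ∈ W, nm v (P * (ψ2 w * (z w : Matrix (Fin n2) (Fin n2) K)) * P') ≤ R2 ∧
          nm v (P * (ψ2 w⁻¹ * (((z w)⁻¹ : (Matrix (Fin n2) (Fin n2) K)ˣ) : Matrix (Fin n2) (Fin n2) K)) * P') ≤ R2) :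
    ∃ (ι : Type) (_ : Fintype ι) (_ : DecidableEq ι) (P : Matrix ι (Fin n) K) (P' : Matrix (Fin n) ι K)
        (z : G → (Matrix (Fin n) (Fin n) K)ˣ),
        Fintype.card ι = n ∧ P * P' = 1 ∧ P' * P = 1 ∧
        (∀ g h, Commute (z g : Matrix (Fin n) (Fin n) K) (z h)) ∧
        (∀ g h, Commute (z g : Matrix (Fin n) (Fin n) K) (ψ h)) ∧
        ∀ w ∈ W, nm v (P * (ψ w * (z w : Matrix (Fin n) (Fin n) K)) * P') ≤ R1 + R2 ∧
          nm v (P * (ψ w⁻¹ * (((z w)⁻¹ : (Matrix (Fin n) (Fin n) K)ˣ) : Matrix (Fin n) (Fin n) K)) * P') ≤ R1 + R2 := by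
  obtain ⟨ι1, _, _, P1, P1', z1, hc1, hP1, hP1', hz1, hzψ1, hb1⟩ := h1
  obtain ⟨ι2, _, _, P2, P2', z2, hc2, hP2, hP2', hz2, hzψ2, hb2⟩ := h2
  have hconj : ∀ X : Matrix (Fin n1) (Fin n1) K × Matrix (Fin n2) (Fin n2) K,
      Matrix.fromRows (P1 * σ.V') (P2 * σ.U') * σ.J X * Matrix.fromCols (σ.V * P1') (σ.U * P2') =
        Matrix.fromBlocks (P1 * X.1 * P1') 0 0 (P2 * X.2 * P2') := by
    intro X
    rw [Matrix.fromRows_mul, Matrix.fromRows_mul_fromCols, Matrix.mul_assoc P1, σ.V'_J, Matrix.mul_assoc P2, σ.U'_J]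
    have e1 : P1 * (X.1 * σ.V') * (σ.V * P1') = P1 * X.1 * P1' := by
      calc _ = P1 * X.1 * (σ.V' * σ.V) * P1' := by simp only [Matrix.mul_assoc]
        _ = _ := by rw [σ.hV, Matrix.mul_one]
    have e2 : P1 * (X.1 * σ.V') * (σ.U * P2') = 0 := by
      calc _ = P1 * X.1 * (σ.V' * σ.U) * P2' := by simp only [Matrix.mul_assoc]
        _ = _ := by rw [σ.hVU]; simp
    have e3 : P2 * (X.2 * σ.U') * (σ.V * P1') = 0 := by
      calc _ = P2 * X.2 * (σ.U' * σ.V) * P1' := by simp only [Matrix.mul_assoc]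
        _ = _ := by rw [σ.hUV]; simp
    have e4 : P2 * (X.2 * σ.U') * (σ.U * P2') = P2 * X.2 * P2' := by
      calc _ = P2 * X.2 * (σ.U' * σ.U) * P2' := by simp only [Matrix.mul_assoc]
        _ = _ := by rw [σ.hU, Matrix.mul_one]
    rw [e1, e2, e3, e4]
  have hz : ∀ g, ∃ u : (Matrix (Fin n) (Fin n) K)ˣ, (u : Matrix (Fin n) (Fin n) K) = σ.J ((z1 g).val, (z2 g).val) ∧
      ((u⁻¹ : (Matrix (Fin n) (Fin n) K)ˣ) : Matrix (Fin n) (Fin n) K) = σ.J ((z1 g)⁻¹.val, (z2 g)⁻¹.val) := by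
    intro g
    refine ⟨⟨σ.J ((z1 g).val, (z2 g).val), σ.J ((z1 g)⁻¹.val, (z2 g)⁻¹.val), ?_, ?_⟩, rfl, rfl⟩
    · rw [← map_mul, Prod.mk_mul_mk, Units.mul_inv, Units.mul_inv, ← Prod.one_eq_mk, map_one]
    · rw [← map_mul, Prod.mk_mul_mk, Units.inv_mul, Units.inv_mul, ← Prod.one_eq_mk, map_one]
  choose z hz hzi using hz
  refine ⟨ι1 ⊕ ι2, inferInstance, inferInstance, Matrix.fromRows (P1 * σ.V') (P2 * σ.U'),
    Matrix.fromCols (σ.V * P1') (σ.U * P2'), z, ?_, ?_, ?_, ?_, ?_, ?_⟩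
  · rw [Fintype.card_sum, hc1, hc2, hn]
  · have := hconj 1
    rw [map_one, Matrix.mul_one] at this
    rw [this]
    simp [hP1, hP2]
  · rw [Matrix.fromCols_mul_fromRows]
    have e1 : σ.V * P1' * (P1 * σ.V') = σ.V * σ.V' := by
      calc _ = σ.V * (P1' * P1) * σ.V' := by simp only [Matrix.mul_assoc]
        _ = _ := by rw [hP1', Matrix.mul_one]
    have e2 : σ.U * P2' * (P2 * σ.U') = σ.U * σ.U' := by
      calc _ = σ.U * (P2' * P2) * σ.U' := by simp only [Matrix.mul_assoc]
        _ = _ := by rw [hP2', Matrix.mul_one]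
    rw [e1, e2, σ.hs]
  · intro g h
    rw [hz, hz]
    exact Commute.map (Commute.prod (hz1 g h) (hz2 g h)) σ.J
  · intro g h
    rw [hψ, hz]
    exact Commute.map (Commute.prod (hzψ1 g h) (hzψ2 g h)) σ.J
  · intro w hw
    constructor
    · rw [hψ, hz, ← map_mul, Prod.mk_mul_mk, hconj, nm_blocks]
      exact add_le_add (hb1 w hw).1 (hb2 w hw).1
    · rw [hψ, hzi, ← map_mul, Prod.mk_mul_mk, hconj, nm_blocks]
      exact add_le_add (hb1 w hw).2 (hb2 w hw).2

end EG

namespace EG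

/-- generators of a finite index subgroup -/
lemma sub_gen {Γ : Type*} [Group Γ] {S : Set Γ} (hf : S.Finite) (h1 : (1 : Γ) ∈ S) (hS : Subgroup.closure S = ⊤)
    (H : Subgroup Γ) (I : ℕ) (h0 : H.index ≠ 0) (hI : H.index ≤ I) :
    ∃ T : Set H, T.Finite ∧ (1 : H) ∈ T ∧ Subgroup.closure T = ⊤ ∧ H.subtype '' T ⊆ S ^ (I * I + I + 1) := by
  refine ⟨H.subtype ⁻¹' (S ^ (I * I + I + 1)), ?_, ?_, ?_, ?_⟩
  · exact (finite_pow hf _).preimage (Subtype.val_injective.injOn)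
  · have : (1 : Γ) ∈ S ^ (I * I + I + 1) := Set.one_mem_pow h1
    simpa using this
  · have h := posGen S h1 hS H I h0 hI
    apply Subgroup.map_injective H.subtype_injective
    rw [MonoidHom.map_closure, ← MonoidHom.range_eq_map, Subgroup.range_subtype]
    rw [Set.image_preimage_eq_inter_range]
    convert h using 2
    rw [Set.inter_comm]
    congr 1
    ext x; simp
  · rintro _ ⟨x, hx, rfl⟩; exact hx

lemma index_comp {G H L : Type*} [Group G] [Group H] [Group L] (f : G →* H) (g : H →* L) (hg : Function.Injective g)
    (h1 : f.range.index ≠ 0) (h2 : g.range.index ≠ 0) : (g.comp f).range.index ≠ 0 := by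
  rw [MonoidHom.range_comp, Subgroup.index_map, (MonoidHom.ker_eq_bot_iff g).mpr hg, sup_bot_eq]
  exact mul_ne_zero h1 h2

lemma ld_caseA {K : Type} [Field K] (v : AbsoluteValue K ℝ) {n : ℕ} {Γ : Type} [Group Γ] (S : Set Γ) 
    (φ : Γ →* Matrix (Fin n) (Fin n) K) (b : Matrix (Fin n) (Fin n) K) (hb : b.det ≠ 0) (R₀ : ℝ) 
    (h : ∀ s ∈ S, ∃ c : K, c ≠ 0 ∧ (c • φ s).det = 1 ∧ nm v (b * (c • φ s) * b⁻¹) ≤ R₀) :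
    ∃ (ι : Type) (_ : Fintype ι) (_ : DecidableEq ι) (P : Matrix ι (Fin n) K) (P' : Matrix (Fin n) ι K)
        (z : Γ → (Matrix (Fin n) (Fin n) K)ˣ),
        Fintype.card ι = n ∧ P * P' = 1 ∧ P' * P = 1 ∧
        (∀ g h, Commute (z g : Matrix (Fin n) (Fin n) K) (z h)) ∧
        (∀ g h, Commute (z g : Matrix (Fin n) (Fin n) K) (φ h)) ∧
        ∀ w ∈ S, nm v (P * (φ w * (z w : Matrix (Fin n) (Fin n) K)) * P') ≤ R₀ + n ^ 2 * (R₀ + 1) ^ n ∧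
          nm v (P * (φ w⁻¹ * (((z w)⁻¹ : (Matrix (Fin n) (Fin n) K)ˣ) : Matrix (Fin n) (Fin n) K)) * P')
            ≤ R₀ + n ^ 2 * (R₀ + 1) ^ n := by
  have h' : ∀ s, ∃ c : Kˣ, s ∈ S → ((c : K) • φ s).det = 1 ∧ nm v (b * ((c : K) • φ s) * b⁻¹) ≤ R₀ := by
    intro s
    by_cases hs : s ∈ S
    · obtain ⟨c, hc, h1, h2⟩ := h s hs
      exact ⟨Units.mk0 c hc, fun _ => ⟨h1, h2⟩⟩
    · exact ⟨1, fun h => absurd h hs⟩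
  choose c hc using h'
  have hbU : IsUnit b.det := isUnit_iff_ne_zero.mpr hb
  have hbb : b * b⁻¹ = 1 := Matrix.mul_nonsing_inv _ hbU
  have hbb' : b⁻¹ * b = 1 := Matrix.nonsing_inv_mul _ hbU
  let sc := Units.map (algebraMap K (Matrix (Fin n) (Fin n) K)).toMonoidHom
  have hsc : ∀ c : Kˣ, (sc c : Matrix (Fin n) (Fin n) K) = (c : K) • 1 := fun c => by
    change algebraMap K (Matrix (Fin n) (Fin n) K) c = _
    rw [Algebra.algebraMap_eq_smul_one]
  clear_value sc
  refine ⟨Fin n, inferInstance, inferInstance, b, b⁻¹, fun g => sc (c g), Fintype.card_fin n, hbb, hbb', ?_, ?_, ?_⟩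
  · intro g h
    rw [hsc, hsc]
    exact ((Commute.one_left _).smul_left _)
  · intro g h
    rw [hsc]
    exact ((Commute.one_left _).smul_left _)
  · intro w hw
    obtain ⟨h1, h2⟩ := hc w hw
    have h0 := (nm_nonneg v _).trans h2
    have e1 : φ w * (sc (c w) : Matrix (Fin n) (Fin n) K) = (c w : K) • φ w := by
      rw [hsc, Matrix.mul_smul, mul_one]
    have hpos : (0 : ℝ) ≤ n ^ 2 * (R₀ + 1) ^ n := by positivity
    constructor
    · rw [e1]
      linarith
    · have e2 : b * (φ w⁻¹ * (((sc (c w))⁻¹ : (Matrix (Fin n) (Fin n) K)ˣ) : Matrix (Fin n) (Fin n) K)) * b⁻¹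
          = (b * ((c w : K) • φ w) * b⁻¹)⁻¹ := by
        symm
        apply Matrix.inv_eq_left_inv
        have hw1 : φ w⁻¹ * φ w = 1 := by rw [← map_mul, inv_mul_cancel, map_one]
        have h3 : φ w⁻¹ * (((sc (c w))⁻¹ : (Matrix (Fin n) (Fin n) K)ˣ) : Matrix (Fin n) (Fin n) K) * ((c w : K) • φ w) = 1 := by
          rw [← map_inv, hsc, Matrix.mul_smul, Matrix.mul_smul, mul_one, Matrix.smul_mul, smul_smul, hw1, Units.mul_inv, one_smul]
        calc _ = b * (φ w⁻¹ * (((sc (c w))⁻¹ : (Matrix (Fin n) (Fin n) K)ˣ) : Matrix (Fin n) (Fin n) K)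
              * (b⁻¹ * b) * ((c w : K) • φ w)) * b⁻¹ := by simp only [mul_assoc]
          _ = 1 := by rw [hbb', mul_one, h3, mul_one, hbb]
      rw [e2]
      have h4 : (b * ((c w : K) • φ w) * b⁻¹).det = 1 := by
        rw [Matrix.det_mul, Matrix.det_mul, h1, mul_one, ← Matrix.det_mul, hbb, Matrix.det_one]
      have h5 := inv_le v h4
      rw [Fintype.card_fin] at h5
      have : (nm v (b * ((c w : K) • φ w) * b⁻¹) + 1) ^ n ≤ (R₀ + 1) ^ n := by
        have := nm_nonneg v (b * ((c w : K) • φ w) * b⁻¹)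
        gcongr
      have : (n : ℝ) ^ 2 * (nm v (b * ((c w : K) • φ w) * b⁻¹) + 1) ^ n ≤ n ^ 2 * (R₀ + 1) ^ n := by gcongr
      linarith

lemma LDAt.weak {n : ℕ} {R R' : ℝ} {k N N' m m' : ℕ} (h : LDAt n R k N m) (hR : R ≤ R') (hN : N ≤ N') (hm : m ≤ m') :
    LDAt n R' k N' m' := by
  intro K _ _ v hv Γ _ S hf h1 hS hN' φ
  obtain ⟨G, hG, f, S', a1, a2, a3, a4, a5, a6, ι, i1, i2, P, P', z, b1, b2, b3, b4, b5, b6⟩ :=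
    h K v hv Γ S hf h1 hS (hN'.mono h1 hN) φ
  exact ⟨G, hG, f, S', a1, a2, a3, a4, a5, a6.trans (pow_mono_set h1 hm), ι, i1, i2, P, P', z, b1, b2, b3, b4, b5,
    fun w hw => ⟨(b6 w hw).1.trans hR, (b6 w hw).2.trans hR⟩⟩

theorem LD (n : ℕ) : 1 ≤ n → ∃ R : ℝ, 0 ≤ R ∧ ∀ k, 1 ≤ k → ∃ N m, 1 ≤ m ∧ LDAt n R k N m := by
  induction n using Nat.strong_induction_on with
  | _ n ih =>
  intro hn
  obtain ⟨R₀, N₀, I₀, hR₀, hN₀, hI₀, hsp⟩ := splitting n hn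
  have ih' : ∀ j, ∃ R : ℝ, 0 ≤ R ∧ (j < n → 1 ≤ j → ∀ k, 1 ≤ k → ∃ N m, 1 ≤ m ∧ LDAt j R k N m) := by
    intro j
    by_cases hj : j < n ∧ 1 ≤ j
    · obtain ⟨R, h0, h⟩ := ih j hj.1 hj.2
      exact ⟨R, h0, fun _ _ => h⟩
    · exact ⟨0, le_rfl, fun h1 h2 => absurd ⟨h1, h2⟩ hj⟩
  choose R hR0 hR using ih'
  have hR' : ∀ j k, ∃ N m, 1 ≤ m ∧ (j < n → 1 ≤ j → 1 ≤ k → LDAt j (R j) k N m) := by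
    intro j k
    by_cases hj : j < n ∧ 1 ≤ j ∧ 1 ≤ k
    · obtain ⟨N, m, h1, h⟩ := hR j hj.1 hj.2.1 k hj.2.2
      exact ⟨N, m, h1, fun _ _ _ => h⟩
    · exact ⟨0, 1, le_rfl, fun h1 h2 h3 => absurd ⟨h1, h2, h3⟩ hj⟩
  choose Nf mf hm1 hLD using hR'
  have hpos : (0 : ℝ) ≤ n ^ 2 * (R₀ + 1) ^ n := by positivity
  have hsum : 0 ≤ ∑ j ∈ Finset.range n, 2 * R j := Finset.sum_nonneg fun j _ => by have := hR0 j; positivity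
  refine ⟨R₀ + n ^ 2 * (R₀ + 1) ^ n + ∑ j ∈ Finset.range n, 2 * R j, by linarith, ?_⟩
  intro k hk
  obtain ⟨M, hM⟩ : ∃ M, M = I₀ * I₀ + I₀ + 1 := ⟨_, rfl⟩
  -- constants for the pair (j, n - j)
  obtain ⟨N1, hN1⟩ : ∃ N1 : ℕ → ℕ, ∀ j, N1 j = Nf j (mf (n - j) k * k) := ⟨_, fun _ => rfl⟩
  obtain ⟨m1, hm1'⟩ : ∃ m1 : ℕ → ℕ, ∀ j, m1 j = mf j (mf (n - j) k * k) := ⟨_, fun _ => rfl⟩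
  obtain ⟨NN, hNN⟩ : ∃ NN, NN = k * N₀ + ∑ j ∈ Finset.range n, M * (N1 j + m1 j * Nf (n - j) k) := ⟨_, rfl⟩
  obtain ⟨mm, hmm⟩ : ∃ mm, mm = 1 + ∑ j ∈ Finset.range n, M * (m1 j * mf (n - j) k) := ⟨_, rfl⟩
  refine ⟨NN, mm, by omega, ?_⟩
  intro K _ _ v hv Γ _ S hf h1 hS hNF φ
  have hNF0 : NoFree (S ^ k) N₀ := NoFree.of_subset (m := k) subset_rfl (hNF.mono h1 (m := k * N₀) (by omega)) rfl
  rcases hsp K v hv Γ (S ^ k) (finite_pow hf k) (Set.one_mem_pow h1) (closure_pow h1 hS hk) hNF0 φ with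
    ⟨b, hb, hA⟩ | ⟨p, hp, hp0, hp1, H, hH0, hHI, hHc⟩
  · obtain ⟨ι, i1, i2, P, P', z, b1, b2, b3, b4, b5, b6⟩ := ld_caseA v (S ^ k) φ b hb R₀ hA
    refine ⟨Γ, inferInstance, MonoidHom.id Γ, S, fun x y h => h, ?_, hf, h1, hS, ?_, ι, i1, i2, P, P', z, b1, b2, b3, b4, b5, ?_⟩
    · rw [MonoidHom.range_eq_top.mpr (fun x => ⟨x, rfl⟩), Subgroup.index_top]; exact one_ne_zero
    · rintro _ ⟨x, hx, rfl⟩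
      exact pow_mono_set h1 (m := 1) (by omega) (by simpa using hx)
    · intro w hw
      obtain ⟨c1, c2⟩ := b6 w hw
      exact ⟨c1.trans (by linarith), c2.trans (by linarith)⟩
  · obtain ⟨n1, n2, σ, hn1, hn2, hn12, hσ⟩ := idem_split p hp hp0 hp1
    have hn2' : n2 = n - n1 := by omega
    have hmem : n1 ∈ Finset.range n := Finset.mem_range.mpr (by omega)
    have hmem2 : n2 ∈ Finset.range n := Finset.mem_range.mpr (by omega)
    have hNle : M * (N1 n1 + m1 n1 * Nf n2 k) ≤ NN := by
      rw [hNN, hn2']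
      have := Finset.single_le_sum (f := fun j => M * (N1 j + m1 j * Nf (n - j) k)) (fun _ _ => Nat.zero_le _) hmem
      exact this.trans (Nat.le_add_left _ _)
    have hmle : M * (m1 n1 * mf n2 k) ≤ mm := by
      rw [hmm, hn2']
      have := Finset.single_le_sum (f := fun j => M * (m1 j * mf (n - j) k)) (fun _ _ => Nat.zero_le _) hmem
      exact this.trans (Nat.le_add_left _ _)
    have hRle : R n1 + R n2 ≤ R₀ + n ^ 2 * (R₀ + 1) ^ n + ∑ j ∈ Finset.range n, 2 * R j := by
      have e1 := Finset.single_le_sum (f := fun j => 2 * R j) (fun j _ => by have := hR0 j; positivity) hmem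
      have e2 := Finset.single_le_sum (f := fun j => 2 * R j) (fun j _ => by have := hR0 j; positivity) hmem2
      linarith
    obtain ⟨T, hTf, hT1, hTg, hTS⟩ := sub_gen hf h1 hS H I₀ hH0 hHI
    rw [← hM] at hTS
    have hNFT : NoFree T (N1 n1 + m1 n1 * Nf n2 k) :=
      NoFree.comap H.subtype H.subtype_injective hTS (hNF.mono h1 hNle) rfl
    have hcomm : ∀ g : H, Commute ((φ.comp H.subtype) g) (σ.V * σ.V') := fun g => by
      rw [hσ]; exact hHc g g.2
    have hmk : 1 ≤ mf n2 k * k := Nat.mul_le_mul (hm1 n2 k) hk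
    obtain ⟨G1, hG1, f1, S1, a1, a2, a3, a4, a5, a6, hfin1⟩ := hLD n1 (mf n2 k * k) (by omega) hn1 hmk K v hv H T hTf hT1 hTg
      (hNFT.mono hT1 (by rw [hN1, hn2']; omega)) (σ.rep1 _ hcomm)
    have hm1e : mf n1 (mf n2 k * k) = m1 n1 := by rw [hm1', hn2']
    rw [hm1e] at a6
    have hNFS1 : NoFree S1 (Nf n2 k) :=
      NoFree.comap f1 a1 a6 (hNFT.mono hT1 (m := m1 n1 * Nf n2 k) (by omega)) rfl
    obtain ⟨G2, hG2, f2, S2, b1, b2, b3, b4, b5, b6, hfin2⟩ := hLD n2 k (by omega) hn2 hk K v hv G1 S1 a3 a4 a5 hNFS1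
      ((σ.rep2 _ hcomm).comp f1)
    refine ⟨G2, hG2, H.subtype.comp (f1.comp f2), S2, H.subtype_injective.comp (a1.comp b1), ?_, b3, b4, b5, ?_, ?_⟩
    · refine index_comp _ _ H.subtype_injective (index_comp _ _ a1 b2 a2) ?_
      rw [Subgroup.range_subtype]; exact hH0
    · rintro _ ⟨x, hx, rfl⟩
      have x1 : f2 x ∈ S1 ^ mf n2 k := b6 ⟨x, hx, rfl⟩
      have x2 : f1 (f2 x) ∈ T ^ (m1 n1 * mf n2 k) := image_pow_le f1 a6 _ ⟨_, x1, rfl⟩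
      have x3 : H.subtype (f1 (f2 x)) ∈ S ^ (M * (m1 n1 * mf n2 k)) := image_pow_le H.subtype hTS _ ⟨_, x2, rfl⟩
      exact pow_mono_set h1 hmle x3
    · have hcomb := ld_combine v σ hn12 (φ.comp (H.subtype.comp (f1.comp f2))) ((σ.rep1 _ hcomm).comp (f1.comp f2))
        ((σ.rep2 _ hcomm).comp (f1.comp f2)) (fun g => σ.rep_eq _ hcomm (f1 (f2 g))) (S2 ^ k) (R n1) (R n2) ?_ hfin2
      · obtain ⟨ι, i1, i2, P, P', z, c1, c2, c3, c4, c5, c6⟩ := hcomb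
        exact ⟨ι, i1, i2, P, P', z, c1, c2, c3, c4, c5, fun w hw => ⟨(c6 w hw).1.trans hRle, (c6 w hw).2.trans hRle⟩⟩
      · obtain ⟨ι, i1, i2, P, P', z, c1, c2, c3, c4, c5, c6⟩ := hfin1
        refine ⟨ι, i1, i2, P, P', fun g => z (f2 g), c1, c2, c3, fun g h => c4 _ _, fun g h => c5 _ _, ?_⟩
        intro w hw
        have := c6 (f2 w) (image_pow_le f2 b6 _ ⟨w, hw, rfl⟩)
        rw [← map_inv] at this
        exact this

end EG

namespace EG

/-- finitely many elements lie in a discretely valued subfield -/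
def DiscV {K : Type} [Field K] (v : AbsoluteValue K ℝ) : Prop :=
  ∀ F : Set K, F.Finite → ∃ (k' : Subfield K) (q : ℝ), 1 < q ∧ F ⊆ k' ∧ ∀ x ∈ k', 1 < v x → q ≤ v x

section
variable {K : Type} [Field K] {v : AbsoluteValue K ℝ} (hna : ∀ x y, v (x + y) ≤ max (v x) (v y))

/-- powers of an ultrametric absolute value -/
def powAbs (hna : ∀ x y, v (x + y) ≤ max (v x) (v y)) (t : ℕ) (ht : t ≠ 0) : AbsoluteValue K ℝ where
  toFun x := v x ^ t
  map_mul' x y := by rw [map_mul, mul_pow]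
  nonneg' x := pow_nonneg (v.nonneg x) t
  eq_zero' x := by rw [pow_eq_zero_iff ht]; exact v.eq_zero
  add_le' x y := by
    rcases max_choice (v x) (v y) with h | h
    · have := hna x y
      rw [h] at this
      exact (pow_le_pow_left₀ (v.nonneg _) this t).trans (le_add_of_nonneg_right (pow_nonneg (v.nonneg y) t))
    · have := hna x y
      rw [h] at this
      exact (pow_le_pow_left₀ (v.nonneg _) this t).trans (le_add_of_nonneg_left (pow_nonneg (v.nonneg x) t))

lemma powAbs_apply (hna : ∀ x y, v (x + y) ≤ max (v x) (v y)) (t : ℕ) (ht : t ≠ 0) (x : K) :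
  powAbs hna t ht x = v x ^ t := rfl

lemma na_sum (hna : ∀ x y, v (x + y) ≤ max (v x) (v y)) {ι : Type*} (s : Finset ι) (f : ι → K) {c : ℝ} (hc : 0 ≤ c)
    (h : ∀ i ∈ s, v (f i) ≤ c) : v (∑ i ∈ s, f i) ≤ c := by
  classical
  induction s using Finset.induction_on with
  | empty => simpa using hc
  | insert a s ha ih =>
    rw [Finset.sum_insert ha]
    exact (hna _ _).trans (max_le (h a (Finset.mem_insert_self _ _)) (ih fun i hi => h i (Finset.mem_insert_of_mem hi)))

/-- the plateau lemma -/
lemma plateau (hna : ∀ x y, v (x + y) ≤ max (v x) (v y)) {n : ℕ} (k' : Subfield K) (q l : ℝ) (hq : 1 < q) (hl : 1 < l) (hlq : l ^ (n + 1) ≤ q)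
    (hk : ∀ x ∈ k', 1 < v x → q ≤ v x) (ν : (Fin n → K) → ℝ) (hν0 : ∀ x, 0 ≤ ν x)
    (hνs : ∀ (a : K) x, ν (a • x) = v a * ν x) (hνa : ∀ x y, ν (x + y) ≤ max (ν x) (ν y)) :
    ∃ r : ℝ, 0 < r ∧ ∀ x : Fin n → K, (∀ i, x i ∈ k') → ν x ≤ l * r → ν x ≤ r := by
  classical
  by_contra hcon
  push Not at hcon
  have h' : ∀ j : Fin (n + 1), ∃ x : Fin n → k', l ^ (j : ℕ) < ν (fun i => (x i : K)) ∧ ν (fun i => (x i : K)) ≤ l ^ ((j : ℕ) + 1) := by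
    intro j
    obtain ⟨x, hx, h1, h2⟩ := hcon (l ^ (j : ℕ)) (by positivity)
    exact ⟨fun i => ⟨x i, hx i⟩, h2, by rw [pow_succ']; exact h1⟩
  choose X hX1 hX2 using h'
  have hli : ¬ LinearIndependent k' X := by
    intro h
    have := h.fintype_card_le_finrank
    simp at this
  obtain ⟨g, hg, i0, hi0⟩ := Fintype.not_linearIndependent_iff.mp hli
  set Y : Fin (n + 1) → (Fin n → K) := fun j i => (X j i : K) with hY
  have hsum : ∑ j, (g j : K) • Y j = 0 := by
    ext i
    have := congrArg (fun f : Fin n → k' => ((f i : k') : K)) hg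
    simp only [Finset.sum_apply, Pi.smul_apply, Pi.zero_apply, smul_eq_mul] at this ⊢
    rw [← Subfield.coe_zero k', ← this]
    push_cast
    rfl
  have hne : ∀ i j : Fin (n + 1), i < j → g i ≠ 0 → g j ≠ 0 → v (g i) * ν (Y i) ≠ v (g j) * ν (Y j) := by
    intro i j hij hgi hgj he
    have hi' : (g i : K) ≠ 0 := by simpa using hgi
    have hj' : (g j : K) ≠ 0 := by simpa using hgj
    have hvi : 0 < v (g i) := v.pos hi'
    have hvj : 0 < v (g j) := v.pos hj'
    have h1 : 1 ≤ l ^ (i : ℕ) := one_le_pow₀ hl.le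
    have h2 : l ^ ((i : ℕ) + 1) ≤ l ^ (j : ℕ) := pow_le_pow_right₀ hl.le hij
    have h3 : l ^ ((j : ℕ) + 1) ≤ l ^ (n + 1) := pow_le_pow_right₀ hl.le (by omega)
    have a1 : l ^ (i : ℕ) < ν (Y i) := hX1 i
    have a2 : ν (Y i) ≤ l ^ ((i : ℕ) + 1) := hX2 i
    have a3 : l ^ (j : ℕ) < ν (Y j) := hX1 j
    have a4 : ν (Y j) ≤ l ^ ((j : ℕ) + 1) := hX2 j
    have hpi : 0 < ν (Y i) := by linarith
    have hq1 : v ((g i : K) / g j) = ν (Y j) / ν (Y i) := by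
      rw [map_div₀, div_eq_div_iff hvj.ne' hpi.ne', he]; ring
    have h5 : 1 < v ((g i : K) / g j) := by
      rw [hq1, one_lt_div hpi]; linarith
    have h6 := hk _ (k'.div_mem (g i).2 (g j).2) h5
    rw [hq1, le_div_iff₀ hpi] at h6
    nlinarith
  obtain ⟨m, -, hm⟩ := Finset.exists_max_image (Finset.univ : Finset (Fin (n + 1))) (fun j => v (g j) * ν (Y j)) ⟨i0, Finset.mem_univ _⟩
  have hpos : ∀ j, 0 < ν (Y j) := fun j => (pow_pos (by linarith) _).trans (hX1 j)
  have hm0 : 0 < v (g m) * ν (Y m) := by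
    refine lt_of_lt_of_le ?_ (hm i0 (Finset.mem_univ _))
    exact mul_pos (v.pos (by simpa using hi0)) (hpos _)
  have hgm : g m ≠ 0 := by
    intro h; rw [h] at hm0; simp at hm0
  have hlt : ∀ j, j ≠ m → v (g j) * ν (Y j) < v (g m) * ν (Y m) := by
    intro j hj
    refine lt_of_le_of_ne (hm j (Finset.mem_univ _)) ?_
    by_cases hgj : g j = 0
    · rw [hgj]; simp only [Subfield.coe_zero, map_zero, zero_mul]; exact hm0.ne
    · rcases lt_or_gt_of_ne hj with h | h
      · exact hne j m h hgj hgm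
      · exact (hne m j h hgm hgj).symm
  have key : ∀ s : Finset (Fin (n + 1)), m ∉ s → ν (∑ j ∈ s, (g j : K) • Y j) < v (g m) * ν (Y m) := by
    intro s
    induction s using Finset.induction_on with
    | empty =>
      intro _
      have : ν 0 = 0 := by have := hνs 0 0; simpa using this
      rw [Finset.sum_empty, this]; exact hm0
    | insert a s ha ih =>
      intro hms
      rw [Finset.sum_insert ha]
      refine lt_of_le_of_lt (hνa _ _) (max_lt ?_ (ih fun h => hms (Finset.mem_insert_of_mem h)))
      rw [hνs]
      exact hlt a fun h => hms (h ▸ Finset.mem_insert_self _ _)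
  have h1 := key (Finset.univ.erase m) (by simp)
  have h2 := Finset.add_sum_erase Finset.univ (fun j => (g j : K) • Y j) (Finset.mem_univ m)
  rw [hsum] at h2
  have h3 : ∑ j ∈ Finset.univ.erase m, (g j : K) • Y j = (-(g m : K)) • Y m := by
    rw [neg_smul]; exact eq_neg_of_add_eq_zero_right h2
  rw [h3, hνs, v.map_neg] at h1
  exact lt_irrefl _ h1

end

end EG

namespace EG

lemma mulVec_sum {K : Type*} [Field K] {n : ℕ} (A : Matrix (Fin n) (Fin n) K) (x : Fin n → K) (i : Fin n) :
    (A *ᵥ x) i = ∑ j, A i j * x j := rfl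

lemma na_norm {K : Type} [Field K] {v : AbsoluteValue K ℝ} (hna : ∀ x y, v (x + y) ≤ max (v x) (v y)) {n : ℕ} (hn : 1 ≤ n)
    (b b' : Matrix (Fin n) (Fin n) K) (hbb : b' * b = 1) :
    ∃ ν : (Fin n → K) → ℝ, (∀ x, 0 ≤ ν x) ∧ (∀ (a : K) x, ν (a • x) = v a * ν x) ∧ (∀ x y, ν (x + y) ≤ max (ν x) (ν y)) ∧
      (∀ (A : Matrix (Fin n) (Fin n) K) (l : ℝ), 0 ≤ l → (∀ i j, v ((b * A * b') i j) ≤ l) → ∀ x, ν (A *ᵥ x) ≤ l * ν x) ∧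
      ∃ C : ℝ, 0 ≤ C ∧ ∀ x i, v (x i) ≤ C * ν x := by
  have hne : (Finset.univ : Finset (Fin n)).Nonempty := ⟨⟨0, by omega⟩, Finset.mem_univ _⟩
  have h : ∀ x : Fin n → K, ∃ r : ℝ, (∀ i, v ((b *ᵥ x) i) ≤ r) ∧ ∃ i, r = v ((b *ᵥ x) i) := by
    intro x
    obtain ⟨m, -, hm⟩ := Finset.exists_max_image Finset.univ (fun i => v ((b *ᵥ x) i)) hne
    exact ⟨_, fun i => hm i (Finset.mem_univ _), m, rfl⟩
  choose ν h1 h2 using h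
  have h0 : ∀ x, 0 ≤ ν x := fun x => by obtain ⟨i, hi⟩ := h2 x; rw [hi]; exact v.nonneg _
  refine ⟨ν, h0, ?_, ?_, ?_, ?_⟩
  · intro a x
    apply le_antisymm
    · obtain ⟨i, hi⟩ := h2 (a • x)
      rw [hi, Matrix.mulVec_smul, Pi.smul_apply, smul_eq_mul, map_mul]
      exact mul_le_mul_of_nonneg_left (h1 x i) (v.nonneg _)
    · obtain ⟨i, hi⟩ := h2 x
      rw [hi, ← map_mul]
      have := h1 (a • x) i
      rwa [Matrix.mulVec_smul, Pi.smul_apply, smul_eq_mul] at this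
  · intro x y
    obtain ⟨i, hi⟩ := h2 (x + y)
    rw [hi, Matrix.mulVec_add, Pi.add_apply]
    exact (hna _ _).trans (max_le_max (h1 x i) (h1 y i))
  · intro A l hl hA x
    obtain ⟨i, hi⟩ := h2 (A *ᵥ x)
    have e : b *ᵥ (A *ᵥ x) = (b * A * b') *ᵥ (b *ᵥ x) := by
      rw [Matrix.mulVec_mulVec, Matrix.mulVec_mulVec, mul_assoc _ b', hbb, mul_one]
    rw [hi, e]
    rw [mulVec_sum]
    refine na_sum hna _ _ (mul_nonneg hl (h0 x)) fun j _ => ?_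
    rw [map_mul]
    exact mul_le_mul (hA i j) (h1 x j) (v.nonneg _) hl
  · refine ⟨nm v b', nm_nonneg v _, fun x i => ?_⟩
    have e : x = b' *ᵥ (b *ᵥ x) := by rw [Matrix.mulVec_mulVec, hbb, Matrix.one_mulVec]
    conv_lhs => rw [e]
    rw [mulVec_sum]
    refine na_sum hna _ _ (mul_nonneg (nm_nonneg v _) (h0 x)) fun j _ => ?_
    rw [map_mul]
    exact mul_le_mul (entry_le v _ i j) (h1 x j) (v.nonneg _) (nm_nonneg v _)

lemma na_caseA {K : Type} [Field K] [IsAlgClosed K] {v : AbsoluteValue K ℝ} (hna : ∀ x y, v (x + y) ≤ max (v x) (v y))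
    (hv : v.IsNontrivial) (hdisc : DiscV v) {n : ℕ} (hn : 1 ≤ n) {Γ : Type} [Group Γ] (S : Set Γ) (hSf : S.Finite)
    (hS : Subgroup.closure S = ⊤) (φ : Γ →* Matrix (Fin n) (Fin n) K) (R₀ : ℝ) (hR₀ : 1 ≤ R₀)
    (h : ∀ (t : ℕ) (ht : t ≠ 0), ∃ b : Matrix (Fin n) (Fin n) K, b.det ≠ 0 ∧ ∀ s ∈ S, ∃ c : K, c ≠ 0 ∧ (c • φ s).det = 1 ∧
      nm (powAbs hna t ht) (b * (c • φ s) * b⁻¹) ≤ R₀) :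
    ∃ C : ℝ, ∀ γ, v (φ γ).det = 1 → nm v (φ γ) ≤ C := by
  choose c hc hcdet using fun s : Γ => exists_det_one hn (φ s) (det_rep_ne φ s)
  obtain ⟨M, hM⟩ : ∃ M : Γ → Matrix (Fin n) (Fin n) K, ∀ s, M s = c s • φ s := ⟨_, fun _ => rfl⟩
  have hMdet : ∀ s, (M s).det = 1 := fun s => by rw [hM]; exact hcdet s
  obtain ⟨a, ha⟩ := hv.exists_abv_gt_one
  obtain ⟨k', q, hq, hF, hk⟩ := hdisc ((⋃ s ∈ S, ⋃ i, ⋃ j, {M s i j, (M s)⁻¹ i j}) ∪ {a}) (by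
    refine Set.Finite.union ?_ (Set.finite_singleton _)
    refine hSf.biUnion fun s _ => Set.finite_iUnion fun i => Set.finite_iUnion fun j => ?_
    exact (Set.finite_singleton _).insert _)
  have hak : a ∈ k' := hF (Or.inr rfl)
  have hMk : ∀ s ∈ S, ∀ i j, M s i j ∈ k' ∧ (M s)⁻¹ i j ∈ k' := by
    intro s hs i j
    constructor
    · apply hF; left
      simp only [Set.mem_iUnion]
      exact ⟨s, hs, i, j, Or.inl rfl⟩
    · apply hF; left
      simp only [Set.mem_iUnion]
      exact ⟨s, hs, i, j, Or.inr rfl⟩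
  obtain ⟨ρ, hρ⟩ : ∃ ρ : ℝ, ρ = R₀ + n ^ 2 * (R₀ + 1) ^ n := ⟨_, rfl⟩
  have hpos : (0 : ℝ) ≤ n ^ 2 * (R₀ + 1) ^ n := by positivity
  obtain ⟨l, hl1, hlq⟩ : ∃ l : ℝ, 1 < l ∧ l ^ (n + 1) ≤ q := by
    refine ⟨q ^ (((n + 1 : ℕ) : ℝ)⁻¹), Real.one_lt_rpow hq (by positivity), ?_⟩
    rw [Real.rpow_inv_natCast_pow (by linarith) (by omega)]
  obtain ⟨t, ht⟩ := pow_unbounded_of_one_lt ρ hl1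
  have ht0 : t ≠ 0 := by
    rintro rfl
    rw [pow_zero] at ht
    linarith
  obtain ⟨b, hb, hbs⟩ := h t ht0
  have hbU : IsUnit b.det := isUnit_iff_ne_zero.mpr hb
  have hbb : b * b⁻¹ = 1 := Matrix.mul_nonsing_inv _ hbU
  have hbb' : b⁻¹ * b = 1 := Matrix.nonsing_inv_mul _ hbU
  obtain ⟨w, hw⟩ : ∃ w, w = powAbs hna t ht0 := ⟨_, rfl⟩
  have hwv : ∀ x, w x = v x ^ t := fun x => by rw [hw]; rfl
  rw [← hw] at hbs
  have hMs : ∀ s ∈ S, nm w (b * M s * b⁻¹) ≤ R₀ := by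
    intro s hs
    obtain ⟨c', hc', hd', hn'⟩ := hbs s hs
    have e : w (c s) = w c' := by
      have h1 := hcdet s
      rw [Matrix.det_smul, Fintype.card_fin] at h1 hd'
      have h2 := congrArg w (h1.trans hd'.symm)
      rw [map_mul, map_mul, map_pow, map_pow] at h2
      have h3 : w (φ s).det ≠ 0 := (w.pos (det_rep_ne φ s)).ne'
      exact (pow_left_inj₀ (w.nonneg _) (w.nonneg _) (by omega)).mp (mul_right_cancel₀ h3 h2)
    rw [hM, Matrix.mul_smul, Matrix.smul_mul, nm_smul, e]
    rwa [Matrix.mul_smul, Matrix.smul_mul, nm_smul] at hn'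
  have hent : ∀ A : Matrix (Fin n) (Fin n) K, nm w A ≤ ρ → ∀ i j, v (A i j) ≤ l := by
    intro A hA i j
    have h1 := entry_le w A i j
    rw [hwv] at h1
    exact (pow_le_pow_iff_left₀ (v.nonneg _) (by linarith) ht0).mp (by linarith)
  have hMs1 : ∀ s ∈ S, ∀ i j, v ((b * M s * b⁻¹) i j) ≤ l := fun s hs => hent _ ((hMs s hs).trans (by linarith))
  have hMs2 : ∀ s ∈ S, ∀ i j, v ((b * (M s)⁻¹ * b⁻¹) i j) ≤ l := by
    intro s hs
    apply hent
    have e2 : b * (M s)⁻¹ * b⁻¹ = (b * M s * b⁻¹)⁻¹ := by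
      symm
      apply Matrix.inv_eq_left_inv
      have hMM : (M s)⁻¹ * M s = 1 := Matrix.nonsing_inv_mul _ (by rw [hMdet]; exact isUnit_one)
      calc _ = b * ((M s)⁻¹ * (b⁻¹ * b) * M s) * b⁻¹ := by simp only [mul_assoc]
        _ = 1 := by rw [hbb', mul_one, hMM, mul_one, hbb]
    rw [e2]
    have h4 : (b * M s * b⁻¹).det = 1 := by
      rw [Matrix.det_mul, Matrix.det_mul, hMdet, mul_one, ← Matrix.det_mul, hbb, Matrix.det_one]
    have h5 := inv_le w h4
    rw [Fintype.card_fin] at h5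
    have h6 : (nm w (b * M s * b⁻¹) + 1) ^ n ≤ (R₀ + 1) ^ n := by
      have := nm_nonneg w (b * M s * b⁻¹)
      have := hMs s hs
      gcongr
    have : (n : ℝ) ^ 2 * (nm w (b * M s * b⁻¹) + 1) ^ n ≤ n ^ 2 * (R₀ + 1) ^ n := by gcongr
    linarith
  obtain ⟨ν, hν0, hνs, hνa, hνA, C, hC0, hC⟩ := na_norm hna hn b b⁻¹ hbb'
  obtain ⟨r, hr, hplat⟩ := plateau hna k' q l hq hl1 hlq hk ν hν0 hνs hνa
  obtain ⟨Λ, hΛ⟩ : ∃ Λ : Set (Fin n → K), Λ = {x | (∀ i, x i ∈ k') ∧ ν x ≤ r} := ⟨_, rfl⟩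
  have hstep : ∀ A : Matrix (Fin n) (Fin n) K, (∀ i j, A i j ∈ k') → (∀ i j, v ((b * A * b⁻¹) i j) ≤ l) → ∀ x ∈ Λ, A *ᵥ x ∈ Λ := by
    intro A hAk hAl x hx
    rw [hΛ, Set.mem_ofPred_eq] at hx ⊢
    have hk1 : ∀ i, (A *ᵥ x) i ∈ k' := fun i => by
      rw [mulVec_sum]
      exact k'.sum_mem fun j _ => k'.mul_mem (hAk i j) (hx.1 j)
    refine ⟨hk1, hplat _ hk1 ((hνA A l (by linarith) hAl x).trans ?_)⟩
    exact mul_le_mul_of_nonneg_left hx.2 (by linarith)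
  have hP : ∀ γ : Γ, ∃ (c : K) (W : Matrix (Fin n) (Fin n) K), c ≠ 0 ∧ φ γ = c • W ∧ W.det = 1 ∧ ∀ x ∈ Λ, W *ᵥ x ∈ Λ := by
    intro γ
    have hγ : γ ∈ Subgroup.closure S := by rw [hS]; trivial
    induction hγ using Subgroup.closure_induction'' with
    | mem s hs =>
      refine ⟨(c s)⁻¹, M s, inv_ne_zero (hc s), ?_, hMdet s, hstep _ (fun i j => (hMk s hs i j).1) (hMs1 s hs)⟩
      rw [hM, smul_smul, inv_mul_cancel₀ (hc s), one_smul]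
    | inv_mem s hs =>
      refine ⟨c s, (M s)⁻¹, hc s, ?_, ?_, hstep _ (fun i j => (hMk s hs i j).2) (hMs2 s hs)⟩
      · have hMM : M s * (M s)⁻¹ = 1 := Matrix.mul_nonsing_inv _ (by rw [hMdet]; exact isUnit_one)
        calc φ s⁻¹ = φ s⁻¹ * (M s * (M s)⁻¹) := by rw [hMM, mul_one]
          _ = (φ s⁻¹ * φ s) * (c s • (M s)⁻¹) := by rw [hM s, Matrix.smul_mul, ← hM s, Matrix.mul_smul, Matrix.mul_smul, mul_assoc]
          _ = _ := by rw [← map_mul, inv_mul_cancel, map_one, one_mul]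
      · rw [Matrix.det_nonsing_inv, hMdet, Ring.inverse_one]
    | one => exact ⟨1, 1, one_ne_zero, by simp, by simp, fun x hx => by simpa using hx⟩
    | mul x y hx hy ihx ihy =>
      obtain ⟨c1, W1, a1, a2, a3, a4⟩ := ihx
      obtain ⟨c2, W2, b1, b2, b3, b4⟩ := ihy
      refine ⟨c1 * c2, W1 * W2, mul_ne_zero a1 b1, ?_, ?_, ?_⟩
      · rw [map_mul, a2, b2, Matrix.smul_mul, Matrix.mul_smul, smul_smul]
      · rw [Matrix.det_mul, a3, b3, one_mul]
      · intro x hx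
        rw [← Matrix.mulVec_mulVec]
        exact a4 _ (b4 _ hx)
  -- basis vectors
  have hbas : ∀ j : Fin n, ∃ m : ℕ, (a⁻¹ ^ m) • (Pi.single j 1 : Fin n → K) ∈ Λ := by
    intro j
    obtain ⟨m, hm⟩ := pow_unbounded_of_one_lt (ν (Pi.single j 1) / r) ha
    refine ⟨m, ?_⟩
    rw [hΛ, Set.mem_ofPred_eq]
    constructor
    · intro i
      rw [Pi.smul_apply, smul_eq_mul]
      refine k'.mul_mem (pow_mem (k'.inv_mem hak) m) ?_
      by_cases hij : i = j
      · subst hij; rw [Pi.single_eq_same]; exact k'.one_mem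
      · rw [Pi.single_eq_of_ne hij]; exact k'.zero_mem
    · rw [hνs, map_pow, map_inv₀, inv_pow]
      have : 0 < v a ^ m := by positivity
      rw [inv_mul_le_iff₀ this]
      rw [div_lt_iff₀ hr] at hm
      exact hm.le
  choose m hm using hbas
  have hva : 0 ≤ v a := by linarith
  refine ⟨∑ i : Fin n, ∑ j : Fin n, v a ^ m j * (C * r), ?_⟩
  intro γ hγ
  obtain ⟨c0, W, hc0, hφ, hW, hWΛ⟩ := hP γ
  have hvc : v c0 = 1 := by
    rw [hφ, Matrix.det_smul, hW, mul_one, map_pow, Fintype.card_fin] at hγ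
    exact (pow_eq_one_iff_of_nonneg (v.nonneg _) (by omega)).mp hγ
  rw [hφ, nm_smul, hvc, one_mul]
  unfold nm
  refine Finset.sum_le_sum fun i _ => Finset.sum_le_sum fun j _ => ?_
  have h1 := hWΛ _ (hm j)
  rw [hΛ, Set.mem_ofPred_eq] at h1
  have h2 := hC (W *ᵥ ((a⁻¹ ^ m j) • (Pi.single j 1 : Fin n → K))) i
  rw [Matrix.mulVec_smul, Pi.smul_apply, smul_eq_mul, Matrix.mulVec_single_one, map_mul, map_pow, map_inv₀, inv_pow,
    inv_mul_le_iff₀ (by positivity)] at h2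
  refine h2.trans ?_
  have h3 := h1.2
  rw [Matrix.mulVec_smul, Matrix.mulVec_single_one] at h3
  gcongr

end EG

namespace EG

/-- The ultrametric statement in dimension `n`. -/
def NAAt (n N I : ℕ) : Prop :=
  ∀ (K : Type) [Field K] [IsAlgClosed K] (v : AbsoluteValue K ℝ), (∀ x y, v (x + y) ≤ max (v x) (v y)) → v.IsNontrivial →
    DiscV v → ∀ (Γ : Type) [Group Γ] (S : Set Γ), S.Finite → (1 : Γ) ∈ S → Subgroup.closure S = ⊤ → NoFree S N →
    ∀ φ : Γ →* Matrix (Fin n) (Fin n) K, ∃ H T : Subgroup Γ, H.index ≠ 0 ∧ H.index ≤ I ∧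
      (∀ x ∈ H, ∀ y ∈ H, x * y * x⁻¹ * y⁻¹ ∈ T) ∧ ∃ C : ℝ, ∀ γ ∈ T, nm v (φ γ) ≤ C

theorem NA (n : ℕ) : 1 ≤ n → ∃ N I, NAAt n N I := by
  induction n using Nat.strong_induction_on with
  | _ n ih =>
  intro hn
  obtain ⟨R₀, N₀, I₀, hR₀, hN₀, hI₀, hsp⟩ := splitting n hn
  have ih' : ∀ j, ∃ N I, (j < n → 1 ≤ j → NAAt j N I) := by
    intro j
    by_cases hj : j < n ∧ 1 ≤ j
    · obtain ⟨N, I, h⟩ := ih j hj.1 hj.2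
      exact ⟨N, I, fun _ _ => h⟩
    · exact ⟨0, 0, fun h1 h2 => absurd ⟨h1, h2⟩ hj⟩
  choose Nf If hNA using ih'
  obtain ⟨M, hM⟩ : ∃ M, M = I₀ * I₀ + I₀ + 1 := ⟨_, rfl⟩
  obtain ⟨NN, hNN⟩ : ∃ NN, NN = N₀ + ∑ j ∈ Finset.range n, M * Nf j := ⟨_, rfl⟩
  obtain ⟨II, hII⟩ : ∃ II, II = 1 + ∑ j ∈ Finset.range n, If j * If (n - j) * I₀ := ⟨_, rfl⟩
  refine ⟨NN, II, ?_⟩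
  intro K _ _ v hna hv hdisc Γ _ S hf h1 hS hNF φ
  by_cases hA : ∀ (t : ℕ) (ht : t ≠ 0), ∃ b : Matrix (Fin n) (Fin n) K, b.det ≠ 0 ∧ ∀ s ∈ S, ∃ c : K, c ≠ 0 ∧ (c • φ s).det = 1 ∧
      nm (powAbs hna t ht) (b * (c • φ s) * b⁻¹) ≤ R₀
  · obtain ⟨C, hC⟩ := na_caseA hna hv hdisc hn S hf hS φ R₀ hR₀ hA
    let T : Subgroup Γ := MonoidHom.ker ((v : K →* ℝ).comp ((Matrix.detMonoidHom).comp φ))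
    have hT : ∀ γ, γ ∈ T ↔ v (φ γ).det = 1 := fun γ => Iff.rfl
    refine ⟨⊤, T, by simp, by rw [Subgroup.index_top, hII]; omega, ?_, C, fun γ hγ => hC γ ((hT γ).mp hγ)⟩
    intro x _ y _
    rw [hT]
    have e : ∀ z : Γ, v (φ z).det * v (φ z⁻¹).det = 1 := fun z => by
      rw [← map_mul, ← Matrix.det_mul, ← map_mul, mul_inv_cancel, map_one, Matrix.det_one, map_one]
    rw [map_mul, map_mul, map_mul, Matrix.det_mul, Matrix.det_mul, Matrix.det_mul, map_mul, map_mul, map_mul]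
    calc _ = (v (φ x).det * v (φ x⁻¹).det) * (v (φ y).det * v (φ y⁻¹).det) := by ring
      _ = 1 := by rw [e, e, one_mul]
  · push Not at hA
    obtain ⟨t, ht, hA⟩ := hA
    have hvt : (powAbs hna t ht).IsNontrivial := by
      obtain ⟨a, ha⟩ := hv.exists_abv_gt_one
      refine ⟨a, ?_, ?_⟩
      · rintro rfl; rw [map_zero] at ha; linarith
      · rw [powAbs_apply]; exact (one_lt_pow₀ ha ht).ne'
    rcases hsp K (powAbs hna t ht) hvt Γ S hf h1 hS (hNF.mono h1 (by omega)) φ with ⟨b, hb, hb'⟩ | ⟨p, hp, hp0, hp1, H, hH0, hHI, hHc⟩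
    · exfalso
      obtain ⟨s, hs, hs'⟩ := hA b hb
      obtain ⟨c, h2, h3, h4⟩ := hb' s hs
      exact absurd h4 (not_le.mpr (hs' c h2 h3))
    obtain ⟨n1, n2, σ, hn1, hn2, hn12, hσ⟩ := idem_split p hp hp0 hp1
    have hn2' : n2 = n - n1 := by omega
    have hmem : n1 ∈ Finset.range n := Finset.mem_range.mpr (by omega)
    have hmem2 : n2 ∈ Finset.range n := Finset.mem_range.mpr (by omega)
    have hN1 : M * Nf n1 ≤ NN := by
      rw [hNN]
      have := Finset.single_le_sum (f := fun j => M * Nf j) (fun _ _ => Nat.zero_le _) hmem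
      exact this.trans (Nat.le_add_left _ _)
    have hN2 : M * Nf n2 ≤ NN := by
      rw [hNN]
      have := Finset.single_le_sum (f := fun j => M * Nf j) (fun _ _ => Nat.zero_le _) hmem2
      exact this.trans (Nat.le_add_left _ _)
    have hIle : If n1 * If n2 * I₀ ≤ II := by
      rw [hII, hn2']
      have := Finset.single_le_sum (f := fun j => If j * If (n - j) * I₀) (fun _ _ => Nat.zero_le _) hmem
      exact this.trans (Nat.le_add_left _ _)
    obtain ⟨T, hTf, hT1, hTg, hTS⟩ := sub_gen hf h1 hS H I₀ hH0 hHI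
    rw [← hM] at hTS
    have hcomm : ∀ g : H, Commute ((φ.comp H.subtype) g) (σ.V * σ.V') := fun g => by
      rw [hσ]; exact hHc g g.2
    obtain ⟨H1, T1, a1, a2, a3, C1, hC1⟩ := hNA n1 (by omega) hn1 K v hna hv hdisc H T hTf hT1 hTg
      (NoFree.comap H.subtype H.subtype_injective hTS (hNF.mono h1 hN1) rfl) (σ.rep1 _ hcomm)
    obtain ⟨H2, T2, b1, b2, b3, C2, hC2⟩ := hNA n2 (by omega) hn2 K v hna hv hdisc H T hTf hT1 hTg
      (NoFree.comap H.subtype H.subtype_injective hTS (hNF.mono h1 hN2) rfl) (σ.rep2 _ hcomm)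
    have hidx : ((H1 ⊓ H2).map H.subtype).index = (H1 ⊓ H2).index * H.index := by
      rw [Subgroup.index_map, Subgroup.ker_subtype, sup_bot_eq, Subgroup.range_subtype]
    refine ⟨(H1 ⊓ H2).map H.subtype, (T1 ⊓ T2).map H.subtype, ?_, ?_, ?_, ?_⟩
    · rw [hidx]
      exact mul_ne_zero (Subgroup.index_inf_ne_zero a1 b1) hH0
    · rw [hidx]
      refine le_trans ?_ hIle
      exact Nat.mul_le_mul (Subgroup.index_inf_le.trans (Nat.mul_le_mul a2 b2)) hHI
    · rintro _ ⟨x, hx, rfl⟩ _ ⟨y, hy, rfl⟩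
      exact ⟨x * y * x⁻¹ * y⁻¹, ⟨a3 x hx.1 y hy.1, b3 x hx.2 y hy.2⟩, by simp⟩
    · refine ⟨nm v σ.V * C1 * nm v σ.V' + nm v σ.U * C2 * nm v σ.U', ?_⟩
      rintro _ ⟨g, hg, rfl⟩
      have := σ.rep_eq _ hcomm g
      rw [MonoidHom.comp_apply] at this
      rw [this, Split2.J_apply]
      refine (nm_add_le v _ _).trans (add_le_add ?_ ?_)
      · exact nm_mul_le_of v (nm_mul_le_of v le_rfl (hC1 g hg.1)) le_rfl
      · exact nm_mul_le_of v (nm_mul_le_of v le_rfl (hC2 g hg.2)) le_rfl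

end EG

namespace EG

theorem local_gap (k : Type) [NontriviallyNormedField k] [LocallyCompactSpace k] [IsUltrametricDist k] :
    ∃ q : ℝ, 1 < q ∧ ∀ x : k, 1 < ‖x‖ → q ≤ ‖x‖ := by
  have : ProperSpace k := ProperSpace.of_locallyCompactSpace k
  obtain ⟨A, hA⟩ : ∃ A : Set k, A = Metric.closedBall 0 2 \ Metric.closedBall 0 1 := ⟨_, rfl⟩
  have hc : IsCompact A := by
    rw [hA]
    exact (isCompact_closedBall _ _).diff (IsUltrametricDist.isOpen_closedBall _ one_ne_zero)
  have hmem : ∀ x, x ∈ A ↔ ‖x‖ ≤ 2 ∧ 1 < ‖x‖ := by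
    intro x; rw [hA]; simp
  by_cases hne : A.Nonempty
  · obtain ⟨x0, hx0, hmin⟩ := hc.exists_isMinOn hne continuous_norm.continuousOn
    have h0 := (hmem x0).1 hx0
    refine ⟨‖x0‖, h0.2, fun x hx => ?_⟩
    by_cases h2 : ‖x‖ ≤ 2
    · exact hmin ((hmem x).2 ⟨h2, hx⟩)
    · push Not at h2
      exact h0.1.trans h2.le
  · refine ⟨2, by norm_num, fun x hx => ?_⟩
    by_contra h
    push Not at h
    exact hne ⟨x, (hmem x).2 ⟨h.le, hx⟩⟩

section
variable (k : Type) [NontriviallyNormedField k] [CompleteSpace k] [IsUltrametricDist k]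

/-- The extension of the norm to the algebraic closure. -/
noncomputable def specAbs : AbsoluteValue (AlgebraicClosure k) ℝ where
  toFun x := spectralNorm k (AlgebraicClosure k) x
  map_mul' x y := map_mul (spectralMulAlgNorm k (AlgebraicClosure k)) x y
  nonneg' x := spectralNorm_nonneg x
  eq_zero' x := ⟨fun h => eq_zero_of_map_spectralNorm_eq_zero h (Algebra.IsAlgebraic.isAlgebraic x),
    fun h => by rw [h]; exact spectralNorm_zero⟩
  add_le' x y := map_add_le_add (spectralMulAlgNorm k (AlgebraicClosure k)) x y

theorem specAbs_apply (x : AlgebraicClosure k) : specAbs k x = spectralNorm k (AlgebraicClosure k) x := rfl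

theorem specAbs_algebraMap (x : k) : specAbs k (algebraMap k _ x) = ‖x‖ := spectralNorm_extends x

theorem specAbs_na (x y : AlgebraicClosure k) : specAbs k (x + y) ≤ max (specAbs k x) (specAbs k y) :=
  isNonarchimedean_spectralNorm x y

theorem specAbs_nontrivial : (specAbs k).IsNontrivial := by
  obtain ⟨x, hx⟩ := NormedField.exists_one_lt_norm k
  refine ⟨algebraMap k _ x, ?_, ?_⟩
  · intro h
    have := specAbs_algebraMap k x
    rw [h, map_zero] at this
    linarith
  · rw [specAbs_algebraMap]; exact hx.ne'

theorem specAbs_disc [LocallyCompactSpace k] : DiscV (specAbs k) := by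
  intro F hF
  obtain ⟨q, hq, hq'⟩ := local_gap k
  have : Finite F := hF
  have hfd : FiniteDimensional k (IntermediateField.adjoin k F) := by
    refine IntermediateField.finiteDimensional_adjoin fun x _ => ?_
    exact (Algebra.IsAlgebraic.isAlgebraic x).isIntegral
  obtain ⟨D, hD⟩ : ∃ D, D = Module.finrank k (IntermediateField.adjoin k F) := ⟨_, rfl⟩
  have hD0 : 0 < D := by rw [hD]; exact Module.finrank_pos
  have hDR : (0:ℝ) < D := by exact_mod_cast hD0
  refine ⟨(IntermediateField.adjoin k F).toSubfield, q ^ (1 / D : ℝ), ?_, ?_, ?_⟩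
  · exact Real.one_lt_rpow hq (by positivity)
  · exact IntermediateField.subset_adjoin k F
  · intro x hx hvx
    have hx' : x ∈ IntermediateField.adjoin k F := hx
    have hIntegral : IsIntegral k x := (Algebra.IsAlgebraic.isAlgebraic x).isIntegral
    have hn0 : 0 < (minpoly k x).natDegree := minpoly.natDegree_pos hIntegral
    have hnD : (minpoly k x).natDegree ≤ D := by
      rw [hD]
      have := minpoly.natDegree_le (A := k) (⟨x, hx'⟩ : IntermediateField.adjoin k F)
      rwa [IntermediateField.minpoly_eq] at this
    have hnR : (0:ℝ) < (minpoly k x).natDegree := by exact_mod_cast hn0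
    have hnDR : ((minpoly k x).natDegree : ℝ) ≤ D := by exact_mod_cast hnD
    have e := spectralNorm.spectralNorm_eq_norm_coeff_zero_rpow k (AlgebraicClosure k) x
    rw [specAbs_apply, e] at hvx ⊢
    have h1 : 1 < ‖(minpoly k x).coeff 0‖ := by
      by_contra h
      push Not at h
      exact absurd (Real.rpow_le_one (norm_nonneg _) h (by positivity : (0:ℝ) ≤ 1 / (minpoly k x).natDegree))
        (not_le.mpr hvx)
    have h2 := hq' _ h1
    calc q ^ (1 / D : ℝ) ≤ q ^ (1 / (minpoly k x).natDegree : ℝ) :=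
          Real.rpow_le_rpow_of_exponent_le hq.le (one_div_le_one_div_of_le hnR hnDR)
      _ ≤ _ := Real.rpow_le_rpow (by linarith) h2 (by positivity)
end

/-- Places over local fields. -/
theorem NAAt.local {n N I : ℕ} (h : NAAt n N I) (k : Type) [NontriviallyNormedField k] [CompleteSpace k]
    [LocallyCompactSpace k] (hk : ∀ x y : k, ‖x + y‖ ≤ max ‖x‖ ‖y‖) (Γ : Type) [Group Γ] (S : Set Γ)
    (hf : S.Finite) (h1 : (1 : Γ) ∈ S) (hS : Subgroup.closure S = ⊤) (hN : NoFree S N)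
    (ρ : Γ →* GL (Fin n) k) :
    ∃ H T : Subgroup Γ, H.index ≠ 0 ∧ H.index ≤ I ∧ (∀ x ∈ H, ∀ y ∈ H, x * y * x⁻¹ * y⁻¹ ∈ T) ∧
      ∃ C : ℝ, ∀ γ ∈ T, ∀ i j, ‖(ρ γ : Matrix (Fin n) (Fin n) k) i j‖ ≤ C := by
  have : IsUltrametricDist k := IsUltrametricDist.isUltrametricDist_of_forall_norm_add_le_max_norm hk
  obtain ⟨H, T, a, b, c, C, hC⟩ := h (AlgebraicClosure k) (specAbs k) (specAbs_na k) (specAbs_nontrivial k)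
    (specAbs_disc k) Γ S hf h1 hS hN
    (((algebraMap k (AlgebraicClosure k)).mapMatrix.toMonoidHom.comp (Units.coeHom _)).comp ρ)
  refine ⟨H, T, a, b, c, C, fun γ hγ i j => ?_⟩
  have := (entry_le (specAbs k) _ i j).trans (hC γ hγ)
  have e : specAbs k ((((algebraMap k (AlgebraicClosure k)).mapMatrix.toMonoidHom.comp (Units.coeHom _)).comp ρ) γ i j)
     = ‖(ρ γ : Matrix (Fin n) (Fin n) k) i j‖ := by
    rw [← specAbs_algebraMap]; rfl
  rwa [e] at this

end EG

namespace EG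

/-- Left-normed commutators. -/
def LN {G : Type*} [Group G] (Y : Set G) : ℕ → Set G
  | 0 => Y
  | (k+1) => {g | ∃ y ∈ Y, ∃ c ∈ LN Y k, g = y * c * y⁻¹ * c⁻¹}

section
variable {V : Type} [AddCommGroup V] [Module ℂ V] {Γ : Type} [Group Γ]

theorem rho_inv_apply (ρ : Γ →* Module.End ℂ V) (g : Γ) (w : V) : ρ g⁻¹ (ρ g w) = w := by
  rw [← Module.End.mul_apply, ← map_mul, inv_mul_cancel, map_one, Module.End.one_apply]

theorem rho_apply_inv (ρ : Γ →* Module.End ℂ V) (g : Γ) (w : V) : ρ g (ρ g⁻¹ w) = w := by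
  rw [← Module.End.mul_apply, ← map_mul, mul_inv_cancel, map_one, Module.End.one_apply]

theorem rho_inj (ρ : Γ →* Module.End ℂ V) (g : Γ) : Function.Injective (ρ g) :=
  Function.LeftInverse.injective (rho_inv_apply ρ g)

theorem pres_inv [FiniteDimensional ℂ V] (ρ : Γ →* Module.End ℂ V) (g : Γ) (W : Submodule ℂ V)
    (h : ∀ w ∈ W, ρ g w ∈ W) : ∀ w ∈ W, ρ g⁻¹ w ∈ W := by
  have hle : W.map (ρ g) ≤ W := by
    rintro _ ⟨w, hw, rfl⟩; exact h w hw
  have he : W.map (ρ g) = W :=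
    Submodule.eq_of_le_of_finrank_eq hle (Submodule.equivMapOfInjective (ρ g) (rho_inj ρ g) W).finrank_eq.symm
  intro w hw
  rw [← he] at hw
  obtain ⟨w', hw', rfl⟩ := hw
  rw [rho_inv_apply]; exact hw'

theorem inv_of_gen [FiniteDimensional ℂ V] (ρ : Γ →* Module.End ℂ V) {D : Set Γ} (hD : Subgroup.closure D = ⊤)
    (W : Submodule ℂ V) (h : ∀ x ∈ D, ∀ w ∈ W, ρ x w ∈ W) (g : Γ) : ∀ w ∈ W, ρ g w ∈ W := by
  have hg : g ∈ Subgroup.closure D := by rw [hD]; trivial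
  induction hg using Subgroup.closure_induction with
  | mem x hx => exact h x hx
  | one => intro w hw; rw [map_one]; exact hw
  | mul x y _ _ hx hy => intro w hw; rw [map_mul]; exact hx _ (hy _ hw)
  | inv x _ hx => exact pres_inv ρ x W hx

theorem adjoin_pres {a f : Module.End ℂ V} (hf : f ∈ Algebra.adjoin ℂ {a}) (W : Submodule ℂ V)
    (h : ∀ w ∈ W, a w ∈ W) : ∀ w ∈ W, f w ∈ W := by
  induction hf using Algebra.adjoin_induction with
  | mem x hx => rw [Set.mem_singleton_iff] at hx; rw [hx]; exact h
  | algebraMap r => intro w hw; rw [Module.algebraMap_end_apply]; exact W.smul_mem _ hw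
  | add x y _ _ hx hy => intro w hw; exact W.add_mem (hx w hw) (hy w hw)
  | mul x y _ _ hx hy => intro w hw; exact hx _ (hy _ hw)

/-- `f` acts on all the `A j / B j` by one and the same scalar. -/
def Sc (A B : ℕ → Submodule ℂ V) (f : Module.End ℂ V) : Prop :=
  ∃ ξ : ℂ, ∀ j, (∀ w ∈ A j, f w ∈ A j) ∧ (∀ w ∈ B j, f w ∈ B j) ∧ ∀ w ∈ A j, f w - ξ • w ∈ B j

theorem Sc.mul {A B : ℕ → Submodule ℂ V} {f g : Module.End ℂ V} (hf : Sc A B f) (hg : Sc A B g) :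
    Sc A B (f * g) := by
  obtain ⟨a, ha⟩ := hf
  obtain ⟨b, hb⟩ := hg
  refine ⟨a * b, fun j => ⟨fun w hw => (ha j).1 _ ((hb j).1 w hw), fun w hw => (ha j).2.1 _ ((hb j).2.1 w hw), fun w hw => ?_⟩⟩
  have h1 := (ha j).2.1 _ ((hb j).2.2 w hw)
  have h2 := (B j).smul_mem b ((ha j).2.2 w hw)
  have := (B j).add_mem h1 h2
  have e : (f * g) w - (a * b) • w = f (g w - b • w) + b • (f w - a • w) := by
    rw [Module.End.mul_apply, map_sub, map_smul, smul_sub, smul_smul, mul_comm b a]; abel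
  rw [e]; exact this

theorem Sc.adjoin {A B : ℕ → Submodule ℂ V} {a f : Module.End ℂ V} (hf : f ∈ Algebra.adjoin ℂ {a})
    (ha : Sc A B a) : Sc A B f := by
  induction hf using Algebra.adjoin_induction with
  | mem x hx => rw [Set.mem_singleton_iff] at hx; rw [hx]; exact ha
  | algebraMap r =>
    refine ⟨r, fun j => ⟨fun w hw => ?_, fun w hw => ?_, fun w hw => ?_⟩⟩
    · rw [Module.algebraMap_end_apply]; exact (A j).smul_mem _ hw
    · rw [Module.algebraMap_end_apply]; exact (B j).smul_mem _ hw
    · rw [Module.algebraMap_end_apply, sub_self]; exact (B j).zero_mem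
  | add x y _ _ hx hy =>
    obtain ⟨a, ha⟩ := hx
    obtain ⟨b, hb⟩ := hy
    refine ⟨a + b, fun j => ⟨fun w hw => (A j).add_mem ((ha j).1 w hw) ((hb j).1 w hw),
      fun w hw => (B j).add_mem ((ha j).2.1 w hw) ((hb j).2.1 w hw), fun w hw => ?_⟩⟩
    have := (B j).add_mem ((ha j).2.2 w hw) ((hb j).2.2 w hw)
    have e : (x + y) w - (a + b) • w = (x w - a • w) + (y w - b • w) := by
      rw [LinearMap.add_apply, add_smul]; abel
    rw [e]; exact this
  | mul x y _ _ hx hy => exact hx.mul hy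

theorem Sc.inv [FiniteDimensional ℂ V] {A B : ℕ → Submodule ℂ V} (ρ : Γ →* Module.End ℂ V) {g : Γ} (h : Sc A B (ρ g)) :
    Sc A B (ρ g⁻¹) := by
  obtain ⟨a, ha⟩ := h
  have hA : ∀ j, ∀ w ∈ A j, ρ g⁻¹ w ∈ A j := fun j => pres_inv ρ g _ (ha j).1
  have hB : ∀ j, ∀ w ∈ B j, ρ g⁻¹ w ∈ B j := fun j => pres_inv ρ g _ (ha j).2.1
  by_cases h0 : a = 0
  · refine ⟨1, fun j => ⟨hA j, hB j, fun w hw => ?_⟩⟩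
    have hAB : ∀ w ∈ A j, w ∈ B j := by
      intro w hw
      have h1 := (ha j).2.2 w hw
      rw [h0, zero_smul, sub_zero] at h1
      have := hB j _ h1
      rwa [rho_inv_apply] at this
    exact (B j).sub_mem (hB j _ (hAB w hw)) ((B j).smul_mem _ (hAB w hw))
  · refine ⟨a⁻¹, fun j => ⟨hA j, hB j, fun w hw => ?_⟩⟩
    have h1 := (B j).smul_mem (-a⁻¹) (hB j _ ((ha j).2.2 w hw))
    rw [map_sub, map_smul, rho_inv_apply, smul_sub, smul_smul, neg_mul, inv_mul_cancel₀ h0] at h1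
    have e : ρ g⁻¹ w - a⁻¹ • w = -a⁻¹ • w - (-1 : ℂ) • ρ g⁻¹ w := by
      rw [neg_smul, neg_smul, one_smul]; abel
    rw [e]; exact h1

theorem Sc.gen [FiniteDimensional ℂ V] {A B : ℕ → Submodule ℂ V} (ρ : Γ →* Module.End ℂ V) {D : Set Γ} (hD : Subgroup.closure D = ⊤)
    (h : ∀ x ∈ D, Sc A B (ρ x)) (g : Γ) : Sc A B (ρ g) := by
  have hg : g ∈ Subgroup.closure D := by rw [hD]; trivial
  induction hg using Subgroup.closure_induction with
  | mem x hx => exact h x hx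
  | one =>
    rw [map_one]
    exact ⟨1, fun j => ⟨fun w hw => hw, fun w hw => hw, fun w hw => by
      rw [Module.End.one_apply, one_smul, sub_self]; exact (B j).zero_mem⟩⟩
  | mul x y _ _ hx hy => rw [map_mul]; exact hx.mul hy
  | inv x _ hx => exact hx.inv ρ

/-- Eigenvectors modulo an invariant subspace. -/
theorem exists_eig_mod [FiniteDimensional ℂ V] (f : Module.End ℂ V) (U U' : Submodule ℂ V) (hlt : U < U')
    (hU : ∀ w ∈ U, f w ∈ U) (hU' : ∀ w ∈ U', f w ∈ U') : ∃ μ : ℂ, ∃ w ∈ U', w ∉ U ∧ f w - μ • w ∈ U := by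
  obtain ⟨p, hp⟩ : ∃ p : Submodule ℂ U', p = U.comap U'.subtype := ⟨_, rfl⟩
  have hmem : ∀ w : U', w ∈ p ↔ (w : V) ∈ U := fun w => by rw [hp]; rfl
  have hpt : p ≠ ⊤ := by
    intro h
    apply hlt.not_ge
    intro w hw
    exact (hmem ⟨w, hw⟩).1 (h ▸ Submodule.mem_top)
  have hnt : Nontrivial (U' ⧸ p) := Submodule.Quotient.nontrivial_iff.mpr hpt
  have hpp : p ≤ p.comap (f.restrict hU') := by
    intro w hw
    rw [Submodule.mem_comap, hmem]
    exact hU _ ((hmem w).1 hw)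
  obtain ⟨μ, hμ⟩ := Module.End.exists_eigenvalue (p.mapQ p (f.restrict hU') hpp)
  obtain ⟨q, hq⟩ := hμ.exists_hasEigenvector
  obtain ⟨w, rfl⟩ := Submodule.Quotient.mk_surjective p q
  refine ⟨μ, w, w.2, ?_, ?_⟩
  · intro h
    apply hq.2
    rw [Submodule.Quotient.mk_eq_zero, hmem]; exact h
  · have h1 := hq.apply_eq_smul
    rw [Submodule.mapQ_apply, ← Submodule.Quotient.mk_smul, Submodule.Quotient.eq, hmem] at h1
    exact h1

theorem eig_of_mod [FiniteDimensional ℂ V] (f : Module.End ℂ V) (U : Submodule ℂ V)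
    (hU : ∀ w ∈ U, f w ∈ U) {μ : ℂ} {w : V} (hw : w ∉ U) (h : f w - μ • w ∈ U) : f.HasEigenvalue μ := by
  by_contra hμ
  rw [Module.End.hasEigenvalue_iff, not_not, Module.End.eigenspace_def, LinearMap.ker_eq_bot] at hμ
  obtain ⟨g, hg⟩ : ∃ g : Module.End ℂ V, g = f - μ • 1 := ⟨_, rfl⟩
  rw [← hg] at hμ
  have happ : ∀ w, g w = f w - μ • w := fun w => by rw [hg]; simp
  have hle : U.map g ≤ U := by
    rintro _ ⟨u, hu, rfl⟩
    rw [happ]; exact U.sub_mem (hU u hu) (U.smul_mem _ hu)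
  have he : U.map g = U :=
    Submodule.eq_of_le_of_finrank_eq hle (Submodule.equivMapOfInjective g hμ U).finrank_eq.symm
  rw [← happ, ← he] at h
  obtain ⟨u, hu, hu'⟩ := h
  rw [hμ hu'] at hu
  exact hw hu

theorem eig_collision [FiniteDimensional ℂ V] (f : Module.End ℂ V) (d : ℕ) (hd : Module.finrank ℂ V ≤ d)
    (s : ℕ → ℂ) (h : ∀ i, f.HasEigenvalue (s i)) : ∃ i j, i < j ∧ j ≤ d ∧ s i = s j := by
  have hne : f.charpoly ≠ 0 := f.charpoly_monic.ne_zero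
  have hcard : f.charpoly.roots.toFinset.card ≤ d :=
    (Multiset.toFinset_card_le _).trans ((Polynomial.card_roots' _).trans (by rw [LinearMap.charpoly_natDegree]; exact hd))
  have hmaps : ∀ i ∈ Finset.range (d+1), s i ∈ f.charpoly.roots.toFinset := by
    intro i _
    rw [Multiset.mem_toFinset, Polynomial.mem_roots hne]
    exact (Module.End.hasEigenvalue_iff_isRoot_charpoly f _).1 (h i)
  obtain ⟨i, hi, j, hj, hij, he⟩ := Finset.exists_ne_map_eq_of_card_lt_of_maps_to
    (by rw [Finset.card_range]; omega) hmaps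
  rw [Finset.mem_range] at hi hj
  rcases lt_or_gt_of_ne hij with h' | h'
  · exact ⟨i, j, h', by omega, he⟩
  · exact ⟨j, i, h', by omega, he.symm⟩

end
end EG

namespace EG

section
variable {V : Type} [AddCommGroup V] [Module ℂ V] {Γ : Type} [Group Γ]

/-- Hypotheses of the triangularisation lemma. -/
structure TH (ρ : Γ →* Module.End ℂ V) (D : Set Γ) (e r : ℕ) : Prop where
  gen : Subgroup.closure D = ⊤
  adj : ∀ x ∈ D, ρ x ∈ Algebra.adjoin ℂ {ρ (x ^ e)}
  tor : ∀ x ∈ D, ∀ μ μ' : ℂ, (ρ (x ^ e)).HasEigenvalue μ → (ρ (x ^ e)).HasEigenvalue μ' →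
    ∀ j, 1 ≤ j → j ≤ Module.finrank ℂ V → μ ^ j = μ' ^ j → μ = μ'
  ln : ∀ c ∈ LN ((fun x => x ^ e) '' D) r, ρ c = 1

theorem TH.inv [FiniteDimensional ℂ V] {ρ : Γ →* Module.End ℂ V} {D : Set Γ} {e r : ℕ} (h : TH ρ D e r) (W : Submodule ℂ V)
    (hW : ∀ y ∈ (fun x => x ^ e) '' D, ∀ w ∈ W, ρ y w ∈ W) (g : Γ) : ∀ w ∈ W, ρ g w ∈ W :=
  inv_of_gen ρ h.gen W (fun x hx => adjoin_pres (h.adj x hx) W (hW _ ⟨x, hx, rfl⟩)) g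

theorem TH.step [FiniteDimensional ℂ V] {ρ : Γ →* Module.End ℂ V} {D : Set Γ} {e r : ℕ} (h : TH ρ D e r) (U : Submodule ℂ V)
    (hU : ∀ g, ∀ w ∈ U, ρ g w ∈ U) (htop : U ≠ ⊤) :
    ∃ U' : Submodule ℂ V, U < U' ∧ (∀ g, ∀ w ∈ U', ρ g w ∈ U') ∧ ∀ g, ∃ ξ : ℂ, ∀ w ∈ U', ρ g w - ξ • w ∈ U := by
  obtain ⟨Y, hY⟩ : ∃ Y, Y = (fun x => x ^ e) '' D := ⟨_, rfl⟩
  obtain ⟨U', ⟨hlt, hU'⟩, hmin⟩ := (wellFounded_lt (α := Submodule ℂ V)).has_min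
    {W | U < W ∧ ∀ g, ∀ w ∈ W, ρ g w ∈ W} ⟨⊤, lt_top_iff_ne_top.mpr htop, fun _ _ _ => trivial⟩
  have key : ∀ k, (∀ c ∈ LN Y (k+1), ∃ ξ : ℂ, ∀ w ∈ U', ρ c w - ξ • w ∈ U) →
      (∀ c ∈ LN Y k, ∃ ξ : ℂ, ∀ w ∈ U', ρ c w - ξ • w ∈ U) := by
    intro k hk c hc
    -- `c` commutes with `Y` modulo `U`
    have hcomm : ∀ y ∈ Y, ∀ w ∈ U', ρ y (ρ c w) - ρ c (ρ y w) ∈ U := by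
      intro y hy
      obtain ⟨ζ, hζ⟩ := hk (y * c * y⁻¹ * c⁻¹) ⟨y, hy, c, hc, rfl⟩
      have h1 : ∀ w ∈ U', ρ y (ρ c w) - ζ • ρ c (ρ y w) ∈ U := by
        intro w hw
        have := hζ _ (hU' c _ (hU' y w hw))
        have e1 : ρ (y * c * y⁻¹ * c⁻¹) (ρ c (ρ y w)) = ρ y (ρ c w) := by
          rw [map_mul, map_mul, map_mul]
          simp only [Module.End.mul_apply]
          rw [rho_inv_apply, rho_inv_apply]
        rwa [e1] at this
      obtain ⟨μ, w, hwU', hwU, hw⟩ := exists_eig_mod (ρ y) U U' hlt (hU y) (hU' y)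
      have h2 : ∀ i : ℕ, ∃ w ∈ U', w ∉ U ∧ ρ y w - (ζ ^ i * μ) • w ∈ U := by
        intro i
        induction i with
        | zero => exact ⟨w, hwU', hwU, by rw [pow_zero, one_mul]; exact hw⟩
        | succ i ih =>
          obtain ⟨w, a1, a2, a3⟩ := ih
          refine ⟨ρ c w, hU' c w a1, ?_, ?_⟩
          · intro h3
            have := hU c⁻¹ _ h3
            rw [rho_inv_apply] at this
            exact a2 this
          · have b1 := h1 w a1
            have b2 := U.smul_mem ζ (hU c _ a3)
            have := U.add_mem b1 b2
            have e2 : ρ y (ρ c w) - (ζ ^ (i+1) * μ) • ρ c w =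
              ρ y (ρ c w) - ζ • ρ c (ρ y w) + ζ • ρ c (ρ y w - (ζ ^ i * μ) • w) := by
              rw [map_sub, map_smul, smul_sub, smul_smul, pow_succ', mul_assoc]; abel
            rw [e2]; exact this
      have h3 : ∀ i : ℕ, (ρ y).HasEigenvalue (ζ ^ i * μ) := by
        intro i
        obtain ⟨w, a1, a2, a3⟩ := h2 i
        exact eig_of_mod (ρ y) U (hU y) a2 a3
      obtain ⟨i, j, hij, hj, he⟩ := eig_collision (ρ y) _ le_rfl _ h3
      have hμ0 : μ ≠ 0 := by
        rintro rfl
        rw [zero_smul, sub_zero] at hw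
        have := hU y⁻¹ _ hw
        rw [rho_inv_apply] at this
        exact hwU this
      have hζ0 : ζ ≠ 0 := by
        rintro rfl
        have := h1 w hwU'
        rw [zero_smul, sub_zero] at this
        have := hU c⁻¹ _ (hU y⁻¹ _ this)
        rw [rho_inv_apply, rho_inv_apply] at this
        exact hwU this
      have hpow : ζ ^ (j - i) = 1 := by
        have h4 := mul_right_cancel₀ hμ0 he
        have h5 : ζ ^ j = ζ ^ i * ζ ^ (j - i) := by rw [← pow_add]; congr 1; omega
        rw [h5] at h4
        have := mul_left_cancel₀ (pow_ne_zero i hζ0) (h4.symm.trans (mul_one _).symm)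
        exact this
      rw [hY] at hy
      obtain ⟨x, hx, rfl⟩ := hy
      have h6 := h.tor x hx (ζ ^ 1 * μ) (ζ ^ 0 * μ) (h3 1) (h3 0) (j - i) (by omega) (by omega)
        (by rw [mul_pow, mul_pow, ← pow_mul, one_mul, hpow, pow_zero, one_pow])
      have h7 : ζ = 1 := by
        have := mul_right_cancel₀ hμ0 h6
        simpa using this
      intro w hw
      have := h1 w hw
      rwa [h7, one_smul] at this
    obtain ⟨ν, w0, a1, a2, a3⟩ := exists_eig_mod (ρ c) U U' hlt (hU c) (hU' c)
    obtain ⟨W, hW⟩ : ∃ W : Submodule ℂ V, W = U' ⊓ U.comap (ρ c - ν • 1) := ⟨_, rfl⟩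
    have hmem : ∀ w, w ∈ W ↔ w ∈ U' ∧ ρ c w - ν • w ∈ U := by
      intro w; rw [hW, Submodule.mem_inf, Submodule.mem_comap]; simp
    have hWinv : ∀ g, ∀ w ∈ W, ρ g w ∈ W := by
      apply h.inv W
      intro y hy w hw
      rw [hmem] at hw ⊢
      refine ⟨hU' y w hw.1, ?_⟩
      have b1 := hcomm y (by rw [hY]; exact hy) w hw.1
      have b2 := hU y _ hw.2
      have := U.sub_mem b2 b1
      have e2 : ρ c (ρ y w) - ν • ρ y w = ρ y (ρ c w - ν • w) - (ρ y (ρ c w) - ρ c (ρ y w)) := by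
        rw [map_sub, map_smul]; abel
      rw [e2]; exact this
    have hUW : U < W := by
      refine lt_of_le_of_ne ?_ ?_
      · intro u hu
        rw [hmem]
        exact ⟨hlt.le hu, U.sub_mem (hU c u hu) (U.smul_mem _ hu)⟩
      · intro he
        apply a2
        rw [he, hmem]
        exact ⟨a1, a3⟩
    have hWU' : W = U' := by
      have hle : W ≤ U' := fun w hw => ((hmem w).1 hw).1
      by_contra hne
      exact hmin W ⟨hUW, hWinv⟩ (lt_of_le_of_ne hle hne)
    exact ⟨ν, fun w hw => ((hmem w).1 (hWU' ▸ hw)).2⟩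
  have hall : ∀ k, k ≤ r → (∀ c ∈ LN Y (r - k), ∃ ξ : ℂ, ∀ w ∈ U', ρ c w - ξ • w ∈ U) := by
    intro k
    induction k with
    | zero =>
      intro _ c hc
      refine ⟨1, fun w hw => ?_⟩
      rw [hY] at hc
      rw [h.ln c hc, one_smul, Module.End.one_apply, sub_self]; exact U.zero_mem
    | succ k ih =>
      intro hk
      apply key
      have := ih (by omega)
      rwa [show r - (k+1) + 1 = r - k by omega]
  have h0 := hall r le_rfl
  rw [Nat.sub_self] at h0
  refine ⟨U', hlt, hU', ?_⟩
  intro g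
  obtain ⟨ξ, hξ⟩ := Sc.gen (A := fun _ => U') (B := fun _ => U) ρ h.gen (fun x hx => by
    refine Sc.adjoin (h.adj x hx) ?_
    obtain ⟨ξ, hξ⟩ := h0 (x ^ e) (by rw [hY]; exact ⟨x, hx, rfl⟩)
    exact ⟨ξ, fun _ => ⟨hU' _, hU _, hξ⟩⟩) g
  exact ⟨ξ, (hξ 0).2.2⟩

/-- The flag. -/
theorem TH.flag [FiniteDimensional ℂ V] {ρ : Γ →* Module.End ℂ V} {D : Set Γ} {e r : ℕ} (h : TH ρ D e r) :
    ∃ U : ℕ → Submodule ℂ V, U 0 = ⊥ ∧ U (Module.finrank ℂ V) = ⊤ ∧ (∀ j, U j ≤ U (j+1)) ∧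
      (∀ j g, ∀ w ∈ U j, ρ g w ∈ U j) ∧ ∀ j g, ∃ ξ : ℂ, ∀ w ∈ U (j+1), ρ g w - ξ • w ∈ U j := by
  have hs : ∀ U : Submodule ℂ V, ∃ U' : Submodule ℂ V, (∀ g, ∀ w ∈ U, ρ g w ∈ U) →
      (U ≤ U' ∧ (U ≠ ⊤ → U < U') ∧ (∀ g, ∀ w ∈ U', ρ g w ∈ U') ∧ ∀ g, ∃ ξ : ℂ, ∀ w ∈ U', ρ g w - ξ • w ∈ U) := by
    intro U
    by_cases hU : ∀ g, ∀ w ∈ U, ρ g w ∈ U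
    · by_cases ht : U = ⊤
      · refine ⟨⊤, fun _ => ⟨le_top, fun h' => absurd ht h', fun _ _ _ => trivial, fun g => ⟨0, fun w _ => by rw [ht]; trivial⟩⟩⟩
      · obtain ⟨U', a, b, c⟩ := h.step U hU ht
        exact ⟨U', fun _ => ⟨a.le, fun _ => a, b, c⟩⟩
    · exact ⟨⊤, fun h' => absurd h' hU⟩
  choose F hF using hs
  obtain ⟨U, hU0, hUs⟩ : ∃ U : ℕ → Submodule ℂ V, U 0 = ⊥ ∧ ∀ j, U (j+1) = F (U j) :=
    ⟨fun j => Nat.rec ⊥ (fun _ W => F W) j, rfl, fun _ => rfl⟩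
  have hinv : ∀ j g, ∀ w ∈ U j, ρ g w ∈ U j := by
    intro j
    induction j with
    | zero => intro g w hw; rw [hU0, Submodule.mem_bot] at hw ⊢; rw [hw, map_zero]
    | succ j ih => rw [hUs]; exact (hF _ ih).2.2.1
  have hdim : ∀ j, j ≤ Module.finrank ℂ (U j) ∨ U j = ⊤ := by
    intro j
    induction j with
    | zero => left; exact Nat.zero_le _
    | succ j ih =>
      by_cases ht : U j = ⊤
      · right
        have := (hF _ (hinv j)).1
        rw [hUs, eq_top_iff, ← ht]; exact this
      · left
        have h1 := ih.resolve_right ht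
        have := Submodule.finrank_lt_finrank_of_lt ((hF _ (hinv j)).2.1 ht)
        rw [hUs]; omega
  refine ⟨U, hU0, ?_, fun j => by rw [hUs]; exact (hF _ (hinv j)).1, hinv, fun j => by rw [hUs]; exact (hF _ (hinv j)).2.2.2⟩
  rcases hdim (Module.finrank ℂ V) with h1 | h1
  · exact Submodule.eq_top_of_finrank_eq (le_antisymm (Submodule.finrank_le _) h1)
  · exact h1

end
end EG

namespace EG

section
variable {V : Type} [AddCommGroup V] [Module ℂ V] {Γ : Type} [Group Γ]

theorem tri_eig (a : Module.End ℂ V) (U U' : Submodule ℂ V) (hU : ∀ w ∈ U, a w ∈ U) (hU' : ∀ w ∈ U', a w ∈ U')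
    {ξ μ : ℂ} (h : ∀ w ∈ U', a w - ξ • w ∈ U) {w : V} (hw : w ∈ U') (hg : w ∈ a.maxGenEigenspace μ) :
    a w - μ • w ∈ U := by
  by_cases hwU : w ∈ U
  · exact U.sub_mem (hU w hwU) (U.smul_mem _ hwU)
  obtain ⟨N, hN⟩ := (Module.End.mem_maxGenEigenspace _ _ _).1 hg
  have hbU : ∀ w ∈ U, (a - μ • 1) w ∈ U := fun w hw => by
    simpa using U.sub_mem (hU w hw) (U.smul_mem μ hw)
  have key : ∀ n : ℕ, ((a - μ • 1) ^ n) w - ((ξ - μ) ^ n) • w ∈ U := by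
    intro n
    induction n with
    | zero => simp
    | succ n ih =>
      have h1 := hbU _ ih
      have h2 := U.smul_mem ((ξ - μ) ^ n) (h w hw)
      have := U.add_mem h1 h2
      have e : ((a - μ • 1) ^ (n+1)) w - ((ξ - μ) ^ (n+1)) • w =
          (a - μ • 1) (((a - μ • 1) ^ n) w - ((ξ - μ) ^ n) • w) + ((ξ - μ) ^ n) • (a w - ξ • w) := by
        rw [pow_succ', Module.End.mul_apply, map_sub, map_smul]
        simp only [LinearMap.sub_apply, LinearMap.smul_apply, Module.End.one_apply, pow_succ]
        module
      rw [e]; exact this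
  have h1 := key N
  rw [hN, zero_sub] at h1
  have h2 := U.neg_mem h1
  rw [neg_neg] at h2
  have h3 : (ξ - μ) ^ N = 0 := by
    by_contra h0
    apply hwU
    have := U.smul_mem ((ξ - μ) ^ N)⁻¹ h2
    rwa [smul_smul, inv_mul_cancel₀ h0, one_smul] at this
  have h4 : ξ = μ := sub_eq_zero.mp (eq_zero_of_pow_eq_zero h3)
  rw [← h4]; exact h w hw

theorem tri_nil (T : Module.End ℂ V) (U : ℕ → Submodule ℂ V) (hU0 : U 0 = ⊥) (W : Submodule ℂ V)
    (hTW : ∀ w ∈ W, T w ∈ W) {μ : ℂ} (h : ∀ j, ∀ w ∈ W, w ∈ U (j+1) → T w - μ • w ∈ U j) :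
    ∀ j, ∀ w ∈ W, w ∈ U j → w ∈ T.maxGenEigenspace μ := by
  have key : ∀ j, ∀ w ∈ W, w ∈ U j → ((T - μ • 1) ^ j) w = 0 := by
    intro j
    induction j with
    | zero => intro w _ hw; rw [hU0, Submodule.mem_bot] at hw; rw [hw, map_zero]
    | succ j ih =>
      intro w hw hwj
      rw [pow_succ, Module.End.mul_apply]
      apply ih
      · simpa using W.sub_mem (hTW w hw) (W.smul_mem μ hw)
      · simpa using h j w hw hwj
  intro j w hw hwj
  exact (Module.End.mem_maxGenEigenspace _ _ _).2 ⟨j, key j w hw hwj⟩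

theorem comm_sub (ρ : Γ →* Module.End ℂ V) (a b : Γ) (w : V) :
    ρ (a * b * a⁻¹ * b⁻¹) w - w = ρ a (ρ b (ρ a⁻¹ (ρ b⁻¹ w))) - ρ b (ρ a (ρ a⁻¹ (ρ b⁻¹ w))) := by
  rw [rho_apply_inv, rho_apply_inv, map_mul, map_mul, map_mul]; rfl

theorem TH.preserve [FiniteDimensional ℂ V] {ρ : Γ →* Module.End ℂ V} {D : Set Γ} {e r : ℕ} (h : TH ρ D e r)
    (U : ℕ → Submodule ℂ V) (hU0 : U 0 = ⊥) (d : ℕ) (hUd : U d = ⊤)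
    (hinv : ∀ j g, ∀ w ∈ U j, ρ g w ∈ U j) (hsc : ∀ j g, ∃ ξ : ℂ, ∀ w ∈ U (j+1), ρ g w - ξ • w ∈ U j)
    (y0 : Γ) (hy0 : y0 ∈ (fun x => x ^ e) '' D) (y : Γ) (hy : y ∈ (fun x => x ^ e) '' D) (μ : ℂ) :
    ∀ w ∈ (ρ y0).maxGenEigenspace μ, ρ y w ∈ (ρ y0).maxGenEigenspace μ := by
  obtain ⟨c, hc0, hcs⟩ : ∃ c : ℕ → Γ, c 0 = y ∧ ∀ i, c (i+1) = y0 * c i * y0⁻¹ * (c i)⁻¹ :=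
    ⟨fun j => Nat.rec y (fun _ c => y0 * c * y0⁻¹ * c⁻¹) j, rfl, fun _ => rfl⟩
  have hcLN : ∀ i, c i ∈ LN ((fun x => x ^ e) '' D) i := by
    intro i
    induction i with
    | zero => rw [hc0]; exact hy
    | succ i ih => exact ⟨y0, hy0, c i, ih, hcs i⟩
  have hY : ∀ j, ∀ w ∈ U (j+1), w ∈ (ρ y0).maxGenEigenspace μ → ρ y0 w - μ • w ∈ U j := by
    intro j w hw hg
    obtain ⟨ξ, hξ⟩ := hsc j y0
    exact tri_eig (ρ y0) (U j) (U (j+1)) (hinv j y0) (hinv (j+1) y0) hξ hw hg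
  have hY0 : ∀ w ∈ (ρ y0).maxGenEigenspace μ, ρ y0 w ∈ (ρ y0).maxGenEigenspace μ := by
    intro w hw
    rw [Module.End.mem_maxGenEigenspace] at hw ⊢
    obtain ⟨n, hn⟩ := hw
    refine ⟨n, ?_⟩
    have hcm : Commute ((ρ y0 - μ • 1) ^ n) (ρ y0) := by
      apply Commute.pow_left
      exact (Commute.refl _).sub_left ((Commute.one_left _).smul_left μ)
    have := congrArg (fun f : Module.End ℂ V => f w) hcm.eq
    simp only [Module.End.mul_apply] at this
    rw [this, hn, map_zero]
  have hstep : ∀ i, (∀ w ∈ (ρ y0).maxGenEigenspace μ, ρ (c (i+1)) w ∈ (ρ y0).maxGenEigenspace μ) →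
      (∀ w ∈ (ρ y0).maxGenEigenspace μ, ρ (c i) w ∈ (ρ y0).maxGenEigenspace μ) := by
    intro i hi
    have hi' := pres_inv ρ (c (i+1)) _ hi
    have huni : ∀ j, ∀ w ∈ U (j+1), ρ (c (i+1))⁻¹ w - w ∈ U j := by
      intro j w hw
      have e1 : (c (i+1))⁻¹ = c i * y0 * (c i)⁻¹ * y0⁻¹ := by rw [hcs]; group
      rw [e1, comm_sub]
      obtain ⟨ξ, hξ⟩ := hsc j (c i)
      obtain ⟨ξ', hξ'⟩ := hsc j y0
      have hu := hinv (j+1) (c i)⁻¹ _ (hinv (j+1) y0⁻¹ w hw)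
      generalize ρ (c i)⁻¹ (ρ y0⁻¹ w) = u at hu
      have b1 := hξ _ (hinv (j+1) y0 u hu)
      have b2 := hξ' _ (hinv (j+1) (c i) u hu)
      have b3 := (U j).smul_mem ξ (hξ' u hu)
      have b4 := (U j).smul_mem ξ' (hξ u hu)
      have := (U j).add_mem ((U j).add_mem b1 b3) ((U j).neg_mem ((U j).add_mem b2 b4))
      convert this using 1
      module
    obtain ⟨T, hT⟩ : ∃ T : Module.End ℂ V, T = ρ ((c (i+1))⁻¹ * y0) := ⟨_, rfl⟩
    have hTW : ∀ w ∈ (ρ y0).maxGenEigenspace μ, T w ∈ (ρ y0).maxGenEigenspace μ := by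
      intro w hw
      rw [hT, map_mul]
      exact hi' _ (hY0 w hw)
    have hTn := tri_nil T U hU0 ((ρ y0).maxGenEigenspace μ) hTW (μ := μ) (by
      intro j w hw hwj
      have b1 := huni j _ (hinv (j+1) y0 w hwj)
      have b2 := hY j w hwj hw
      have := (U j).add_mem b1 b2
      rw [hT, map_mul, Module.End.mul_apply]
      convert this using 1
      abel) d
    have hci : ∀ w ∈ (ρ y0).maxGenEigenspace μ, ρ (c i)⁻¹ w ∈ (ρ y0).maxGenEigenspace μ := by
      intro w hw
      have h1 := hTn w hw (by rw [hUd]; trivial)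
      rw [Module.End.mem_maxGenEigenspace] at h1 ⊢
      obtain ⟨n, hn⟩ := h1
      refine ⟨n, ?_⟩
      have e1 : (c (i+1))⁻¹ * y0 = c i * y0 * (c i)⁻¹ := by rw [hcs]; group
      have e2 : ∀ n : ℕ, (ρ y0 - μ • 1) ^ n * ρ (c i)⁻¹ = ρ (c i)⁻¹ * (T - μ • 1) ^ n := by
        intro n
        induction n with
        | zero => simp
        | succ n ih =>
          rw [pow_succ, mul_assoc, pow_succ', ← mul_assoc (ρ (c i)⁻¹)]
          have e3 : (ρ y0 - μ • 1) * ρ (c i)⁻¹ = ρ (c i)⁻¹ * (T - μ • 1) := by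
            rw [hT, e1, sub_mul, mul_sub, ← map_mul, ← map_mul, smul_mul_assoc, mul_smul_comm, one_mul, mul_one]
            congr 2
            group
          rw [e3, ← mul_assoc, ih, mul_assoc, mul_assoc, ← pow_succ, ← pow_succ']
      have := congrArg (fun f : Module.End ℂ V => f w) (e2 n)
      simp only [Module.End.mul_apply] at this
      rw [this, hn, map_zero]
    have := pres_inv ρ _ _ hci
    rwa [inv_inv] at this
  have hall : ∀ k, k ≤ r → ∀ w ∈ (ρ y0).maxGenEigenspace μ, ρ (c (r - k)) w ∈ (ρ y0).maxGenEigenspace μ := by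
    intro k
    induction k with
    | zero => intro _ w hw; rw [Nat.sub_zero, h.ln _ (hcLN r)]; exact hw
    | succ k ih =>
      intro hk
      apply hstep
      rw [show r - (k+1) + 1 = r - k by omega]
      exact ih (by omega)
  have := hall r le_rfl
  rwa [Nat.sub_self, hc0] at this

/-- Triangularisation lemma: the generated group acts nilpotently. -/
theorem TH.main [FiniteDimensional ℂ V] {ρ : Γ →* Module.End ℂ V} {D : Set Γ} {e r : ℕ} (h : TH ρ D e r) :
    ∃ c, ∀ g ∈ (⊤ : Subgroup Γ).lowerCentralSeries c, ρ g = 1 := by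
  obtain ⟨U, hU0, hUd, hmono, hinv, hsc⟩ := h.flag
  obtain ⟨d, hd⟩ : ∃ d, d = Module.finrank ℂ V := ⟨_, rfl⟩
  rw [← hd] at hUd
  obtain ⟨Y, hY⟩ : ∃ Y, Y = (fun x => x ^ e) '' D := ⟨_, rfl⟩
  have htop := Module.End.iSup_iInf_maxGenEigenspace_eq_top_of_forall_mapsTo (fun y : Y => ρ (y : Γ))
    (fun i j φ w hw => h.preserve U hU0 d hUd hinv hsc j (hY ▸ j.2) i (hY ▸ i.2) φ w hw)
    (fun i => Module.End.iSup_maxGenEigenspace_eq_top _)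
  have hmono' : Monotone U := monotone_nat_of_le_succ hmono
  refine ⟨d + 1, fun g hg => ?_⟩
  have key : ∀ χ : Y → ℂ, ∀ w ∈ ⨅ i : Y, (ρ (i : Γ)).maxGenEigenspace (χ i), ρ g w - w = 0 := by
    intro χ
    obtain ⟨W, hW⟩ : ∃ W : Submodule ℂ V, W = ⨅ i : Y, (ρ (i : Γ)).maxGenEigenspace (χ i) := ⟨_, rfl⟩
    rw [← hW]
    have hmem : ∀ w, w ∈ W ↔ ∀ i : Y, w ∈ (ρ (i : Γ)).maxGenEigenspace (χ i) := by
      intro w; rw [hW, Submodule.mem_iInf]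
    have hWinv : ∀ g, ∀ w ∈ W, ρ g w ∈ W := by
      apply h.inv W
      intro y hy w hw
      rw [hmem] at hw ⊢
      intro i
      exact h.preserve U hU0 d hUd hinv hsc i (hY ▸ i.2) y hy _ w (hw i)
    obtain ⟨A, hA⟩ : ∃ A : ℕ → Submodule ℂ V, ∀ j, A j = W ⊓ U j := ⟨fun j => W ⊓ U j, fun _ => rfl⟩
    have hAm : Monotone A := by
      intro i j hij
      rw [hA, hA]; exact inf_le_inf_left _ (hmono' hij)
    have hAinv : ∀ j g, ∀ w ∈ A j, ρ g w ∈ A j := by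
      intro j g w hw
      rw [hA] at hw ⊢
      exact ⟨hWinv g w hw.1, hinv j g w hw.2⟩
    have hA0 : A 0 = ⊥ := by rw [hA, hU0, inf_bot_eq]
    have hASc : ∀ g, Sc (fun j => A (j+1)) A (ρ g) := by
      apply Sc.gen ρ h.gen
      intro x hx
      refine Sc.adjoin (h.adj x hx) ?_
      have hxY : x ^ e ∈ Y := by rw [hY]; exact ⟨x, hx, rfl⟩
      refine ⟨χ ⟨x ^ e, hxY⟩, fun j => ⟨hAinv _ _, hAinv _ _, fun w hw => ?_⟩⟩
      replace hw : w ∈ A (j+1) := hw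
      rw [hA] at hw ⊢
      refine ⟨W.sub_mem (hWinv _ w hw.1) (W.smul_mem _ hw.1), ?_⟩
      obtain ⟨ξ, hξ⟩ := hsc j (x ^ e)
      exact tri_eig (ρ (x ^ e)) (U j) (U (j+1)) (hinv j _) (hinv (j+1) _) hξ hw.2 ((hmem w).1 hw.1 ⟨x ^ e, hxY⟩)
    -- uniform version, indices truncated at zero
    have hAsc : ∀ g, ∃ ξ : ℂ, ∀ j, ∀ w ∈ A j, ρ g w - ξ • w ∈ A (j - 1) := by
      intro g
      obtain ⟨ξ, hξ⟩ := hASc g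
      refine ⟨ξ, fun j w hw => ?_⟩
      rcases j with _ | j
      · rw [Nat.zero_sub]; exact (A 0).sub_mem (hAinv 0 g w hw) ((A 0).smul_mem _ hw)
      · exact (hξ j).2.2 w hw
    have hlcs : ∀ k, ∀ a ∈ (⊤ : Subgroup Γ).lowerCentralSeries k, ∀ b : Γ, ∀ j, ∀ w ∈ A j,
        ρ a (ρ b w) - ρ b (ρ a w) ∈ A (j - (k+1)) := by
      intro k
      induction k with
      | zero =>
        intro a _ b j w hw
        obtain ⟨ξ, hξ⟩ := hAsc a
        obtain ⟨ξ', hξ'⟩ := hAsc b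
        have b1 := hξ j _ (hAinv j b w hw)
        have b2 := hξ' j _ (hAinv j a w hw)
        have b3 := (A (j-1)).smul_mem ξ (hξ' j w hw)
        have b4 := (A (j-1)).smul_mem ξ' (hξ j w hw)
        have := (A (j-1)).add_mem ((A (j-1)).add_mem b1 b3) ((A (j-1)).neg_mem ((A (j-1)).add_mem b2 b4))
        convert this using 1
        module
      | succ k ih =>
        intro a ha
        rw [Subgroup.mem_lowerCentralSeries_succ_iff] at ha
        induction ha using Subgroup.closure_induction with
        | mem x hx =>
          obtain ⟨p, hp, q, _, rfl⟩ := hx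
          intro b j w hw
          have hc1 : ∀ j, ∀ w ∈ A j, ρ (p * q * p⁻¹ * q⁻¹) w - w ∈ A (j - (k+1)) := by
            intro j w hw
            rw [comm_sub]
            exact ih p hp q j _ (hAinv _ _ _ (hAinv _ _ _ hw))
          obtain ⟨ξ, hξ⟩ := hAsc b
          have hn := hξ j w hw
          have b1 := hc1 _ _ hn
          have b2 := hξ _ _ (hc1 j w hw)
          rw [show j - 1 - (k+1) = j - (k+1+1) by omega] at b1
          rw [show j - (k+1) - 1 = j - (k+1+1) by omega] at b2
          have := (A (j - (k+1+1))).sub_mem b1 b2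
          convert this using 1
          simp only [map_sub, map_smul, commutatorElement_def]
          module
        | one => intro b j w hw; rw [map_one]; simp
        | mul x y _ _ hx hy =>
          intro b j w hw
          have b1 := hAinv _ x _ (hy b j w hw)
          have b2 := hx b j _ (hAinv j y w hw)
          have := (A (j - (k+1+1))).add_mem b1 b2
          convert this using 1
          simp only [map_sub, map_mul, Module.End.mul_apply]
          abel
        | inv x _ hx =>
          intro b j w hw
          have b1 := (A (j - (k+1+1))).neg_mem (hAinv _ x⁻¹ _ (hx b j _ (hAinv j x⁻¹ w hw)))
          convert b1 using 1
          simp only [map_sub]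
          rw [rho_apply_inv, rho_inv_apply]
          abel
    have hfin : ∀ a ∈ (⊤ : Subgroup Γ).lowerCentralSeries (d+1), ∀ w ∈ W, ρ a w - w = 0 := by
      intro a ha
      rw [Subgroup.mem_lowerCentralSeries_succ_iff] at ha
      induction ha using Subgroup.closure_induction with
      | mem x hx =>
        obtain ⟨p, hp, q, _, rfl⟩ := hx
        intro w hw
        have hwA : w ∈ A d := by rw [hA, hUd]; exact ⟨hw, trivial⟩
        have := hlcs d p hp q d _ (hAinv _ p⁻¹ _ (hAinv _ q⁻¹ _ hwA))
        rw [← comm_sub, show d - (d+1) = 0 by omega, hA0, Submodule.mem_bot] at this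
        exact this
      | one => intro w hw; rw [map_one]; simp
      | mul x y _ _ hx hy =>
        intro w hw
        rw [map_mul, Module.End.mul_apply, sub_eq_zero.mp (hy w hw)]
        exact hx w hw
      | inv x _ hx =>
        intro w hw
        have := sub_eq_zero.mp (hx w hw)
        rw [sub_eq_zero]
        conv_lhs => rw [← this]
        rw [rho_inv_apply]
    exact hfin g hg
  have hker : (⊤ : Submodule ℂ V) ≤ LinearMap.ker (ρ g - 1) := by
    rw [← htop]
    refine iSup_le fun χ w hw => ?_
    rw [LinearMap.mem_ker, LinearMap.sub_apply, Module.End.one_apply]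
    exact key χ w hw
  ext w
  have := hker (Submodule.mem_top (x := w))
  rw [LinearMap.mem_ker, LinearMap.sub_apply, Module.End.one_apply] at this
  rw [Module.End.one_apply]
  exact sub_eq_zero.mp this

end
end EG

namespace EG

/-- The standard absolute value of `ℂ`. -/
noncomputable def vC : AbsoluteValue ℂ ℝ := NormedField.toAbsoluteValue ℂ

theorem vC_apply (x : ℂ) : vC x = ‖x‖ := rfl

theorem vC_nontrivial : vC.IsNontrivial := by
  refine ⟨2, two_ne_zero, ?_⟩
  rw [vC_apply]; norm_num

theorem LN_map {G H : Type*} [Group G] [Group H] (f : G →* H) (Y : Set G) (k : ℕ) :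
    LN (f '' Y) k = f '' LN Y k := by
  induction k with
  | zero => rfl
  | succ k ih =>
    ext g
    constructor
    · rintro ⟨_, ⟨y, hy, rfl⟩, c, hc, rfl⟩
      rw [ih] at hc
      obtain ⟨c, hc, rfl⟩ := hc
      exact ⟨y * c * y⁻¹ * c⁻¹, ⟨y, hy, c, hc, rfl⟩, by simp⟩
    · rintro ⟨_, ⟨y, hy, c, hc, rfl⟩, rfl⟩
      refine ⟨f y, ⟨y, hy, rfl⟩, f c, ?_, by simp⟩
      rw [ih]; exact ⟨c, hc, rfl⟩

theorem small_pow (m : ℕ) {s : ℝ} (hs : 0 < s) : ∃ η : ℝ, 0 < η ∧ (1 + 2 * η) ^ m - 1 ≤ s := by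
  have hc : Continuous (fun t : ℝ => (1 + 2 * t) ^ m - 1) := by fun_prop
  have h0 := hc.tendsto 0
  simp only [mul_zero, add_zero, one_pow, sub_self] at h0
  have := h0.eventually (gt_mem_nhds hs)
  obtain ⟨ε, hε, h⟩ := Metric.eventually_nhds_iff.mp this
  refine ⟨ε / 2, by positivity, ?_⟩
  have h1 := h (y := ε / 2) (by rw [Real.dist_eq, sub_zero, abs_of_pos (by positivity)]; linarith)
  exact h1.le

section
variable {K : Type*} [Field K] (v : AbsoluteValue K ℝ) {ι : Type*} [Fintype ι] [DecidableEq ι]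

theorem nm_mul_sub_one {A B : Matrix ι ι K} {s t : ℝ} (hA : nm v (A - 1) ≤ s) (hB : nm v (B - 1) ≤ t) :
    nm v (A * B - 1) ≤ (1 + s) * (1 + t) - 1 := by
  have e : A * B - 1 = (A - 1) * (B - 1) + (A - 1) + (B - 1) := by noncomm_ring
  rw [e]
  have h1 := nm_mul_le_of v hA hB
  have h2 := nm_add_le v ((A - 1) * (B - 1) + (A - 1)) (B - 1)
  have h3 := nm_add_le v ((A - 1) * (B - 1)) (A - 1)
  nlinarith

theorem nm_pow_sub_one {A : Matrix ι ι K} {s : ℝ} (hA : nm v (A - 1) ≤ s) (m : ℕ) :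
    nm v (A ^ m - 1) ≤ (1 + s) ^ m - 1 := by
  induction m with
  | zero => simp
  | succ m ih =>
    rw [pow_succ]
    refine (nm_mul_sub_one v ih hA).trans (le_of_eq ?_)
    ring

theorem nm_sum_le {α : Type*} (F : Finset α) (f : α → Matrix ι ι K) : nm v (∑ i ∈ F, f i) ≤ ∑ i ∈ F, nm v (f i) := by
  classical
  induction F using Finset.induction_on with
  | empty => simp
  | insert a F ha ih =>
    rw [Finset.sum_insert ha, Finset.sum_insert ha]
    exact (nm_add_le v _ _).trans (by linarith)

theorem v_pow_sub_one {μ : K} {s : ℝ} (h : v (μ - 1) ≤ s) (m : ℕ) : v (μ ^ m - 1) ≤ (1 + s) ^ m - 1 := by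
  induction m with
  | zero => simp
  | succ m ih =>
    have e : μ ^ (m+1) - 1 = (μ ^ m - 1) * (μ - 1) + (μ ^ m - 1) + (μ - 1) := by ring
    rw [e]
    have h2 := v.add_le ((μ ^ m - 1) * (μ - 1) + (μ ^ m - 1)) (μ - 1)
    have h3 := v.add_le ((μ ^ m - 1) * (μ - 1)) (μ ^ m - 1)
    rw [map_mul] at h3
    have := mul_le_mul ih h (v.nonneg _) ((v.nonneg _).trans ih)
    rw [pow_succ]
    nlinarith

end

section
variable {ι : Type} [Fintype ι] [DecidableEq ι]

theorem tor_scalar {μ μ' : ℂ} {s : ℝ} {n : ℕ} (hs : 0 ≤ s) (hn : (1 + s) ^ n - 1 ≤ 1 / 2) (h : ‖μ - 1‖ ≤ s) (h' : ‖μ' - 1‖ ≤ s)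
    {j : ℕ} (h1 : 1 ≤ j) (hj : j ≤ n) (he : μ ^ j = μ' ^ j) : μ = μ' := by
  have hg := (Commute.all μ μ').mul_geom_sum₂ j
  rw [he, sub_self] at hg
  rcases mul_eq_zero.mp hg with h0 | h0
  · exact sub_eq_zero.mp h0
  exfalso
  have hterm : ∀ i ∈ Finset.range j, ‖μ ^ i * μ' ^ (j - 1 - i) - 1‖ ≤ 1 / 2 := by
    intro i hi
    rw [Finset.mem_range] at hi
    have a1 := v_pow_sub_one vC h i
    have a2 := v_pow_sub_one vC h' (j - 1 - i)
    rw [vC_apply] at a1 a2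
    have e : μ ^ i * μ' ^ (j - 1 - i) - 1 = (μ ^ i - 1) * (μ' ^ (j - 1 - i) - 1) + (μ ^ i - 1) + (μ' ^ (j - 1 - i) - 1) := by ring
    rw [e]
    have b1 := norm_add_le ((μ ^ i - 1) * (μ' ^ (j - 1 - i) - 1) + (μ ^ i - 1)) (μ' ^ (j - 1 - i) - 1)
    have b2 := norm_add_le ((μ ^ i - 1) * (μ' ^ (j - 1 - i) - 1)) (μ ^ i - 1)
    rw [norm_mul] at b2
    have b3 := mul_le_mul a1 a2 (norm_nonneg _) ((norm_nonneg _).trans a1)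
    have b4 : (1 + s) ^ i * (1 + s) ^ (j - 1 - i) ≤ (1 + s) ^ n := by
      rw [← pow_add]
      exact pow_le_pow_right₀ (by linarith) (by omega)
    nlinarith
  have hsum : ‖∑ i ∈ Finset.range j, (μ ^ i * μ' ^ (j - 1 - i) - 1)‖ ≤ j * (1 / 2) := by
    refine (norm_sum_le _ _).trans ((Finset.sum_le_sum hterm).trans (le_of_eq ?_))
    rw [Finset.sum_const, Finset.card_range, nsmul_eq_mul]
  rw [Finset.sum_sub_distrib, h0, zero_sub, norm_neg, Finset.sum_const, Finset.card_range, nsmul_eq_mul, mul_one,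
    Complex.norm_natCast] at hsum
  have : (1:ℝ) ≤ j := by exact_mod_cast h1
  linarith

theorem mem_closed_sub (B : Subalgebra ℂ (Matrix ι ι ℂ)) (x : Matrix ι ι ℂ)
    (h : ∀ ε : ℝ, 0 < ε → ∃ b ∈ B, nm vC (b - x) ≤ ε) : x ∈ B := by
  have hcl : IsClosed ((Subalgebra.toSubmodule B : Submodule ℂ (Matrix ι ι ℂ)) : Set (Matrix ι ι ℂ)) :=
    Submodule.closed_of_finiteDimensional _
  have h' : ∀ m : ℕ, ∃ b ∈ B, nm vC (b - x) ≤ 1 / (m + 1 : ℝ) := fun m => h _ (by positivity)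
  choose b hb hbx using h'
  have ht : Filter.Tendsto b Filter.atTop (nhds x) := by
    refine tendsto_pi_nhds.mpr fun i => tendsto_pi_nhds.mpr fun j => ?_
    rw [tendsto_iff_norm_sub_tendsto_zero]
    refine squeeze_zero (fun _ => norm_nonneg _) (fun m => ?_) tendsto_one_div_add_atTop_nhds_zero_nat
    exact (entry_le vC (b m - x) i j).trans (hbx m)
  exact hcl.mem_of_tendsto ht (Filter.Eventually.of_forall hb)

theorem root_adjoin {x : Matrix ι ι ℂ} {e : ℕ} (he : 1 ≤ e) {η : ℝ} (hη : 0 < η) (hs : (1 + 2 * η) ^ e - 1 ≤ 1 / 2)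
    (hx : nm vC (x - 1) ≤ η) : x ∈ Algebra.adjoin ℂ {x ^ e} := by
  have heR : (0:ℝ) < e := by exact_mod_cast he
  have heC : (e : ℂ) ≠ 0 := by exact_mod_cast (by omega : e ≠ 0)
  obtain ⟨B, hB⟩ : ∃ B, B = Algebra.adjoin ℂ {x ^ e} := ⟨_, rfl⟩
  rw [← hB]
  have hy : x ^ e ∈ B := by rw [hB]; exact Algebra.subset_adjoin rfl
  have key : ∀ m : ℕ, ∃ b ∈ B, Commute b x ∧ nm vC (b - x) ≤ (1/2) ^ m * η := by
    intro m
    induction m with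
    | zero =>
      refine ⟨1, B.one_mem, Commute.one_left _, ?_⟩
      rw [pow_zero, one_mul, ← neg_sub, nm_neg]; exact hx
    | succ m ih =>
      obtain ⟨b, hbB, hbx, hb⟩ := ih
      refine ⟨b - (e : ℂ)⁻¹ • (b ^ e - x ^ e), B.sub_mem hbB (B.smul_mem (B.sub_mem (B.pow_mem hbB e) hy) _), ?_, ?_⟩
      · exact hbx.sub_left (((hbx.pow_left e).sub_left ((Commute.refl x).pow_left e)).smul_left _)
      · have hb1 : nm vC (b - 1) ≤ 2 * η := by
          have e1 : b - 1 = (b - x) + (x - 1) := by abel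
          rw [e1]
          have h1 := nm_add_le vC (b - x) (x - 1)
          have h2 : (1/2 : ℝ) ^ m ≤ 1 := pow_le_one₀ (by norm_num) (by norm_num)
          nlinarith
        have e1 : b - (e : ℂ)⁻¹ • (b ^ e - x ^ e) - x = (b - x) *
            ((e : ℂ)⁻¹ • ∑ i ∈ Finset.range e, (1 - b ^ i * x ^ (e - 1 - i))) := by
          have e2 := hbx.mul_geom_sum₂ e
          have e3 : (e : ℂ)⁻¹ • (e : ℂ) • (b - x) = b - x := by rw [smul_smul, inv_mul_cancel₀ heC, one_smul]
          rw [Finset.sum_sub_distrib, Finset.sum_const, Finset.card_range, mul_smul_comm, mul_sub, e2,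
            ← Nat.cast_smul_eq_nsmul ℂ, mul_smul_comm, mul_one, smul_sub (e : ℂ)⁻¹ ((e : ℂ) • (b - x)), e3]
          abel
        rw [e1]
        have h3 : nm vC ((e : ℂ)⁻¹ • ∑ i ∈ Finset.range e, (1 - b ^ i * x ^ (e - 1 - i))) ≤ 1 / 2 := by
          rw [nm_smul, vC_apply, norm_inv, Complex.norm_natCast]
          have h4 : nm vC (∑ i ∈ Finset.range e, (1 - b ^ i * x ^ (e - 1 - i))) ≤ e * (1 / 2) := by
            refine (nm_sum_le vC _ _).trans ((Finset.sum_le_sum (g := fun _ => (1/2 : ℝ)) ?_).trans (le_of_eq ?_))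
            · intro i hi
              rw [Finset.mem_range] at hi
              rw [← neg_sub, nm_neg]
              refine (nm_mul_sub_one vC (nm_pow_sub_one vC hb1 i)
                (nm_pow_sub_one vC (hx.trans (by linarith : η ≤ 2 * η)) (e - 1 - i))).trans ?_
              rw [add_sub_cancel, add_sub_cancel, ← pow_add]
              have : (1 + 2 * η) ^ (i + (e - 1 - i)) ≤ (1 + 2 * η) ^ e := pow_le_pow_right₀ (by linarith) (by omega)
              linarith
            · rw [Finset.sum_const, Finset.card_range, nsmul_eq_mul]
          calc (e : ℝ)⁻¹ * nm vC (∑ i ∈ Finset.range e, (1 - b ^ i * x ^ (e - 1 - i))) ≤ (e : ℝ)⁻¹ * (e * (1 / 2)) := by gcongr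
            _ = 1 / 2 := by rw [← mul_assoc, inv_mul_cancel₀ heR.ne', one_mul]
        refine (nm_mul_le_of vC hb h3).trans (le_of_eq ?_)
        rw [pow_succ]; ring
  refine mem_closed_sub B x fun ε hε => ?_
  obtain ⟨m, hm⟩ := exists_pow_lt_of_lt_one (show 0 < ε / η by positivity) (show (1/2 : ℝ) < 1 by norm_num)
  obtain ⟨b, hb, _, hb'⟩ := key m
  exact ⟨b, hb, hb'.trans ((lt_div_iff₀ hη).mp hm).le⟩

theorem comm_contr {y c : (Matrix ι ι ℂ)ˣ} {s t : ℝ} (hs0 : 0 ≤ s) (hs : s ≤ 1 / 2) (hs' : 16 * (Fintype.card ι : ℝ) ^ 2 * s ≤ 1)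
    (hy : nm vC ((y : Matrix ι ι ℂ) - 1) ≤ s) (hc : nm vC ((c : Matrix ι ι ℂ) - 1) ≤ t) (ht : t ≤ 1 / 2) :
    nm vC (((y * c * y⁻¹ * c⁻¹ : (Matrix ι ι ℂ)ˣ) : Matrix ι ι ℂ) - 1) ≤ t / 2 := by
  have hinv : ∀ u : (Matrix ι ι ℂ)ˣ, nm vC ((u : Matrix ι ι ℂ) - 1) ≤ 1 / 2 →
      nm vC ((u⁻¹ : (Matrix ι ι ℂ)ˣ) : Matrix ι ι ℂ) ≤ 2 * Fintype.card ι := by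
    intro u hu
    have := inv_one_add_le vC hu
    rw [add_sub_cancel] at this
    rwa [Matrix.coe_units_inv]
  have e : ((y * c * y⁻¹ * c⁻¹ : (Matrix ι ι ℂ)ˣ) : Matrix ι ι ℂ) - 1 =
      (((y : Matrix ι ι ℂ) - 1) * ((c : Matrix ι ι ℂ) - 1) - ((c : Matrix ι ι ℂ) - 1) * ((y : Matrix ι ι ℂ) - 1)) *
        (((y⁻¹ : (Matrix ι ι ℂ)ˣ) : Matrix ι ι ℂ) * ((c⁻¹ : (Matrix ι ι ℂ)ˣ) : Matrix ι ι ℂ)) := by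
    have e1 : ((y : Matrix ι ι ℂ) - 1) * ((c : Matrix ι ι ℂ) - 1) - ((c : Matrix ι ι ℂ) - 1) * ((y : Matrix ι ι ℂ) - 1)
      = (y : Matrix ι ι ℂ) * c - (c : Matrix ι ι ℂ) * y := by noncomm_ring
    rw [e1, sub_mul]
    have e2 : (c : Matrix ι ι ℂ) * y * (((y⁻¹ : (Matrix ι ι ℂ)ˣ) : Matrix ι ι ℂ) * ((c⁻¹ : (Matrix ι ι ℂ)ˣ) : Matrix ι ι ℂ)) = 1 := by
      rw [← Units.val_mul, ← Units.val_mul, ← Units.val_mul, show c * y * (y⁻¹ * c⁻¹) = 1 by group, Units.val_one]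
    rw [e2]
    simp only [Units.val_mul, mul_assoc]
  rw [e]
  have ht0 : 0 ≤ t := (nm_nonneg _ _).trans hc
  have h1 := nm_mul_le_of vC (hinv y (hy.trans hs)) (hinv c (hc.trans ht))
  have h2 := (nm_sub_le vC _ _).trans (add_le_add (nm_mul_le_of vC hy hc) (nm_mul_le_of vC hc hy))
  refine (nm_mul_le_of vC h2 h1).trans ?_
  have : (s * t + t * s) * (2 * (Fintype.card ι : ℝ) * (2 * Fintype.card ι)) = (16 * (Fintype.card ι : ℝ) ^ 2 * s) * (t / 2) := by ring
  rw [this]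
  nlinarith

/-- The near-identity lemma. -/
theorem near_nilp (n e : ℕ) (he : 1 ≤ e) : ∃ η : ℝ, 0 < η ∧ ∀ (ι : Type) [Fintype ι] [DecidableEq ι], Fintype.card ι = n →
    ∀ X : Set (Matrix ι ι ℂ)ˣ, (∀ x ∈ X, nm vC ((x : Matrix ι ι ℂ) - 1) ≤ η) →
    (∃ δ : ℝ, 0 < δ ∧ ∀ k, 1 ≤ k → ∀ c : (Matrix ι ι ℂ)ˣ, c ∈ LN ((fun x : (Matrix ι ι ℂ)ˣ => x ^ e) '' X) k → nm vC ((c : Matrix ι ι ℂ) - 1) ≤ 1 / 2 →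
      nm vC (((c⁻¹ : (Matrix ι ι ℂ)ˣ) : Matrix ι ι ℂ) - 1) ≤ 2 * n + n →
      nm vC ((c : Matrix ι ι ℂ) - 1) < δ → c = 1) →
    Group.IsNilpotent (Subgroup.closure X) := by
  obtain ⟨s1, hs1, hs1n⟩ := small_pow n (show (0:ℝ) < 1 / 2 by norm_num)
  obtain ⟨s, hs⟩ : ∃ s, s = min (min (1/2) (1 / (16 * (n:ℝ)^2 + 1))) s1 := ⟨_, rfl⟩
  have hs0 : 0 < s := by rw [hs]; positivity
  have hs2 : s ≤ 1 / 2 := by rw [hs]; exact (min_le_left _ _).trans (min_le_left _ _)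
  have hs3 : 16 * (n:ℝ)^2 * s ≤ 1 := by
    have h1 : s ≤ 1 / (16 * (n:ℝ)^2 + 1) := by rw [hs]; exact (min_le_left _ _).trans (min_le_right _ _)
    rw [le_div_iff₀ (by positivity)] at h1
    nlinarith
  have hs4 : s ≤ s1 := by rw [hs]; exact min_le_right _ _
  obtain ⟨η, hη, hη'⟩ := small_pow e hs0
  refine ⟨η, hη, ?_⟩
  rintro ι _ _ hcard X hX ⟨δ, hδ, hδ'⟩
  obtain ⟨Y, hY⟩ : ∃ Y, Y = (fun x : (Matrix ι ι ℂ)ˣ => x ^ e) '' X := ⟨_, rfl⟩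
  have hYs : ∀ y ∈ Y, nm vC ((y : Matrix ι ι ℂ) - 1) ≤ s := by
    rw [hY]
    rintro _ ⟨x, hx, rfl⟩
    have := nm_pow_sub_one vC (hX x hx) e
    have h2 : (1 + η) ^ e ≤ (1 + 2 * η) ^ e := by gcongr; linarith
    rw [Units.val_pow_eq_pow_val]
    linarith
  have hLN : ∀ k, ∀ c ∈ LN Y k, nm vC ((c : Matrix ι ι ℂ) - 1) ≤ (1/2) ^ (k+1) := by
    intro k
    induction k with
    | zero => intro c hc; rw [zero_add, pow_one]; exact (hYs c hc).trans hs2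
    | succ k ih =>
      rintro _ ⟨y, hy, c, hc, rfl⟩
      refine (comm_contr hs0.le hs2 (by rw [hcard]; exact hs3) (hYs y hy) (ih c hc) ?_).trans (le_of_eq (by ring))
      rw [pow_succ]
      have : (1/2:ℝ)^k ≤ 1 := pow_le_one₀ (by norm_num) (by norm_num)
      linarith
  obtain ⟨r, hr⟩ := exists_pow_lt_of_lt_one hδ (show (1/2 : ℝ) < 1 by norm_num)
  have hLN1 : ∀ c ∈ LN Y (r+1), c = 1 := by
    intro c hc
    have h1 := hLN (r+1) c hc
    have h2 : nm vC ((c : Matrix ι ι ℂ) - 1) ≤ 1 / 2 := by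
      refine h1.trans ?_
      rw [pow_succ]
      have : (1/2:ℝ)^(r+1) ≤ 1 := pow_le_one₀ (by norm_num) (by norm_num)
      linarith
    refine hδ' (r+1) (by omega) c (by rw [← hY]; exact hc) h2 ?_ ?_
    · have h3 := inv_one_add_le vC h2
      rw [add_sub_cancel, hcard] at h3
      rw [Matrix.coe_units_inv]
      refine (nm_sub_le vC _ _).trans (add_le_add h3 ?_)
      rw [nm_one, hcard]
    · refine lt_of_le_of_lt h1 (lt_of_le_of_lt ?_ hr)
      exact pow_le_pow_of_le_one (by norm_num) (by norm_num) (by omega)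
  -- the representation
  obtain ⟨ρ, hρ⟩ : ∃ ρ : Subgroup.closure X →* Module.End ℂ (ι → ℂ), ∀ g, ρ g = Matrix.toLinAlgEquiv' ((g : (Matrix ι ι ℂ)ˣ) : Matrix ι ι ℂ) :=
    ⟨((Matrix.toLinAlgEquiv' : Matrix ι ι ℂ ≃ₐ[ℂ] _).toAlgHom.toMonoidHom.comp (Units.coeHom _)).comp (Subgroup.subtype _), fun g => rfl⟩
  obtain ⟨D, hD⟩ : ∃ D : Set (Subgroup.closure X), D = Subtype.val ⁻¹' X := ⟨_, rfl⟩
  have hLD : LN ((fun x : (Matrix ι ι ℂ)ˣ => x ^ e) '' X) = LN ((Subgroup.subtype (Subgroup.closure X)) '' ((fun x : Subgroup.closure X => x ^ e) '' D)) := by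
    congr 1
    ext g
    constructor
    · rintro ⟨x, hx, rfl⟩
      exact ⟨⟨x, Subgroup.subset_closure hx⟩ ^ e, ⟨⟨x, Subgroup.subset_closure hx⟩, by rw [hD]; exact hx, rfl⟩, by simp⟩
    · rintro ⟨_, ⟨x, hx, rfl⟩, rfl⟩
      rw [hD] at hx
      exact ⟨x, hx, by simp⟩
  have hTH : TH ρ D e (r+1) := by
    refine ⟨?_, ?_, ?_, ?_⟩
    · rw [hD]; exact Subgroup.closure_closure_coe_preimage
    · intro x hx
      rw [hD] at hx
      have h1 := root_adjoin he hη (hη'.trans hs2) (hX x hx)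
      have h2 : Matrix.toLinAlgEquiv' ((x : (Matrix ι ι ℂ)ˣ) : Matrix ι ι ℂ) ∈
          (Algebra.adjoin ℂ {((x : (Matrix ι ι ℂ)ˣ) : Matrix ι ι ℂ) ^ e}).map ((Matrix.toLinAlgEquiv' : Matrix ι ι ℂ ≃ₐ[ℂ] _).toAlgHom) :=
        ⟨_, h1, rfl⟩
      rw [AlgHom.map_adjoin, Set.image_singleton] at h2
      rw [hρ, hρ]
      exact h2
    · intro x hx μ μ' hμ hμ' j h1 hj hjj
      rw [hD] at hx
      rw [Module.finrank_fintype_fun_eq_card, hcard] at hj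
      have hev : ∀ μ : ℂ, (ρ (x ^ e)).HasEigenvalue μ → ‖μ - 1‖ ≤ s := by
        intro μ hμ
        obtain ⟨w, hw⟩ := hμ.exists_hasEigenvector
        have h2 := hw.apply_eq_smul
        have h3 := hYs (x ^ e) (by rw [hY]; exact ⟨x, hx, rfl⟩)
        refine le_trans ?_ h3
        rw [← vC_apply]
        apply root_le
        rw [Polynomial.IsRoot, Matrix.eval_charpoly]
        refine Matrix.exists_mulVec_eq_zero_iff.mp ⟨w, hw.2, ?_⟩
        rw [hρ] at h2
        have h4 : (((x ^ e : Subgroup.closure X) : (Matrix ι ι ℂ)ˣ) : Matrix ι ι ℂ) *ᵥ w = μ • w := h2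
        rw [Subgroup.coe_pow] at h4
        rw [Matrix.sub_mulVec, Matrix.sub_mulVec, h4, Matrix.one_mulVec]
        ext i
        simp [Matrix.scalar_apply, Matrix.mulVec_diagonal, sub_mul]
      refine tor_scalar hs0.le ?_ (hev μ hμ) (hev μ' hμ') h1 hj hjj
      have : (1 + s) ^ n ≤ (1 + 2 * s1) ^ n := by gcongr; linarith
      linarith
    · intro c hc
      have h1 : (c : (Matrix ι ι ℂ)ˣ) ∈ LN Y (r+1) := by
        rw [hY, hLD, LN_map]
        exact ⟨c, hc, rfl⟩
      rw [hρ, hLN1 _ h1, Units.val_one, map_one]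
  obtain ⟨c, hc⟩ := hTH.main
  rw [Subgroup.nilpotent_iff_lowerCentralSeries]
  refine ⟨c, ?_⟩
  rw [eq_bot_iff]
  intro g hg
  have h1 := hc g hg
  rw [hρ] at h1
  rw [Subgroup.mem_bot]
  apply Subtype.ext
  apply Units.ext
  apply (Matrix.toLinAlgEquiv' : Matrix ι ι ℂ ≃ₐ[ℂ] _).injective
  rw [h1]; simp

end
end EG

namespace EG

theorem comm_closure {L : Type*} [Group L] {S T : Set L} (h : ∀ s ∈ S, ∀ t ∈ T, Commute s t) :
    ∀ s ∈ Subgroup.closure S, ∀ t ∈ Subgroup.closure T, Commute s t := by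
  intro s hs t ht
  induction hs using Subgroup.closure_induction with
  | mem x hx =>
    induction ht using Subgroup.closure_induction with
    | mem y hy => exact h x hx y hy
    | one => exact Commute.one_right _
    | mul y y' _ _ h1 h2 => exact h1.mul_right h2
    | inv y _ h1 => exact h1.inv_right
  | one => exact Commute.one_left _
  | mul y y' _ _ h1 h2 => exact h1.mul_left h2
  | inv y _ h1 => exact h1.inv_left

theorem commutator_central {L : Type*} [Group L] {b b' z z' : L} (h1 : Commute z b) (h2 : Commute z b')
    (h3 : Commute z' b) (h4 : Commute z' b') (h5 : Commute z z') :
    (b * z) * (b' * z') * (b * z)⁻¹ * (b' * z')⁻¹ = b * b' * b⁻¹ * b'⁻¹ := by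
  have e1 : (b * z) * (b' * z') = (b * b') * (z * z') := by
    rw [mul_assoc, ← mul_assoc z, h2.eq]; simp only [mul_assoc]
  have e2 : (b * z)⁻¹ * (b' * z')⁻¹ = (z * z')⁻¹ * (b⁻¹ * b'⁻¹) := by
    rw [← _root_.mul_inv_rev, ← _root_.mul_inv_rev, ← _root_.mul_inv_rev]
    congr 1
    have : (b' * z') * (b * z) = (b' * b) * (z' * z) := by
      rw [mul_assoc, ← mul_assoc z', h3.eq]; simp only [mul_assoc]
    rw [this, h5.eq]
  rw [mul_assoc, e1, e2]
  group

theorem nilp_of_central {L : Type*} [Group L] {J : Type*} (x ζ : J → L) (h1 : ∀ i j, Commute (ζ i) (ζ j))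
    (h2 : ∀ i j, Commute (ζ i) (x j)) (h : Group.IsNilpotent (Subgroup.closure (Set.range fun i => x i * ζ i))) :
    Group.IsNilpotent (Subgroup.closure (Set.range x)) := by
  obtain ⟨A, hA⟩ : ∃ A, A = Subgroup.closure (Set.range x) := ⟨_, rfl⟩
  obtain ⟨B, hB⟩ : ∃ B, B = Subgroup.closure (Set.range fun i => x i * ζ i) := ⟨_, rfl⟩
  obtain ⟨Z, hZ⟩ : ∃ Z, Z = Subgroup.closure (Set.range ζ) := ⟨_, rfl⟩
  have hZZ : ∀ z ∈ Z, ∀ z' ∈ Z, Commute z z' := by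
    rw [hZ]; apply comm_closure; rintro _ ⟨i, rfl⟩ _ ⟨j, rfl⟩; exact h1 i j
  have hZA : ∀ z ∈ Z, ∀ a ∈ A, Commute z a := by
    rw [hZ, hA]; apply comm_closure; rintro _ ⟨i, rfl⟩ _ ⟨j, rfl⟩; exact h2 i j
  have hZB : ∀ z ∈ Z, ∀ a ∈ B, Commute z a := by
    rw [hZ, hB]; apply comm_closure; rintro _ ⟨i, rfl⟩ _ ⟨j, rfl⟩; exact (h2 i j).mul_right (h1 i j)
  have gen : ∀ (n : ℕ) (X : Set L), (∀ g ∈ X, ∃ b ∈ B.lowerCentralSeries n, ∃ z ∈ Z, g = b * z) →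
      ∀ g ∈ Subgroup.closure X, ∃ b ∈ B.lowerCentralSeries n, ∃ z ∈ Z, g = b * z := by
    intro n X hX g hg
    have hle := Subgroup.lowerCentralSeries_le_self B n
    induction hg using Subgroup.closure_induction with
    | mem y hy => exact hX y hy
    | one => exact ⟨1, one_mem _, 1, one_mem _, by simp⟩
    | mul y y' _ _ i1 i2 =>
      obtain ⟨b, hb, z, hz, rfl⟩ := i1
      obtain ⟨b', hb', z', hz', rfl⟩ := i2
      refine ⟨b * b', mul_mem hb hb', z * z', mul_mem hz hz', ?_⟩
      rw [mul_assoc, ← mul_assoc z, (hZB z hz b' (hle hb')).eq]; simp only [mul_assoc]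
    | inv y _ i1 =>
      obtain ⟨b, hb, z, hz, rfl⟩ := i1
      refine ⟨b⁻¹, inv_mem hb, z⁻¹, inv_mem hz, ?_⟩
      rw [← (hZB z hz b (hle hb)).eq, _root_.mul_inv_rev]
  have key : ∀ n, ∀ g ∈ A.lowerCentralSeries n, ∃ b ∈ B.lowerCentralSeries n, ∃ z ∈ Z, g = b * z := by
    have k0 : ∀ g ∈ A, ∃ b ∈ B, ∃ z ∈ Z, g = b * z := by
      intro g hg
      rw [hA] at hg
      refine gen 0 _ ?_ g hg
      rintro _ ⟨i, rfl⟩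
      refine ⟨x i * ζ i, ?_, (ζ i)⁻¹, ?_, by simp⟩
      · rw [hB]; exact Subgroup.subset_closure ⟨i, rfl⟩
      · rw [hZ]; exact inv_mem (Subgroup.subset_closure ⟨i, rfl⟩)
    intro n
    induction n with
    | zero => exact k0
    | succ n ih =>
      intro g hg
      rw [Subgroup.mem_lowerCentralSeries_succ_iff] at hg
      refine gen (n+1) _ ?_ g hg
      rintro _ ⟨p, hp, q, hq, rfl⟩
      obtain ⟨b, hb, z, hz, rfl⟩ := ih p hp
      obtain ⟨b', hb', z', hz', rfl⟩ := k0 q hq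
      have hbB := Subgroup.lowerCentralSeries_le_self B n hb
      refine ⟨b * b' * b⁻¹ * b'⁻¹, ?_, 1, one_mem _, ?_⟩
      · rw [Subgroup.mem_lowerCentralSeries_succ_iff]
        exact Subgroup.subset_closure ⟨b, hb, b', hb', rfl⟩
      · rw [mul_one]
        exact commutator_central (hZB z hz b hbB) (hZB z hz b' hb') (hZB z' hz' b hbB) (hZB z' hz' b' hb') (hZZ z hz z' hz')
  rw [← hB, Subgroup.isNilpotent_iff_lowerCentralSeries] at h
  obtain ⟨n, hn⟩ := h
  rw [← hA, Subgroup.isNilpotent_iff_lowerCentralSeries]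
  refine ⟨n+1, ?_⟩
  rw [Subgroup.lowerCentralSeries_succ, eq_bot_iff, Subgroup.commutator_le]
  intro p hp q hq
  obtain ⟨b, hb, z, hz, rfl⟩ := key n p hp
  rw [hn, Subgroup.mem_bot] at hb
  rw [hb, one_mul, Subgroup.mem_bot, commutatorElement_eq_one_iff_commute]
  exact hZA z hz q hq

theorem LN_central {G L : Type*} [Group G] [Group L] {J : Type*} (Ψ : G →* L) (a : J → G) (ζ : J → L) (e : ℕ)
    (h1 : ∀ i j, Commute (ζ i) (ζ j)) (h2 : ∀ i g, Commute (ζ i) (Ψ g)) (k : ℕ) (c : L)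
    (hc : c ∈ LN ((fun x : L => x ^ e) '' (Set.range fun i => Ψ (a i) * ζ i)) (k + 1)) :
    ∃ g ∈ LN (Set.range fun i => a i ^ e) (k + 1), c = Ψ g := by
  obtain ⟨Z, hZ⟩ : ∃ Z, Z = Subgroup.closure (Set.range ζ) := ⟨_, rfl⟩
  have hZZ : ∀ z ∈ Z, ∀ z' ∈ Z, Commute z z' := by
    rw [hZ]; apply comm_closure; rintro _ ⟨i, rfl⟩ _ ⟨j, rfl⟩; exact h1 i j
  have hZG : ∀ z ∈ Z, ∀ g, Commute z (Ψ g) := by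
    intro z hz g
    rw [hZ] at hz
    refine comm_closure (T := Set.range Ψ) ?_ z hz _ (Subgroup.subset_closure ⟨g, rfl⟩)
    rintro _ ⟨i, rfl⟩ _ ⟨j, rfl⟩; exact h2 i j
  have base : ∀ y ∈ ((fun x : L => x ^ e) '' (Set.range fun i => Ψ (a i) * ζ i)),
      ∃ g ∈ (Set.range fun i => a i ^ e), ∃ z ∈ Z, y = Ψ g * z := by
    rintro _ ⟨_, ⟨i, rfl⟩, rfl⟩
    refine ⟨a i ^ e, ⟨i, rfl⟩, ζ i ^ e, ?_, ?_⟩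
    · rw [hZ]; exact pow_mem (Subgroup.subset_closure (Set.mem_range_self i)) e
    · show (Ψ (a i) * ζ i) ^ e = _
      rw [(h2 i (a i)).symm.mul_pow, map_pow]
  have step : ∀ k, (∀ c ∈ LN ((fun x : L => x ^ e) '' (Set.range fun i => Ψ (a i) * ζ i)) k,
      ∃ g ∈ LN (Set.range fun i => a i ^ e) k, ∃ z ∈ Z, c = Ψ g * z) →
      ∀ c ∈ LN ((fun x : L => x ^ e) '' (Set.range fun i => Ψ (a i) * ζ i)) (k + 1),
      ∃ g ∈ LN (Set.range fun i => a i ^ e) (k + 1), c = Ψ g := by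
    rintro k ih _ ⟨y, hy, c, hc, rfl⟩
    obtain ⟨p, hp, z, hz, rfl⟩ := base y hy
    obtain ⟨q, hq, z', hz', rfl⟩ := ih c hc
    refine ⟨p * q * p⁻¹ * q⁻¹, ⟨p, hp, q, hq, rfl⟩, ?_⟩
    rw [commutator_central (hZG z hz p) (hZG z hz q) (hZG z' hz' p) (hZG z' hz' q) (hZZ z hz z' hz')]
    simp only [map_mul, map_inv]
  have all : ∀ k, ∀ c ∈ LN ((fun x : L => x ^ e) '' (Set.range fun i => Ψ (a i) * ζ i)) k,
      ∃ g ∈ LN (Set.range fun i => a i ^ e) k, ∃ z ∈ Z, c = Ψ g * z := by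
    intro k
    induction k with
    | zero => exact base
    | succ k ih =>
      intro c hc
      obtain ⟨g, hg, e1⟩ := step k ih c hc
      exact ⟨g, hg, 1, one_mem _, by rw [mul_one]; exact e1⟩
  exact step k (all k) c hc

theorem LN_sub {G : Type*} [Group G] {Y : Set G} {H T : Subgroup G} (hY : ∀ y ∈ Y, y ∈ H)
    (hT : ∀ x ∈ H, ∀ y ∈ H, x * y * x⁻¹ * y⁻¹ ∈ T) (k : ℕ) : ∀ c ∈ LN Y (k + 1), c ∈ T := by
  have all : ∀ k, ∀ c ∈ LN Y k, c ∈ H := by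
    intro k
    induction k with
    | zero => exact hY
    | succ k ih =>
      rintro _ ⟨y, hy, c, hc, rfl⟩
      have a := hY y hy
      have b := ih c hc
      exact mul_mem (mul_mem (mul_mem a b) (inv_mem a)) (inv_mem b)
  rintro _ ⟨y, hy, c, hc, rfl⟩
  exact hT y (hY y hy) c (all k c hc)

theorem virt_nilp {Γ : Type*} [Group Γ] (H : Subgroup Γ) (hH : H.index ≠ 0) (c : ℕ)
    (hF : (H.lowerCentralSeries c : Set Γ).Finite) : ∃ C : Subgroup Γ, C.FiniteIndex ∧ Group.IsNilpotent C := by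
  obtain ⟨F, hFd⟩ : ∃ F, F = (⊤ : Subgroup H).lowerCentralSeries c := ⟨_, rfl⟩
  have hn : F.Normal := by rw [hFd]; infer_instance
  have hfin : Finite F := by
    rw [← Subgroup.top_subtype_lowerCentralSeries, ← hFd, Subgroup.coe_map] at hF
    exact (Set.Finite.of_finite_image hF Subtype.val_injective.injOn).to_subtype
  obtain ⟨C, hC⟩ : ∃ C, C = (MulAut.conjNormal : H →* MulAut F).ker := ⟨_, rfl⟩
  have hfa : Finite (MulAut F) := Finite.of_injective (fun f : MulAut F => (f : F → F)) DFunLike.coe_injective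
  have hCi : C.FiniteIndex := by rw [hC]; exact Subgroup.finiteIndex_ker _
  have hcomm : ∀ x ∈ F, ∀ g ∈ C, Commute x g := by
    intro x hx g hg
    rw [hC, MonoidHom.mem_ker] at hg
    have h1 := congrArg (fun f : MulAut F => ((f ⟨x, hx⟩ : F) : H)) hg
    simp only [MulAut.conjNormal_apply, MulAut.one_apply] at h1
    have : g * x = x * g := by rw [← mul_inv_eq_iff_eq_mul]; exact h1
    exact this.symm
  have hCn : Group.IsNilpotent C := by
    rw [Subgroup.isNilpotent_iff_lowerCentralSeries]
    refine ⟨c+1, ?_⟩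
    rw [Subgroup.lowerCentralSeries_succ, eq_bot_iff, Subgroup.commutator_le]
    intro p hp q hq
    rw [Subgroup.mem_bot, commutatorElement_eq_one_iff_commute]
    refine hcomm p ?_ q hq
    rw [hFd]
    exact Subgroup.lowerCentralSeries_mono c le_top hp
  refine ⟨C.map H.subtype, ⟨?_⟩, ?_⟩
  · rw [Subgroup.index_map_subtype]
    exact mul_ne_zero hCi.index_ne_zero hH
  · exact Group.nilpotent_of_mulEquiv (C.equivMapOfInjective H.subtype Subtype.val_injective)

end EG

namespace EG

theorem cover (d : ℕ) (R τ : ℝ) (hτ : 0 < τ) : ∃ M : ℕ, 1 ≤ M ∧ ∀ (ι : Type) [Fintype ι] [DecidableEq ι], Fintype.card ι = d →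
    ∀ f : Fin (M + 1) → Matrix ι ι ℂ, (∀ i, nm vC (f i) ≤ R) → ∃ i j, i ≠ j ∧ nm vC (f i - f j) ≤ τ := by
  obtain ⟨t, ht0, ht⟩ : ∃ t : ℝ, 0 < t ∧ (d : ℝ) ^ 2 * (2 * t) ≤ τ := by
    refine ⟨τ / (2 * ((d:ℝ) ^ 2 + 1)), by positivity, ?_⟩
    have : (d : ℝ) ^ 2 * (2 * (τ / (2 * ((d:ℝ) ^ 2 + 1)))) = τ * ((d:ℝ)^2 / ((d:ℝ)^2 + 1)) := by field_simp
    rw [this]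
    have h2 : (d:ℝ)^2 / ((d:ℝ)^2 + 1) ≤ 1 := by rw [div_le_one (by positivity)]; linarith
    nlinarith
  have hc : IsCompact (Metric.closedBall (0 : Fin d → Fin d → ℂ) |R|) := isCompact_closedBall _ _
  obtain ⟨F, hF, hcov⟩ := (Metric.totallyBounded_iff.mp hc.totallyBounded) t ht0
  refine ⟨hF.toFinset.card + 1, by omega, ?_⟩
  intro ι _ _ hcard f hf
  obtain ⟨σ⟩ : Nonempty (Fin d ≃ ι) := ⟨(Fintype.equivFinOfCardEq hcard).symm⟩
  have hin : ∀ i, (fun a b => f i (σ a) (σ b)) ∈ Metric.closedBall (0 : Fin d → Fin d → ℂ) |R| := by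
    intro i
    rw [mem_closedBall_zero_iff]
    refine (pi_norm_le_iff_of_nonneg (abs_nonneg _)).mpr fun a => (pi_norm_le_iff_of_nonneg (abs_nonneg _)).mpr fun b => ?_
    exact ((entry_le vC (f i) (σ a) (σ b)).trans (hf i)).trans (le_abs_self _)
  have hch : ∀ i, ∃ y ∈ F, (fun a b => f i (σ a) (σ b)) ∈ Metric.ball y t := by
    intro i
    have := hcov (hin i)
    simpa only [Set.mem_iUnion, exists_prop] using this
  choose y hyF hy using hch
  obtain ⟨i, -, j, -, hij, hyy⟩ := Finset.exists_ne_map_eq_of_card_lt_of_maps_to (s := Finset.univ) (t := hF.toFinset) (f := y)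
    (by rw [Finset.card_univ, Fintype.card_fin]; omega) (fun i _ => by simpa using hyF i)
  refine ⟨i, j, hij, ?_⟩
  have hd : dist (fun a b => f i (σ a) (σ b)) (fun a b => f j (σ a) (σ b)) ≤ 2 * t := by
    have h1 := hy i
    have h2 := hy j
    rw [← hyy] at h2
    rw [Metric.mem_ball] at h1 h2
    have := dist_triangle_right (fun a b => f i (σ a) (σ b)) (fun a b => f j (σ a) (σ b)) (y i)
    linarith
  refine le_trans (nm_le_sqcard vC (c := 2 * t) ?_) ?_
  · intro p q
    have h1 := (dist_le_pi_dist _ _ (σ.symm q)).trans ((dist_le_pi_dist _ _ (σ.symm p)).trans hd)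
    rw [dist_eq_norm] at h1
    rw [vC_apply]
    simpa using h1
  · rw [hcard]; exact ht

theorem gl_compact (d : ℕ) (k : Type) [NontriviallyNormedField k] [LocallyCompactSpace k] (C : ℝ) :
    IsCompact {u : GL (Fin d) k | (∀ i j, ‖(u : Matrix (Fin d) (Fin d) k) i j‖ ≤ C) ∧
      ∀ i j, ‖((u⁻¹ : GL (Fin d) k) : Matrix (Fin d) (Fin d) k) i j‖ ≤ C} := by
  have hp : ProperSpace k := ProperSpace.of_locallyCompactSpace k
  have hB : IsCompact {A : Matrix (Fin d) (Fin d) k | ∀ i j, ‖A i j‖ ≤ C} := by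
    have h1 : IsCompact (Set.pi Set.univ fun _ : Fin d => Set.pi Set.univ fun _ : Fin d => Metric.closedBall (0:k) C) :=
      isCompact_univ_pi fun _ => isCompact_univ_pi fun _ => isCompact_closedBall _ _
    have : {A : Matrix (Fin d) (Fin d) k | ∀ i j, ‖A i j‖ ≤ C} =
        (Set.pi Set.univ fun _ : Fin d => Set.pi Set.univ fun _ : Fin d => Metric.closedBall (0:k) C) := by
      ext A
      constructor
      · intro h i _ j _
        rw [mem_closedBall_zero_iff]; exact h i j
      · intro h i j
        have := h i trivial j trivial
        rwa [mem_closedBall_zero_iff] at this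
    rw [this]; exact h1
  have hB2 := hB.image (MulOpposite.continuous_op)
  have h3 := (Units.isClosedEmbedding_embedProduct (α := Matrix (Fin d) (Fin d) k)).isCompact_preimage (hB.prod hB2)
  convert h3 using 1
  ext u
  constructor
  · rintro ⟨a, b⟩
    exact ⟨a, _, b, rfl⟩
  · rintro ⟨a, x, b, hx⟩
    have hx' : x = ((u⁻¹ : GL (Fin d) k) : Matrix (Fin d) (Fin d) k) := MulOpposite.op_injective hx
    rw [hx'] at b
    exact ⟨a, b⟩

theorem discrete_finite {d n : ℕ} {k : Fin n → Type} [∀ i, NontriviallyNormedField (k i)] [∀ i, LocallyCompactSpace (k i)]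
    (Γ : Subgroup (GL (Fin d) ℝ × ((i : Fin n) → GL (Fin d) (k i)))) (hΓ : DiscreteTopology Γ) (C : ℝ) (C' : Fin n → ℝ) :
    {γ : Γ | (∀ i j, ‖(γ.1.1 : Matrix (Fin d) (Fin d) ℝ) i j‖ ≤ C) ∧
      (∀ i j, ‖((γ.1.1⁻¹ : GL (Fin d) ℝ) : Matrix (Fin d) (Fin d) ℝ) i j‖ ≤ C) ∧
      ∀ l, (∀ i j, ‖(γ.1.2 l : Matrix (Fin d) (Fin d) (k l)) i j‖ ≤ C' l) ∧
      ∀ i j, ‖(((γ.1.2 l)⁻¹ : GL (Fin d) (k l)) : Matrix (Fin d) (Fin d) (k l)) i j‖ ≤ C' l}.Finite := by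
  have hK := (gl_compact d ℝ C).prod (isCompact_univ_pi fun l => gl_compact d (k l) (C' l))
  have hcl : IsClosed (Γ : Set (GL (Fin d) ℝ × ((i : Fin n) → GL (Fin d) (k i)))) := Subgroup.isClosed_of_discrete
  have hemb : Topology.IsClosedEmbedding (Subtype.val : Γ → GL (Fin d) ℝ × ((i : Fin n) → GL (Fin d) (k i))) :=
    hcl.isClosedEmbedding_subtypeVal
  have h1 := (hemb.isCompact_preimage hK).finite_of_discrete
  refine h1.subset ?_
  rintro γ ⟨a, b, c⟩
  refine ⟨⟨a, b⟩, ?_⟩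
  intro l _
  exact c l

theorem gap {L : Type*} (E : Set L) (hE : E.Finite) (q : L → ℝ) : ∃ δ : ℝ, 0 < δ ∧ ∀ c ∈ E, q c < δ → q c ≤ 0 := by
  induction E, hE using Set.Finite.induction_on with
  | empty => exact ⟨1, one_pos, by simp⟩
  | @insert a s _ _ ih =>
    obtain ⟨δ, h0, h⟩ := ih
    by_cases ha : q a ≤ 0
    · refine ⟨δ, h0, ?_⟩
      rintro c (rfl | hc) h1
      · exact ha
      · exact h c hc h1
    · push Not at ha
      refine ⟨min δ (q a), lt_min h0 ha, ?_⟩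
      rintro c (rfl | hc) h1
      · exact absurd (h1.trans_le (min_le_right _ _)) (lt_irrefl _)
      · exact h c hc (h1.trans_le (min_le_left _ _))

end EG

namespace EG

def conjHom {ι : Type} [Fintype ι] [DecidableEq ι] {d : ℕ} (P : Matrix ι (Fin d) ℂ) (P' : Matrix (Fin d) ι ℂ)
    (h : P * P' = 1) (h' : P' * P = 1) : Matrix (Fin d) (Fin d) ℂ →* Matrix ι ι ℂ where
  toFun A := P * A * P'
  map_one' := by rw [Matrix.mul_one, h]
  map_mul' A B := by
    calc P * (A * B) * P' = P * A * (1 : Matrix (Fin d) (Fin d) ℂ) * B * P' := by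
          rw [Matrix.mul_one, ← Matrix.mul_assoc P A B]
      _ = P * A * (P' * P) * B * P' := by rw [h']
      _ = P * A * P' * (P * B * P') := by simp only [Matrix.mul_assoc]

theorem conjHom_apply {ι : Type} [Fintype ι] [DecidableEq ι] {d : ℕ} (P : Matrix ι (Fin d) ℂ) (P' : Matrix (Fin d) ι ℂ)
    (h : P * P' = 1) (h' : P' * P = 1) (A : Matrix (Fin d) (Fin d) ℂ) : conjHom P P' h h' A = P * A * P' := rfl

theorem real_step {d : ℕ} {ι : Type} [Fintype ι] [DecidableEq ι] (P : Matrix ι (Fin d) ℂ) (P' : Matrix (Fin d) ι ℂ)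
    (hP : P * P' = 1) (hP' : P' * P = 1) {G : Type} [Group G] (φ : G →* Matrix (Fin d) (Fin d) ℂ)
    (z : G → (Matrix (Fin d) (Fin d) ℂ)ˣ)
    (hz : ∀ g h, Commute (z g : Matrix (Fin d) (Fin d) ℂ) (z h : Matrix (Fin d) (Fin d) ℂ))
    (hzφ : ∀ g h, Commute (z g : Matrix (Fin d) (Fin d) ℂ) (φ h))
    (S : Set G) (h1 : (1 : G) ∈ S) (hS : Subgroup.closure S = ⊤) (M : ℕ) (R τ η : ℝ) (hR : R * τ ≤ η)
    (hb : ∀ w ∈ S ^ M, nm vC (P * (φ w * (z w : Matrix (Fin d) (Fin d) ℂ)) * P') ≤ R ∧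
      nm vC (P * (φ w⁻¹ * (((z w)⁻¹ : (Matrix (Fin d) (Fin d) ℂ)ˣ) : Matrix (Fin d) (Fin d) ℂ)) * P') ≤ R)
    (hcov : ∀ f : Fin (M + 1) → Matrix ι ι ℂ, (∀ i, nm vC (f i) ≤ R) → ∃ i j, i ≠ j ∧ nm vC (f i - f j) ≤ τ) :
    ∃ (J : Type) (a : J → G) (ζ : J → (Matrix ι ι ℂ)ˣ) (Ψ : G →* (Matrix ι ι ℂ)ˣ),
      (∀ g, (Ψ g : Matrix ι ι ℂ) = P * φ g * P') ∧ (Subgroup.closure (Set.range a)).index ≠ 0 ∧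
      (∀ i j, Commute (ζ i) (ζ j)) ∧ (∀ i g, Commute (ζ i) (Ψ g)) ∧
      ∀ i, nm vC (((Ψ (a i) * ζ i : (Matrix ι ι ℂ)ˣ) : Matrix ι ι ℂ) - 1) ≤ η := by
  obtain ⟨A, hA⟩ : ∃ A : G → Matrix ι ι ℂ, ∀ w, A w = P * (φ w * (z w : Matrix (Fin d) (Fin d) ℂ)) * P' := ⟨_, fun _ => rfl⟩
  obtain ⟨Φ, hΦ⟩ : ∃ Φ : G →* (Matrix (Fin d) (Fin d) ℂ)ˣ, ∀ g, (Φ g : Matrix (Fin d) (Fin d) ℂ) = φ g :=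
    ⟨φ.toHomUnits, fun g => rfl⟩
  obtain ⟨Θ, hΘ⟩ : ∃ Θ : (Matrix (Fin d) (Fin d) ℂ)ˣ →* (Matrix ι ι ℂ)ˣ, ∀ g,
      (Θ g : Matrix ι ι ℂ) = P * (g : Matrix (Fin d) (Fin d) ℂ) * P' :=
    ⟨Units.map (conjHom P P' hP hP'), fun g => rfl⟩
  have hzu : ∀ g h, Commute (z g) (z h) := fun g h => Units.ext (hz g h)
  have hzΦ : ∀ g h, Commute (z g) (Φ h) := fun g h => Units.ext (by
    rw [Units.val_mul, Units.val_mul, hΦ]; exact hzφ g h)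
  refine ⟨{p : G × G // p.1 ∈ S ^ M ∧ p.2 ∈ S ^ M ∧ nm vC (A p.1 - A p.2) ≤ τ}, fun p => p.1.1⁻¹ * p.1.2,
    fun p => Θ ((z p.1.1)⁻¹ * z p.1.2), Θ.comp Φ, ?_, ?_, ?_, ?_, ?_⟩
  · intro g
    rw [MonoidHom.comp_apply, hΘ, hΦ]
  · refine (index_le_of_collision S h1 hS _ M ?_).1
    intro f hf
    obtain ⟨i, j, hij, h⟩ := hcov (fun i => A (f i)) (fun i => by rw [hA]; exact (hb _ (hf i)).1)
    exact ⟨i, j, hij, Subgroup.subset_closure ⟨⟨(f i, f j), hf i, hf j, h⟩, rfl⟩⟩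
  · intro p q
    refine Commute.map ?_ Θ
    exact (((hzu _ _).inv_inv).mul_right ((hzu _ _).inv_left)).mul_left (((hzu _ _).inv_right).mul_right (hzu _ _))
  · intro p g
    rw [MonoidHom.comp_apply]
    refine Commute.map ?_ Θ
    exact ((hzΦ _ _).inv_left).mul_left (hzΦ _ _)
  · rintro ⟨⟨u, w⟩, hu, hw, huw⟩
    simp only at hu hw huw
    have e0 : Θ.comp Φ (u⁻¹ * w) * Θ ((z u)⁻¹ * z w) = Θ (Φ u⁻¹ * (z u)⁻¹) * Θ (Φ w * z w) := by
      rw [MonoidHom.comp_apply, ← map_mul, ← map_mul]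
      congr 1
      rw [map_mul]
      have := ((hzΦ u w).inv_left).eq
      calc Φ u⁻¹ * Φ w * ((z u)⁻¹ * z w) = Φ u⁻¹ * (Φ w * (z u)⁻¹) * z w := by simp only [mul_assoc]
        _ = _ := by rw [← this]; simp only [mul_assoc]
    have e1 : Θ (Φ u⁻¹ * (z u)⁻¹) * Θ (Φ u * z u) = 1 := by
      rw [← map_mul]
      have := ((hzΦ u u).inv_left).eq
      have h2 : Φ u⁻¹ * (z u)⁻¹ * (Φ u * z u) = 1 := by
        calc _ = Φ u⁻¹ * ((z u)⁻¹ * Φ u) * z u := by simp only [mul_assoc]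
          _ = 1 := by rw [this, map_inv]; group
      rw [h2, map_one]
    have e2 : ∀ w, ((Θ (Φ w * z w) : (Matrix ι ι ℂ)ˣ) : Matrix ι ι ℂ) = A w := by
      intro w
      rw [hΘ, hA, Units.val_mul, hΦ]
    have e3 := congrArg (Units.val) e1
    rw [Units.val_mul, Units.val_one, e2] at e3
    show nm vC (((Θ.comp Φ (u⁻¹ * w) * Θ ((z u)⁻¹ * z w) : (Matrix ι ι ℂ)ˣ) : Matrix ι ι ℂ) - 1) ≤ η
    rw [e0, Units.val_mul, e2, ← e3, ← mul_sub]
    refine (nm_mul_le_of vC (a := R) (b := τ) ?_ ?_).trans hR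
    · rw [hΘ, Units.val_mul, hΦ]; exact (hb u hu).2
    · rw [← nm_neg, neg_sub]; exact huw

end EG

theorem entropy_gap_discrete_subgroups (d : ℕ) (hd : 1 ≤ d) :
    ∃ s : ℝ, 0 < s ∧
      ∀ (n : ℕ) (k : Fin n → Type)
        [∀ i, NontriviallyNormedField (k i)] [∀ i, CompleteSpace (k i)]
        [∀ i, LocallyCompactSpace (k i)],
        (∀ (i : Fin n) (x y : k i), ‖x + y‖ ≤ max ‖x‖ ‖y‖) →
        ∀ Γ : Subgroup (GL (Fin d) ℝ × ((i : Fin n) → GL (Fin d) (k i))),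
          Group.FG Γ → DiscreteTopology Γ →
          (¬ ∃ H : Subgroup Γ, H.FiniteIndex ∧ Group.IsNilpotent ↥H) →
          ∀ S : Finset Γ, (1 : Γ) ∈ S → Subgroup.closure (S : Set Γ) = ⊤ →
            s ≤ Filter.liminf
                  (fun m : ℕ => Real.log (((S : Set Γ) ^ m).ncard) / m) Filter.atTop := by
  obtain ⟨N1, I, hNA⟩ := EG.NA d hd
  obtain ⟨e, he⟩ : ∃ e, e = Nat.factorial I := ⟨_, rfl⟩
  have he1 : 1 ≤ e := by rw [he]; exact Nat.factorial_pos I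
  obtain ⟨η, hη, hnear⟩ := EG.near_nilp d e he1
  obtain ⟨R, hR, hLD⟩ := EG.LD d hd
  obtain ⟨τ, hτ, hRτ⟩ : ∃ τ : ℝ, 0 < τ ∧ R * τ ≤ η := by
    refine ⟨η / (R + 1), by positivity, ?_⟩
    rw [mul_div_assoc', div_le_iff₀ (by positivity)]
    nlinarith
  obtain ⟨M, hM, hcov⟩ := EG.cover d R τ hτ
  obtain ⟨N2, m, hm, hLDAt⟩ := hLD M hM
  obtain ⟨N, hNd⟩ : ∃ N, N = N1 + N2 + 1 := ⟨_, rfl⟩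
  have hN1 : 1 ≤ N := by omega
  refine ⟨Real.log 2 / (2 * N), ?_, ?_⟩
  · have : (0:ℝ) < N := by exact_mod_cast hN1
    have := Real.log_pos (show (1:ℝ) < 2 by norm_num)
    positivity
  intro n k _ _ _ hk Γ _ hdisc hnot S h1 hS
  have hfin : (S : Set Γ).Finite := S.finite_toSet
  have h1' : (1 : Γ) ∈ (S : Set Γ) := h1
  by_cases hN : EG.NoFree (S : Set Γ) N
  swap
  · exact EG.entropy_of_freePair (S : Set Γ) hfin h1' N hN1 hN
  exfalso
  apply hnot
  have hNF1 : EG.NoFree (S : Set Γ) N1 := EG.NoFree.mono h1' (by omega) hN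
  have hNF2 : EG.NoFree (S : Set Γ) N2 := EG.NoFree.mono h1' (by omega) hN
  -- non-archimedean places
  obtain ⟨ρ, hρ⟩ : ∃ ρ : (l : Fin n) → Γ →* GL (Fin d) (k l), ∀ l γ, ρ l γ = γ.1.2 l :=
    ⟨fun l => (Pi.evalMonoidHom _ l).comp ((MonoidHom.snd _ _).comp Γ.subtype), fun l γ => rfl⟩
  have hloc := fun l => hNA.local (k l) (hk l) Γ (S : Set Γ) hfin h1' hS hNF1 (ρ l)
  choose Hl Tl hl0 hlI hlT C' hC' using hloc
  have hpow : ∀ (x : Γ) l, x ^ e ∈ Hl l := by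
    intro x l
    refine Subgroup.pow_mem_of_index_ne_zero_of_dvd (hl0 l) x ?_
    intro j hj hj'
    rw [he]
    exact Nat.dvd_factorial hj (hj'.trans (hlI l))
  -- the real place
  obtain ⟨φ, hφ⟩ : ∃ φ : Γ →* Matrix (Fin d) (Fin d) ℂ, ∀ γ i j, φ γ i j = ((γ.1.1 : Matrix (Fin d) (Fin d) ℝ) i j : ℂ) :=
    ⟨(Complex.ofRealHom.mapMatrix : Matrix (Fin d) (Fin d) ℝ →+* Matrix (Fin d) (Fin d) ℂ).toMonoidHom.comp
      ((Units.coeHom _).comp ((MonoidHom.fst _ _).comp Γ.subtype)), fun γ i j => rfl⟩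
  have hφn : ∀ γ i j, ‖φ γ i j‖ = ‖(γ.1.1 : Matrix (Fin d) (Fin d) ℝ) i j‖ := by
    intro γ i j; rw [hφ, Complex.norm_real]
  have hfinT : ∀ C : ℝ, {γ : Γ | (∀ i j, ‖φ γ i j‖ ≤ C) ∧ (∀ i j, ‖φ γ⁻¹ i j‖ ≤ C) ∧ ∀ l, γ ∈ Tl l}.Finite := by
    intro C
    refine (EG.discrete_finite Γ hdisc C C').subset ?_
    rintro γ ⟨a, b, c⟩
    refine ⟨?_, ?_, ?_⟩
    · intro i j; rw [← hφn]; exact a i j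
    · intro i j; have := b i j; rw [hφn] at this; exact this
    · intro l
      refine ⟨?_, ?_⟩
      · intro i j; have := hC' l γ (c l) i j; rw [hρ] at this; exact this
      · intro i j; have := hC' l γ⁻¹ (inv_mem (c l)) i j; rw [hρ] at this; exact this
  obtain ⟨G, iG, f, S', hfi, hfr, hS'f, hS'1, hS'g, -, ι, i1, i2, P, P', z, hcard, hPP, hPP', hzz, hzφ, hb⟩ :=
    hLDAt ℂ EG.vC EG.vC_nontrivial Γ (S : Set Γ) hfin h1' hS hNF2 φ
  obtain ⟨J, a, ζ, Ψ, hΨ, hind, hζζ, hζΨ, hclose⟩ := EG.real_step P P' hPP hPP' (φ.comp f) z hzz hzφ S' hS'1 hS'g M R τ η hRτ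
    hb (hcov ι hcard)
  have hback : ∀ g, φ (f g) = P' * (Ψ g : Matrix ι ι ℂ) * P := by
    intro g
    rw [hΨ, MonoidHom.comp_apply]
    calc φ (f g) = 1 * φ (f g) * 1 := by rw [Matrix.one_mul, Matrix.mul_one]
      _ = (P' * P) * φ (f g) * (P' * P) := by rw [hPP']
      _ = _ := by simp only [Matrix.mul_assoc]
  -- the gap
  obtain ⟨E, hE⟩ : ∃ E : Set G, E = {g | (∀ l, f g ∈ Tl l) ∧ EG.nm EG.vC ((Ψ g : Matrix ι ι ℂ) - 1) ≤ 1 / 2 ∧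
    EG.nm EG.vC (((Ψ g)⁻¹ : (Matrix ι ι ℂ)ˣ) - 1 : Matrix ι ι ℂ) ≤ 2 * d + d} := ⟨_, rfl⟩
  have hEfin : E.Finite := by
    obtain ⟨C, hC⟩ : ∃ C : ℝ, C = EG.nm EG.vC P' * ((1 / 2 + (2 * d + d)) + d) * EG.nm EG.vC P := ⟨_, rfl⟩
    have hbd : ∀ g, EG.nm EG.vC ((Ψ g : Matrix ι ι ℂ) - 1) ≤ 1 / 2 + (2 * d + d) → ∀ i j, ‖φ (f g) i j‖ ≤ C := by
      intro g hg i j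
      have h2 : EG.nm EG.vC (Ψ g : Matrix ι ι ℂ) ≤ (1 / 2 + (2 * d + d)) + d := by
        have h3 := EG.nm_add_le EG.vC ((Ψ g : Matrix ι ι ℂ) - 1) 1
        rw [sub_add_cancel, EG.nm_one, hcard] at h3
        linarith
      refine (EG.entry_le EG.vC (φ (f g)) i j).trans ?_
      rw [hback, hC]
      exact EG.nm_mul_le_of EG.vC (EG.nm_mul_le_of EG.vC le_rfl h2) le_rfl
    refine Set.Finite.of_finite_image ((hfinT C).subset ?_) (hfi.injOn (s := E))
    rintro _ ⟨g, hg, rfl⟩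
    rw [hE] at hg
    obtain ⟨g1, g2, g3⟩ := hg
    have hd0 : (0:ℝ) ≤ d := Nat.cast_nonneg d
    refine ⟨hbd g (by linarith), ?_, g1⟩
    rw [← map_inv]
    refine hbd g⁻¹ ?_
    rw [map_inv]
    linarith
  obtain ⟨δ, hδ, hgap⟩ := EG.gap E hEfin (fun g => EG.nm EG.vC ((Ψ g : Matrix ι ι ℂ) - 1))
  have hnil := hnear ι hcard (Set.range fun i => Ψ (a i) * ζ i) (by rintro _ ⟨i, rfl⟩; exact hclose i) (by
    refine ⟨δ, hδ, ?_⟩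
    intro j hj c hc c1 c2 c3
    obtain ⟨j', rfl⟩ : ∃ j', j = j' + 1 := ⟨j - 1, by omega⟩
    obtain ⟨g, hg, rfl⟩ := EG.LN_central Ψ a ζ e hζζ hζΨ j' c hc
    have hgE : g ∈ E := by
      rw [hE]
      refine ⟨fun l => ?_, c1, c2⟩
      refine EG.LN_sub (H := (Hl l).comap f) (T := (Tl l).comap f) ?_ ?_ j' g hg
      · rintro _ ⟨i, rfl⟩
        show f (a i ^ e) ∈ Hl l
        rw [map_pow]; exact hpow _ l
      · intro x hx y hy
        show f (x * y * x⁻¹ * y⁻¹) ∈ Tl l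
        simp only [map_mul, map_inv]
        exact hlT l _ hx _ hy
    have h0 := hgap g hgE c3
    have h00 := (EG.nm_eq_zero EG.vC).mp (le_antisymm h0 (EG.nm_nonneg _ _))
    exact Units.ext (by rw [Units.val_one]; exact sub_eq_zero.mp h00))
  have hnil2 := EG.nilp_of_central (fun i => Ψ (a i)) ζ hζζ (fun i j => hζΨ i (a j)) hnil
  obtain ⟨c, hc⟩ := (Subgroup.isNilpotent_iff_lowerCentralSeries _).mp hnil2
  obtain ⟨H, hH⟩ : ∃ H, H = Subgroup.closure (Set.range a) := ⟨_, rfl⟩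
  have hHmap : H.map Ψ = Subgroup.closure (Set.range fun i => Ψ (a i)) := by
    rw [hH, MonoidHom.map_closure, ← Set.range_comp]; rfl
  rw [← hHmap, ← Subgroup.map_lowerCentralSeries] at hc
  -- the finite index subgroup
  have hfinal : ((H.map f) ⊓ ⨅ l, Hl l).index ≠ 0 := by
    refine Subgroup.index_inf_ne_zero ?_ (Subgroup.index_iInf_ne_zero hl0)
    rw [Subgroup.index_map, (MonoidHom.ker_eq_bot_iff f).mpr hfi, sup_bot_eq]
    exact mul_ne_zero (by rw [hH]; exact hind) hfr
  refine EG.virt_nilp _ hfinal (c + 1) ((hfinT 1).subset ?_)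
  intro γ hγ
  have hγ1 : φ γ = 1 := by
    have h2 := Subgroup.lowerCentralSeries_mono (c+1) (inf_le_left : ((H.map f) ⊓ ⨅ l, Hl l) ≤ H.map f) hγ
    have h3 := Subgroup.lowerCentralSeries_antitone (H.map f) (Nat.le_succ c) h2
    rw [← Subgroup.map_lowerCentralSeries] at h3
    obtain ⟨g, hg, rfl⟩ := h3
    have h4 : Ψ g ∈ (H.lowerCentralSeries c).map Ψ := ⟨g, hg, rfl⟩
    rw [hc, Subgroup.mem_bot] at h4
    rw [hback, h4, Units.val_one, Matrix.mul_one, hPP']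
  have hγ2 : φ γ⁻¹ = 1 := by
    have h2 : φ γ * φ γ⁻¹ = 1 := by rw [← map_mul, mul_inv_cancel, map_one]
    rwa [hγ1, one_mul] at h2
  have hone : ∀ i j, ‖(1 : Matrix (Fin d) (Fin d) ℂ) i j‖ ≤ 1 := by
    intro i j
    rw [Matrix.one_apply]
    split_ifs <;> simp
  refine ⟨by rw [hγ1]; exact hone, by rw [hγ2]; exact hone, fun l => ?_⟩
  have h2 := Subgroup.lowerCentralSeries_antitone _ (show 1 ≤ c + 1 by omega) hγ
  have h3 : Subgroup.lowerCentralSeries ((H.map f) ⊓ ⨅ l, Hl l) 1 ≤ Tl l := by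
    rw [Subgroup.lowerCentralSeries_succ, Subgroup.lowerCentralSeries_zero, Subgroup.commutator_le]
    intro x hx y hy
    exact hlT l x ((Subgroup.mem_iInf.mp hx.2) l) y ((Subgroup.mem_iInf.mp hy.2) l)
  exact h3 h2
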